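/- Let H be a real Hilbert space, let E ⊆ H be a nonempty bounded set, and let G be a multiresolution family for E with inflation factor A ≥ 240. Then E is contained in some rectifiable curve in H if and only if Σ_{Q ∈ G} β_E(Q)²·diam Q < ∞. Furthermore, there exists a constant C > 0 depending only on A such that, whenever Σ_{Q ∈ G} β_E(Q)²·diam Q < ∞, the set E is contained in a rectifiable curve Γ with H^1(Γ) ≤ C·(diam E + Σ_{Q ∈ G} β_E(Q)²·diam Q). -/

import Mathlib

open Metric MeasureTheory Set Bornology
open scoped ENNReal NNReal Classical

universe u

noncomputable section

/-- The affine line through `a` with direction `v`. -/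
def lineThrough {X : Type u} [AddCommGroup X] [Module ℝ X] (a v : X) : Set X :=
  {y | ∃ t : ℝ, y = a + t • v}

/-- The Jones beta number of `E` in the window `Q`:
`β_E(Q) = inf_L sup_{x ∈ E ∩ Q} dist(x,L)/diam Q`, with value `0` if `E ∩ Q = ∅`. -/
def jonesBeta {X : Type u} [NormedAddCommGroup X] [NormedSpace ℝ X] (E Q : Set X) : ℝ :=
  if E ∩ Q = ∅ then 0
  else sInf {r : ℝ | ∃ a v : X, v ≠ 0 ∧
    r = sSup ((fun x => infDist x (lineThrough a v) / Metric.diam Q) '' (E ∩ Q))}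

/-- `net` encodes a partial multiresolution family for `E`: a nested family of
`2^{-k}`-separated subsets of `E`. -/
def IsPartialMultiresolution {X : Type u} [NormedAddCommGroup X]
    (E : Set X) (net : ℤ → Set X) : Prop :=
  (∀ k, net k ⊆ E) ∧ (∀ k, net k ⊆ net (k + 1)) ∧
    (∀ k : ℤ, ∀ x ∈ net k, ∀ y ∈ net k, x ≠ y → (2 : ℝ) ^ (-k) ≤ dist x y)

/-- `net` encodes a multiresolution family for `E`: a nested family of `2^{-k}`-nets for `E`. -/
def IsMultiresolution {X : Type u} [NormedAddCommGroup X]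
    (E : Set X) (net : ℤ → Set X) : Prop :=
  IsPartialMultiresolution E net ∧ ∀ k : ℤ, ∀ e ∈ E, ∃ x ∈ net k, dist e x ≤ (2 : ℝ) ^ (-k)

/-- The sum `Σ_{Q ∈ G} β_E(Q)^p · diam Q` over the (partial) multiresolution family
`G = {B(x, A·2^{-k}) : x ∈ net k, k ∈ ℤ}` with inflation factor `A`. -/
def betaSum {X : Type u} [NormedAddCommGroup X] [NormedSpace ℝ X]
    (E : Set X) (net : ℤ → Set X) (A p : ℝ) : ℝ≥0∞ :=
  ∑' (k : ℤ), ∑' (x : net k),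
    ENNReal.ofReal (jonesBeta E (closedBall (x : X) (A * (2 : ℝ) ^ (-k))) ^ p *
      Metric.diam (closedBall (x : X) (A * (2 : ℝ) ^ (-k))))

/-- `S_{E,p}(G) = diam E + Σ_{Q ∈ G} β_E(Q)^p · diam Q`. -/
def SEp {X : Type u} [NormedAddCommGroup X] [NormedSpace ℝ X]
    (E : Set X) (net : ℤ → Set X) (A p : ℝ) : ℝ≥0∞ :=
  ENNReal.ofReal (Metric.diam E) + betaSum E net A p

/-- `Γ` is a rectifiable curve: the image of a continuous map `[0,1] → X` with
finite one-dimensional Hausdorff measure. -/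
def IsRectifiableCurve {X : Type u} [NormedAddCommGroup X]
    [MeasurableSpace X] [BorelSpace X] (Γ : Set X) : Prop :=
  (∃ f : ℝ → X, ContinuousOn f (Set.Icc (0 : ℝ) 1) ∧ Γ = f '' Set.Icc (0 : ℝ) 1) ∧
    μH[1] Γ < ⊤

/-- The length of the polygonal path through the points of a list. -/
def pathLen {X : Type*} [PseudoMetricSpace X] : List X → ℝ
  | [] => 0
  | [_] => 0
  | a :: b :: l => dist a b + pathLen (b :: l)

section Paths

variable {X : Type*} [MetricSpace X]

lemma exists_param_of_list (l : List X) :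
    ∃ τ : X → ℝ, (∀ x ∈ l, τ x ∈ Icc 0 (pathLen l)) ∧
      (∀ x ∈ l, ∀ y ∈ l, dist x y ≤ |τ x - τ y|) ∧ ∀ a ∈ l.head?, τ a = 0 := by
  induction l with
  | nil => exact ⟨fun _ => 0, by simp, by simp, by simp⟩
  | cons a l ih =>
    cases l with
    | nil => exact ⟨fun _ => 0, by simp [pathLen], by simp, by simp⟩
    | cons b l =>
      obtain ⟨τ, h1, h2, h3⟩ := ih
      have hb : τ b = 0 := h3 b (by simp)
      have hd : 0 ≤ dist a b := dist_nonneg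
      have key : ∀ y ∈ b :: l, dist a y ≤ τ y + dist a b := by
        intro y hy
        have h4 := h2 b (by simp) y hy
        have h5 := (h1 y hy).1
        rw [hb, zero_sub, abs_neg, abs_of_nonneg h5] at h4
        linarith [dist_triangle a b y]
      refine ⟨fun x => if x = a then 0 else τ x + dist a b, ?_, ?_, by simp⟩
      · intro x hx
        have hp : 0 ≤ pathLen (b :: l) := (h1 b (by simp)).1.trans (h1 b (by simp)).2
        by_cases hxa : x = a
        · simp only [hxa, if_true, pathLen]
          exact ⟨le_rfl, by linarith⟩
        · have := h1 x (by simpa [hxa] using hx)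
          simp only [hxa, if_false, pathLen]
          exact ⟨by linarith [this.1], by linarith [this.2]⟩
      · intro x hx y hy
        by_cases hxa : x = a <;> by_cases hya : y = a
        · simp [hxa, hya]
        · have hy' : y ∈ b :: l := by simpa [hya] using hy
          have h5 := (h1 y hy').1
          simp only [hxa, hya, if_true, if_false, zero_sub, abs_neg]
          rw [abs_of_nonneg (by linarith)]
          exact key y hy'
        · have hx' : x ∈ b :: l := by simpa [hxa] using hx
          have h5 := (h1 x hx').1
          simp only [hxa, hya, if_true, if_false, sub_zero]
          rw [abs_of_nonneg (by linarith), dist_comm]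
          exact key x hx'
        · simp only [hxa, hya, if_false, add_sub_add_right_eq_sub]
          exact h2 x (by simpa [hxa] using hx) y (by simpa [hya] using hy)

lemma exists_param_of_finite {E : Set X} {L : ℝ}
    (h : ∀ F : Finset X, (F : Set X) ⊆ E → ∃ l : List X, (∀ x ∈ F, x ∈ l) ∧ pathLen l ≤ L) :
    ∃ τ : X → ℝ, (∀ x ∈ E, τ x ∈ Icc 0 L) ∧ ∀ x ∈ E, ∀ y ∈ E, dist x y ≤ |τ x - τ y| := by
  have h' : ∀ F : Finset E, ∃ τ : X → ℝ, (∀ x ∈ F, τ x ∈ Icc 0 L) ∧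
      ∀ x ∈ F, ∀ y ∈ F, dist x y ≤ |τ x - τ y| := by
    intro F
    obtain ⟨l, hl, hL⟩ := h (F.map (Function.Embedding.subtype _)) (by
      intro x hx
      simp only [Finset.coe_map, mem_image] at hx
      obtain ⟨y, -, rfl⟩ := hx
      exact y.2)
    obtain ⟨τ, h1, h2, -⟩ := exists_param_of_list l
    have hm : ∀ x ∈ F, (x : X) ∈ l := fun x hx => hl x (by simpa using hx)
    exact ⟨τ, fun x hx => ⟨(h1 x (hm x hx)).1, (h1 x (hm x hx)).2.trans hL⟩,
      fun x hx y hy => h2 x (hm x hx) y (hm y hy)⟩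
  choose T hT1 hT2 using h'
  let U : Ultrafilter (Finset E) := Ultrafilter.of Filter.atTop
  have hU : (U : Filter (Finset E)) ≤ Filter.atTop := Ultrafilter.of_le _
  have hlim : ∀ x : E, ∃ t ∈ Icc 0 L, Filter.Tendsto (fun F => T F x) U (nhds t) := by
    intro x
    have : ∀ᶠ F in (U : Filter (Finset E)), T F x ∈ Icc 0 L := by
      apply hU
      filter_upwards [Filter.eventually_ge_atTop {x}] with F hF
      exact hT1 F x (by simpa using hF)
    obtain ⟨t, ht, h⟩ := (isCompact_Icc (a := (0:ℝ)) (b := L)).ultrafilter_le_nhds'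
      (U.map fun F => T F x) this
    exact ⟨t, ht, h⟩
  choose t ht1 ht2 using hlim
  refine ⟨fun x => if hx : x ∈ E then t ⟨x, hx⟩ else 0, fun x hx => by simpa [hx] using ht1 _, ?_⟩
  intro x hx y hy
  simp only [hx, hy, dif_pos]
  refine ge_of_tendsto ((ht2 ⟨x, hx⟩).sub (ht2 ⟨y, hy⟩)).abs ?_
  apply hU
  filter_upwards [Filter.eventually_ge_atTop {⟨x, hx⟩, ⟨y, hy⟩}] with F hF
  exact hT2 F ⟨x, hx⟩ (hF (by simp)) ⟨y, hy⟩ (hF (by simp))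

lemma pathLen_append_cons (l₁ l₂ : List X) (s : X) :
    pathLen (l₁ ++ s :: l₂) = pathLen (l₁ ++ [s]) + pathLen (s :: l₂) := by
  induction l₁ with
  | nil => simp [pathLen]
  | cons a l ih =>
    cases l with
    | nil => simp [pathLen]
    | cons b l =>
      simp only [List.cons_append, pathLen] at ih ⊢
      rw [ih]; ring

/-- A closed walk in the graph with edge set `G`, using a tree of edges `T`. -/
structure IsTour (G : Finset (X × X)) (x₀ : X) (l : List X) (T : Finset (X × X)) : Prop where
  base_mem : x₀ ∈ l
  subset : T ⊆ G
  mem : ∀ e ∈ T, e.1 ∈ l ∧ e.2 ∈ l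
  len : pathLen l ≤ 2 * ∑ e ∈ T, dist e.1 e.2
  card : T.card + 1 ≤ l.toFinset.card
  reach : ∀ x ∈ l, Relation.ReflTransGen (fun a b => (a, b) ∈ G ∨ (b, a) ∈ G) x₀ x

lemma IsTour.insert {G : Finset (X × X)} {x₀ : X} {l : List X} {T : Finset (X × X)}
    (h : IsTour G x₀ l T) {s v : X} (hs : s ∈ l) (hv : v ∉ l) {e : X × X} (he : e ∈ G)
    (hev : e = (s, v) ∨ e = (v, s)) :
    ∃ l' T', IsTour G x₀ l' T' ∧ (∀ x ∈ l, x ∈ l') ∧ v ∈ l' := by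
  obtain ⟨l₁, l₂, rfl⟩ := List.append_of_mem hs
  have hm : ∀ x, x ∈ l₁ ++ s :: v :: s :: l₂ ↔ x = v ∨ x ∈ l₁ ++ s :: l₂ := by
    intro x; simp only [List.mem_append, List.mem_cons]; tauto
  have heT : e ∉ T := by
    intro heT
    have := h.mem e heT
    rcases hev with rfl | rfl
    · exact hv this.2
    · exact hv this.1
  have hd : dist e.1 e.2 = dist s v := by
    rcases hev with rfl | rfl
    · rfl
    · exact dist_comm _ _
  refine ⟨l₁ ++ s :: v :: s :: l₂, Insert.insert e T, ⟨?_, ?_, ?_, ?_, ?_, ?_⟩, ?_, ?_⟩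
  · exact (hm _).2 (Or.inr h.base_mem)
  · exact Finset.insert_subset he h.subset
  · intro e' he'
    rcases Finset.mem_insert.1 he' with rfl | he'
    · rcases hev with rfl | rfl
      · exact ⟨(hm _).2 (Or.inr hs), (hm _).2 (Or.inl rfl)⟩
      · exact ⟨(hm _).2 (Or.inl rfl), (hm _).2 (Or.inr hs)⟩
    · exact ⟨(hm _).2 (Or.inr (h.mem e' he').1), (hm _).2 (Or.inr (h.mem e' he').2)⟩
  · rw [Finset.sum_insert heT, hd]
    have h1 := h.len
    rw [pathLen_append_cons] at h1 ⊢
    simp only [pathLen, dist_comm v s] at h1 ⊢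
    linarith
  · rw [Finset.card_insert_of_notMem heT]
    have : (l₁ ++ s :: v :: s :: l₂).toFinset = Insert.insert v (l₁ ++ s :: l₂).toFinset := by
      ext x
      rw [List.mem_toFinset, hm, Finset.mem_insert, List.mem_toFinset]
    rw [this, Finset.card_insert_of_notMem (by rwa [List.mem_toFinset])]
    linarith [h.card]
  · intro x hx
    rcases (hm x).1 hx with rfl | hx
    · refine (h.reach s hs).tail ?_
      rcases hev with rfl | rfl
      · exact Or.inl he
      · exact Or.inr he
    · exact h.reach x hx
  · exact fun x hx => (hm _).2 (Or.inr hx)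
  · exact (hm _).2 (Or.inl rfl)

lemma IsTour.extend {G : Finset (X × X)} {x₀ : X} {l : List X} {T : Finset (X × X)}
    (h : IsTour G x₀ l T) {z : X}
    (hz : Relation.ReflTransGen (fun a b => (a, b) ∈ G ∨ (b, a) ∈ G) x₀ z) :
    ∃ l' T', IsTour G x₀ l' T' ∧ (∀ x ∈ l, x ∈ l') ∧ z ∈ l' := by
  induction hz with
  | refl => exact ⟨l, T, h, fun _ hx => hx, h.base_mem⟩
  | @tail b c _ hbc ih =>
    obtain ⟨l', T', h', hl, hb⟩ := ih
    by_cases hc : c ∈ l'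
    · exact ⟨l', T', h', hl, hc⟩
    · rcases hbc with hbc | hbc
      · obtain ⟨l'', T'', h1, h2, h3⟩ := h'.insert hb hc hbc (Or.inl rfl)
        exact ⟨l'', T'', h1, fun x hx => h2 x (hl x hx), h3⟩
      · obtain ⟨l'', T'', h1, h2, h3⟩ := h'.insert hb hc hbc (Or.inr rfl)
        exact ⟨l'', T'', h1, fun x hx => h2 x (hl x hx), h3⟩

lemma exists_tour (G : Finset (X × X)) (x₀ : X) (Z : Finset X)
    (hZ : ∀ z ∈ Z, Relation.ReflTransGen (fun a b => (a, b) ∈ G ∨ (b, a) ∈ G) x₀ z) :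
    ∃ l T, IsTour G x₀ l T ∧ ∀ z ∈ Z, z ∈ l := by
  induction Z using Finset.induction_on with
  | empty =>
    refine ⟨[x₀], ∅, ⟨by simp, by simp, by simp, by simp [pathLen], by simp, ?_⟩, by simp⟩
    intro x hx
    rw [List.mem_singleton.1 hx]
  | insert a s _ ih =>
    obtain ⟨l, T, h, hl⟩ := ih fun z hz => hZ z (Finset.mem_insert_of_mem hz)
    obtain ⟨l', T', h', h2, h3⟩ := h.extend (hZ a (Finset.mem_insert_self _ _))
    refine ⟨l', T', h', fun z hz => ?_⟩
    rcases Finset.mem_insert.1 hz with rfl | hz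
    · exact h3
    · exact h2 z (hl z hz)

end Paths

section Extension

variable {H : Type*} [NormedAddCommGroup H] [NormedSpace ℝ H]

lemma exists_lipschitz_extension_of_isClosed {C : Set ℝ} (hC : IsClosed C)
    (hl : ∀ t, ∃ s ∈ C, s ≤ t) (hr : ∀ t, ∃ s ∈ C, t ≤ s) {g : ℝ → H}
    (hg : ∀ s ∈ C, ∀ t ∈ C, dist (g s) (g t) ≤ |s - t|) :
    ∃ f : ℝ → H, LipschitzWith 1 f ∧ ∀ t ∈ C, f t = g t := by
  have hL : ∀ t, ∃ a ∈ C, a ≤ t ∧ ∀ c ∈ C, c ≤ t → c ≤ a := by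
    intro t
    obtain ⟨s, hs, hst⟩ := hl t
    have hbd : BddAbove (C ∩ Iic t) := ⟨t, fun x hx => hx.2⟩
    have hm := (hC.inter isClosed_Iic).csSup_mem ⟨s, hs, hst⟩ hbd
    exact ⟨_, hm.1, hm.2, fun c hc hct => le_csSup hbd ⟨hc, hct⟩⟩
  have hR : ∀ t, ∃ a ∈ C, t ≤ a ∧ ∀ c ∈ C, t ≤ c → a ≤ c := by
    intro t
    obtain ⟨s, hs, hst⟩ := hr t
    have hbd : BddBelow (C ∩ Ici t) := ⟨t, fun x hx => hx.2⟩
    have hm := (hC.inter isClosed_Ici).csInf_mem ⟨s, hs, hst⟩ hbd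
    exact ⟨_, hm.1, hm.2, fun c hc hct => csInf_le hbd ⟨hc, hct⟩⟩
  choose l hlC hlt hlmax using hL
  choose r hrC hrt hrmin using hR
  let f : ℝ → H := fun t => AffineMap.lineMap (g (l t)) (g (r t)) ((t - l t) / (r t - l t))
  have hfC : ∀ t ∈ C, f t = g t := by
    intro t ht
    have : l t = t := le_antisymm (hlt t) (hlmax t t ht le_rfl)
    simp [f, this]
  -- on one gap
  have hgap : ∀ s t, s ≤ t → l s = l t → r s = r t → dist (f s) (f t) ≤ t - s := by
    intro s t hst h1 h2
    simp only [f, h1, h2]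
    rw [dist_lineMap_lineMap]
    rcases eq_or_lt_of_le ((hlt t).trans (hrt t)) with h | h
    · have : s = t := by
        apply le_antisymm hst
        have := hlt s; have := hrt t; linarith
      simp [this]
    · have hpos : 0 < r t - l t := sub_pos.2 h
      have h3 := hg _ (hlC t) _ (hrC t)
      rw [abs_sub_comm, abs_of_pos hpos] at h3
      have h4 : dist ((s - l t) / (r t - l t)) ((t - l t) / (r t - l t)) =
          (t - s) / (r t - l t) := by
        rw [Real.dist_eq, ← sub_div, abs_div, abs_of_pos hpos, abs_sub_comm]
        rw [abs_of_nonneg] <;> [ring; linarith]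
      rw [h4]
      calc _ ≤ (t - s) / (r t - l t) * (r t - l t) := by
              apply mul_le_mul_of_nonneg_left h3
              exact div_nonneg (by linarith) hpos.le
        _ = t - s := by field_simp
  have hleft : ∀ t, dist (f (l t)) (f t) ≤ t - l t := by
    intro t
    rcases eq_or_lt_of_le (hlt t) with h | h
    · rw [h]; simp
    rw [hfC _ (hlC t)]
    rcases eq_or_lt_of_le (hrt t) with h' | h'
    · have : t ∈ C := h' ▸ hrC t
      rw [hfC _ this]
      have := hg _ (hlC t) _ this
      rwa [abs_sub_comm, abs_of_pos (by linarith)] at this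
    have hpos : 0 < r t - l t := by linarith
    simp only [f]
    rw [dist_left_lineMap, Real.norm_eq_abs, abs_div, abs_of_pos hpos, abs_of_pos (by linarith)]
    have h3 := hg _ (hlC t) _ (hrC t)
    rw [abs_sub_comm, abs_of_pos hpos] at h3
    calc _ ≤ (t - l t) / (r t - l t) * (r t - l t) := by
              apply mul_le_mul_of_nonneg_left h3
              exact div_nonneg (by linarith) hpos.le
        _ = t - l t := by field_simp
  have hright : ∀ t, dist (f t) (f (r t)) ≤ r t - t := by
    intro t
    rcases eq_or_lt_of_le (hrt t) with h | h
    · rw [← h]; simp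
    rw [hfC _ (hrC t)]
    rcases eq_or_lt_of_le (hlt t) with h' | h'
    · have : t ∈ C := h' ▸ hlC t
      rw [hfC _ this]
      have := hg _ this _ (hrC t)
      rwa [abs_sub_comm, abs_of_pos (by linarith)] at this
    have hpos : 0 < r t - l t := by linarith
    simp only [f]
    rw [dist_lineMap_right, Real.norm_eq_abs]
    have h3 := hg _ (hlC t) _ (hrC t)
    rw [abs_sub_comm, abs_of_pos hpos] at h3
    have : 1 - (t - l t) / (r t - l t) = (r t - t) / (r t - l t) := by field_simp; ring
    rw [this, abs_div, abs_of_pos hpos, abs_of_pos (by linarith)]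
    calc _ ≤ (r t - t) / (r t - l t) * (r t - l t) := by
              apply mul_le_mul_of_nonneg_left h3
              exact div_nonneg (by linarith) hpos.le
        _ = r t - t := by field_simp
  have hmain : ∀ s t, s ≤ t → dist (f s) (f t) ≤ t - s := by
    intro s t hst
    by_cases h : r s ≤ t
    · have h1 : r s ≤ l t := hlmax t _ (hrC s) h
      have h2 := hg _ (hrC s) _ (hlC t)
      rw [abs_sub_comm, abs_of_nonneg (by linarith), ← hfC _ (hrC s), ← hfC _ (hlC t)] at h2
      have := dist_triangle4 (f s) (f (r s)) (f (l t)) (f t)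
      linarith [hright s, hleft t]
    · push Not at h
      have h1 : r s = r t := le_antisymm (hrmin s _ (hrC t) (hst.trans (hrt t)))
        (hrmin t _ (hrC s) h.le)
      have h2 : l t ≤ s := by
        by_contra hc
        push Not at hc
        have := hrmin s _ (hlC t) hc.le
        linarith [hlt t]
      have h3 : l s = l t := le_antisymm (hlmax t _ (hlC s) ((hlt s).trans hst))
        (hlmax s _ (hlC t) h2)
      exact hgap s t hst h3 h1
  refine ⟨f, LipschitzWith.of_dist_le_mul ?_, hfC⟩
  intro s t
  rw [NNReal.coe_one, one_mul, Real.dist_eq]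
  rcases le_total s t with h | h
  · rw [abs_sub_comm, abs_of_nonneg (by linarith)]; exact hmain s t h
  · rw [dist_comm, abs_of_nonneg (by linarith)]; exact hmain t s h

lemma exists_lipschitz_extension [CompleteSpace H] {S : Set ℝ} {L : ℝ} (hS : S.Nonempty)
    (hSL : S ⊆ Icc 0 L) {g : ℝ → H}
    (hg : ∀ s ∈ S, ∀ t ∈ S, dist (g s) (g t) ≤ |s - t|) :
    ∃ f : ℝ → H, LipschitzWith 1 f ∧ ∀ t ∈ S, f t = g t := by
  have hgL : LipschitzOnWith 1 g S := LipschitzOnWith.of_dist_le_mul fun x hx y hy => by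
    simpa [Real.dist_eq] using hg x hx y hy
  have hcont : ContinuousOn (extendFrom S g) (closure S) := by
    apply continuousOn_extendFrom subset_rfl
    intro x hx
    have : (nhdsWithin x S).NeBot := mem_closure_iff_nhdsWithin_neBot.1 hx
    have h1 : Cauchy (nhdsWithin x S) := cauchy_nhds.mono nhdsWithin_le_nhds
    have h2 : Cauchy (Filter.map g (nhdsWithin x S)) := by
      rw [Metric.cauchy_iff] at h1 ⊢
      refine ⟨h1.1.map _, fun ε hε => ?_⟩
      obtain ⟨t, ht, h⟩ := h1.2 ε hε
      refine ⟨g '' (t ∩ S), Filter.image_mem_map (Filter.inter_mem ht self_mem_nhdsWithin), ?_⟩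
      rintro _ ⟨a, ha, rfl⟩ _ ⟨b, hb, rfl⟩
      exact (hg a ha.2 b hb.2).trans_lt (h a ha.1 b hb.1)
    exact CompleteSpace.complete h2
  have heq : ∀ t ∈ S, extendFrom S g t = g t := fun t ht =>
    extendFrom_extends hgL.continuousOn t ht
  have hL : LipschitzOnWith 1 (extendFrom S g) (closure S) := by
    rw [lipschitzOnWith_closure_iff hcont]
    intro x hx y hy
    rw [heq x hx, heq y hy]
    exact hgL hx hy
  have hcl : closure S ⊆ Icc 0 L := closure_minimal hSL isClosed_Icc
  have hcpt : IsCompact (closure S) := isCompact_Icc.of_isClosed_subset isClosed_closure hcl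
  obtain ⟨a, ha, hamin⟩ := hcpt.exists_isLeast hS.closure
  obtain ⟨b, hb, hbmax⟩ := hcpt.exists_isGreatest hS.closure
  have hab : a ≤ b := hamin hb
  let p : ℝ → ℝ := fun t => projIcc a b hab t
  have hp : Continuous p := continuous_subtype_val.comp continuous_projIcc
  have hpid : ∀ t ∈ closure S, p t = t := fun t ht => by
    simp only [p]; rw [projIcc_of_mem hab ⟨hamin ht, hbmax ht⟩]
  have hplip : ∀ s t, |p s - p t| ≤ |s - t| := fun s t => by
    have := (LipschitzWith.projIcc hab).dist_le_mul s t
    simpa [Real.dist_eq, Subtype.dist_eq] using this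
  obtain ⟨f, hf, hfe⟩ := exists_lipschitz_extension_of_isClosed (C := p ⁻¹' closure S)
    (isClosed_closure.preimage hp)
    (fun t => ⟨min t a, by simp only [mem_preimage, p]; rw
        [projIcc_of_le_left hab (min_le_right _ _)]; exact ha,
      min_le_left _ _⟩)
    (fun t => ⟨max t b, by simp only [mem_preimage, p]; rw [projIcc_of_right_le hab
        (le_max_right _ _)]; exact hb,
      le_max_left _ _⟩)
    (g := fun t => extendFrom S g (p t)) (fun s hs t ht => by
      refine le_trans ?_ (hplip s t)
      simpa [Real.dist_eq] using hL.dist_le_mul _ hs _ ht)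
  refine ⟨f, hf, fun t ht => ?_⟩
  have := hpid t (subset_closure ht)
  rw [hfe t (by rw [mem_preimage, this]; exact subset_closure ht)]
  simp only [this]
  exact heq t ht

/-- A set all of whose finite subsets lie on polygonal paths of length at most `L` lies on a
Lipschitz curve of length at most `L`. -/
lemma exists_lipschitz_curve [CompleteSpace H] {E : Set H} (hE : E.Nonempty) {L : ℝ}
    (h : ∀ F : Finset H, (F : Set H) ⊆ E → ∃ l : List H, (∀ x ∈ F, x ∈ l) ∧ pathLen l ≤ L) :
    0 ≤ L ∧ ∃ f : ℝ → H, LipschitzWith 1 f ∧ E ⊆ f '' Icc 0 L := by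
  obtain ⟨τ, h1, h2⟩ := exists_param_of_finite h
  obtain ⟨e, he⟩ := hE
  refine ⟨(h1 e he).1.trans (h1 e he).2, ?_⟩
  have hinj : InjOn τ E := fun x hx y hy hxy => by
    have := h2 x hx y hy
    rw [hxy, sub_self, abs_zero] at this
    exact dist_le_zero.1 this
  have : Nonempty H := ⟨0⟩
  have hinv := hinj.leftInvOn_invFunOn
  obtain ⟨f, hf, hfe⟩ := exists_lipschitz_extension (S := τ '' E) (L := L)
      ⟨_, mem_image_of_mem _ he⟩
    (by rintro _ ⟨x, hx, rfl⟩; exact h1 x hx) (g := Function.invFunOn τ E) (by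
      rintro _ ⟨x, hx, rfl⟩ _ ⟨y, hy, rfl⟩
      rw [hinv hx, hinv hy]
      exact h2 x hx y hy)
  exact ⟨f, hf, fun x hx => ⟨τ x, h1 x hx, by rw [hfe _ (mem_image_of_mem _ hx), hinv hx]⟩⟩

end Extension

section Tree

/-- Short edges count with their length, long edges with half their length. -/
def edgeWeight {H : Type*} [PseudoMetricSpace H] (ρ : ℝ) (e : H × H) : ℝ :=
  if dist e.1 e.2 ≤ ρ then dist e.1 e.2 else dist e.1 e.2 / 2

lemma edgeWeight_ge {H : Type*} [PseudoMetricSpace H] {ρ : ℝ} (e : H × H) : dist e.1 e.2 / 2 ≤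
    edgeWeight ρ e := by
  unfold edgeWeight
  have := dist_nonneg (x := e.1) (y := e.2)
  split_ifs <;> linarith

variable {H : Type*} [NormedAddCommGroup H] [InnerProductSpace ℝ H]

/-- `v` and `q` are joined by an edge of `G` of length at most `ρ`. -/
def ShortAdj (G : Finset (H × H)) (ρ : ℝ) (v q : H) : Prop :=
  ((v, q) ∈ G ∨ (q, v) ∈ G) ∧ dist v q ≤ ρ

/-- The vertex `v` has two short neighbours on opposite sides. -/
def TwoSided (G : Finset (H × H)) (ρ : ℝ) (v : H) : Prop :=
  ∃ q q', ShortAdj G ρ v q ∧ ShortAdj G ρ v q' ∧ inner ℝ (q - v) (q' - v) ≤ 0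

/-- The number of sides (`0`, `1` or `2`) on which `v` has no short neighbour. -/
def freeSides (G : Finset (H × H)) (ρ : ℝ) (v : H) : ℝ :=
  if TwoSided G ρ v then 0 else if ∃ q, ShortAdj G ρ v q then 1 else 2

/-- Total edge weight, plus a reserve `ph v` for every free side of every vertex `v`. -/
def potential (Z : Finset H) (G : Finset (H × H)) (ρ : ℝ) (ph : H → ℝ) : ℝ :=
  ∑ e ∈ G, edgeWeight ρ e + ∑ v ∈ Z, freeSides G ρ v * ph v

/-- `G` is a connected graph on the vertex set `Z` without loops. -/
structure IsConnGraph (x₀ : H) (Z : Finset H) (G : Finset (H × H)) : Prop where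
  mem : ∀ e ∈ G, e.1 ∈ Z ∧ e.2 ∈ Z
  ne : ∀ e ∈ G, e.1 ≠ e.2
  reach : ∀ z ∈ Z, Relation.ReflTransGen (fun a b => (a, b) ∈ G ∨ (b, a) ∈ G) x₀ z

variable {G G' : Finset (H × H)} {ρ ρ' : ℝ} {v : H}

lemma freeSides_nonneg : 0 ≤ freeSides G ρ v := by
  unfold freeSides; split_ifs <;> norm_num

lemma freeSides_le_two : freeSides G ρ v ≤ 2 := by
  unfold freeSides; split_ifs <;> norm_num

lemma freeSides_le_one {q : H} (h : ShortAdj G ρ v q) : freeSides G ρ v ≤ 1 := by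
  unfold freeSides
  rw [if_pos (⟨q, h⟩ : ∃ q, ShortAdj G ρ v q)]
  split_ifs <;> norm_num

lemma freeSides_eq_zero (h : TwoSided G ρ v) : freeSides G ρ v = 0 := by
  unfold freeSides; rw [if_pos h]

lemma freeSides_le_of_map (r : H → H)
    (h1 : ∀ q, ShortAdj G ρ v q → ShortAdj G' ρ' v (r q))
    (h2 : ∀ q q', ShortAdj G ρ v q → ShortAdj G ρ v q' → inner ℝ (q - v) (q' - v) ≤ 0 →
      inner ℝ (r q - v) (r q' - v) ≤ 0) :
    freeSides G' ρ' v ≤ freeSides G ρ v := by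
  by_cases ht : TwoSided G ρ v
  · obtain ⟨q, q', hq, hq', hqq⟩ := ht
    rw [freeSides_eq_zero ⟨r q, r q', h1 q hq, h1 q' hq', h2 q q' hq hq' hqq⟩]
    exact freeSides_nonneg
  · by_cases he : ∃ q, ShortAdj G ρ v q
    · obtain ⟨q, hq⟩ := he
      refine (freeSides_le_one (h1 q hq)).trans ?_
      unfold freeSides
      rw [if_neg ht, if_pos ⟨q, hq⟩]
    · refine freeSides_le_two.trans ?_
      unfold freeSides
      rw [if_neg ht, if_neg he]

lemma freeSides_mono (h : ∀ q, ShortAdj G ρ v q → ShortAdj G' ρ' v q) :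
    freeSides G' ρ' v ≤ freeSides G ρ v :=
  freeSides_le_of_map id h fun _ _ _ _ h => h

lemma freeSides_half_le (hG : ∀ e ∈ G, e.1 ≠ e.2) :
    freeSides G (ρ / 2) v ≤ freeSides G ρ v +
      ((G.filter fun e => ρ / 2 < dist e.1 e.2 ∧ dist e.1 e.2 ≤ ρ ∧ (e.1 = v ∨ e.2 = v)).card :
          ℝ) := by
  set S := G.filter fun e => ρ / 2 < dist e.1 e.2 ∧ dist e.1 e.2 ≤ ρ ∧ (e.1 = v ∨ e.2 = v) with hS
  have hsplit : ∀ q, ShortAdj G ρ v q → ShortAdj G (ρ / 2) v q ∨ (v, q) ∈ S ∨ (q, v) ∈ S := by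
    rintro q ⟨hq, hd⟩
    by_cases h : dist v q ≤ ρ / 2
    · exact Or.inl ⟨hq, h⟩
    · right
      push Not at h
      rcases hq with hq | hq
      · left; simp only [hS, Finset.mem_filter]; exact ⟨hq, h, hd, Or.inl trivial⟩
      · right; simp only [hS, Finset.mem_filter]; rw [dist_comm]; exact ⟨hq, h, hd, Or.inr trivial⟩
  rcases S.eq_empty_or_nonempty with h0 | h0
  · rw [h0]
    simp only [Finset.card_empty, Nat.cast_zero, add_zero]
    refine freeSides_mono fun q hq => ?_
    simpa [h0] using hsplit q hq
  · have h1 : (1 : ℝ) ≤ S.card := by exact_mod_cast h0.card_pos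
    by_cases h2 : 2 ≤ S.card
    · have : (2 : ℝ) ≤ S.card := by exact_mod_cast h2
      linarith [@freeSides_le_two _ _ _ G (ρ / 2) v, @freeSides_nonneg _ _ _ G ρ v]
    · have hc : S.card ≤ 1 := by omega
      rw [Finset.card_le_one] at hc
      by_cases ht : TwoSided G ρ v
      · rw [freeSides_eq_zero ht]
        obtain ⟨q, q', hq, hq', hqq⟩ := ht
        have : (∃ q, ShortAdj G (ρ / 2) v q) := by
          by_contra hno
          push Not at hno
          have a1 := (hsplit q hq).resolve_left (hno q)
          have a2 := (hsplit q' hq').resolve_left (hno q')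
          have hvq : v ≠ q := by
            rintro rfl
            rcases hq.1 with h | h <;> exact hG _ h rfl
          have hvq' : v ≠ q' := by
            rintro rfl
            rcases hq'.1 with h | h <;> exact hG _ h rfl
          have hqq' : q = q' := by
            rcases a1 with a1 | a1 <;> rcases a2 with a2 | a2 <;>
              have := hc _ a1 _ a2 <;> simp only [Prod.mk.injEq] at this
            · exact this.2
            · exact absurd this.1 hvq'
            · exact absurd this.2 hvq'
            · exact this.1
          subst hqq'
          rw [real_inner_self_eq_norm_sq] at hqq
          have : ‖q - v‖ = 0 := by nlinarith [norm_nonneg (q - v)]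
          exact hvq (sub_eq_zero.1 (norm_eq_zero.1 this)).symm
        obtain ⟨w, hw⟩ := this
        linarith [freeSides_le_one hw]
      · have : 1 ≤ freeSides G ρ v := by
          unfold freeSides
          rw [if_neg ht]
          split_ifs <;> norm_num
        linarith [@freeSides_le_two _ _ _ G (ρ / 2) v]

lemma sum_dist_le_potential {Z : Finset H} {ph : H → ℝ} (hph : ∀ v ∈ Z, 0 ≤ ph v) :
    ∑ e ∈ G, dist e.1 e.2 ≤ 2 * potential Z G ρ ph := by
  have h1 : ∑ e ∈ G, dist e.1 e.2 ≤ 2 * ∑ e ∈ G, edgeWeight ρ e := by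
    rw [Finset.mul_sum]
    exact Finset.sum_le_sum fun e _ => by linarith [edgeWeight_ge (ρ := ρ) e]
  have h2 : 0 ≤ ∑ v ∈ Z, freeSides G ρ v * ph v :=
    Finset.sum_nonneg fun v hv => mul_nonneg freeSides_nonneg (hph v hv)
  unfold potential
  linarith

lemma potential_half_le {x₀ : H} {Z : Finset H} (hG : IsConnGraph x₀ Z G) {c : ℝ} (hc : 0 ≤ c)
    (hcρ : 8 * c ≤ ρ) :
    potential Z G (ρ / 2) (fun _ => c) ≤ potential Z G ρ (fun _ => c) := by
  set S := G.filter fun e => ρ / 2 < dist e.1 e.2 ∧ dist e.1 e.2 ≤ ρ with hS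
  have h1 : ∑ e ∈ G, edgeWeight (ρ / 2) e ≤ ∑ e ∈ G, (edgeWeight ρ e -
      if e ∈ S then 2 * c else 0) := by
    refine Finset.sum_le_sum fun e he => ?_
    have hd := dist_nonneg (x := e.1) (y := e.2)
    simp only [hS, Finset.mem_filter, he, true_and, edgeWeight]
    split_ifs <;> linarith
  have h2 : ∑ v ∈ Z, freeSides G (ρ / 2) v * c ≤ ∑ v ∈ Z, freeSides G ρ v * c +
      ∑ e ∈ G, if e ∈ S then 2 * c else 0 := by
    have h3 : ∀ v ∈ Z, freeSides G (ρ / 2) v * c ≤ freeSides G ρ v * c +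
        ∑ e ∈ S, ((if e.1 = v then c else 0) + if e.2 = v then c else 0) := by
      intro v _
      refine (mul_le_mul_of_nonneg_right (freeSides_half_le hG.ne) hc).trans ?_
      rw [add_mul]
      gcongr
      rw [← nsmul_eq_mul, ← Finset.sum_const]
      have : (G.filter fun e => ρ / 2 < dist e.1 e.2 ∧ dist e.1 e.2 ≤ ρ ∧ (e.1 = v ∨ e.2 = v)) =
          S.filter fun e => (e.1 = v ∨ e.2 = v) := by
        rw [hS, Finset.filter_filter]
        congr 1
        ext e
        tauto
      rw [this, Finset.sum_filter]
      refine Finset.sum_le_sum fun e _ => ?_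
      split_ifs <;> first | linarith | (exfalso; tauto)
    refine (Finset.sum_le_sum h3).trans ?_
    rw [Finset.sum_add_distrib, Finset.sum_comm]
    gcongr
    rw [← Finset.sum_filter, Finset.filter_mem_eq_inter,
      Finset.inter_eq_right.2 (Finset.filter_subset _ _)]
    refine Finset.sum_le_sum fun e he => ?_
    rw [Finset.sum_add_distrib, Finset.sum_ite_eq, Finset.sum_ite_eq]
    split_ifs <;> linarith
  unfold potential
  rw [Finset.sum_sub_distrib] at h1
  linarith

end Tree

section Insertion

variable {H : Type*} [NormedAddCommGroup H] [InnerProductSpace ℝ H]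

/-- An almost isometric coordinate on an `s`-separated set of points close to a line. -/
structure IsFlatCoord (s : ℝ) (W : Set H) (τ : H → ℝ) : Prop where
  le : ∀ z ∈ W, ∀ z' ∈ W, |τ z - τ z'| ≤ dist z z'
  ge : ∀ z ∈ W, ∀ z' ∈ W, z ≠ z' → dist z z' ≤ |τ z - τ z'| + s / 1000
  sign : ∀ v ∈ W, ∀ z ∈ W, ∀ z' ∈ W, z ≠ v → z' ≠ v →
    (inner ℝ (z - v) (z' - v) ≤ 0 ↔ (τ z - τ v) * (τ z' - τ v) ≤ 0)

lemma abs_inner_sub_mul_le {e u u' : H} {m : ℝ} (he : ‖e‖ = 1) (hm : 0 ≤ m)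
    (hu : ‖u‖ ^ 2 ≤ inner ℝ u e ^ 2 + m ^ 2) (hu' : ‖u'‖ ^ 2 ≤ inner ℝ u' e ^ 2 + m ^ 2) :
    |inner ℝ u u' - inner ℝ u e * inner ℝ u' e| ≤ m ^ 2 := by
  have hee : inner ℝ e e = (1 : ℝ) := by rw [real_inner_self_eq_norm_sq, he]; norm_num
  have key : ∀ x y : H, inner ℝ (x - (inner ℝ x e : ℝ) • e) (y - (inner ℝ y e : ℝ) • e) =
      inner ℝ x y - inner ℝ x e * inner ℝ y e := by
    intro x y
    simp only [inner_sub_left, inner_sub_right, inner_smul_left, inner_smul_right, hee,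
      RCLike.conj_to_real, real_inner_comm e]
    ring
  have h1 : ∀ x : H, ‖x‖ ^ 2 ≤ inner ℝ x e ^ 2 + m ^ 2 → ‖x - (inner ℝ x e : ℝ) • e‖ ≤ m := by
    intro x hx
    apply le_of_sq_le_sq _ hm
    rw [← real_inner_self_eq_norm_sq, key, real_inner_self_eq_norm_sq]
    nlinarith
  rw [← key]
  refine (abs_real_inner_le_norm _ _).trans ?_
  rw [sq]
  exact mul_le_mul (h1 u hu) (h1 u' hu') (norm_nonneg _) hm

lemma mul_norm_sub_abs_inner_le {e u : H} {m s : ℝ} (he : ‖e‖ = 1) 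
    (hu : ‖u‖ ^ 2 ≤ inner ℝ u e ^ 2 + m ^ 2) (hsu : s ≤ ‖u‖) :
    s * (‖u‖ - |inner ℝ u e|) ≤ m ^ 2 := by
  have h1 : |inner ℝ u e| ≤ ‖u‖ := by
    have := abs_real_inner_le_norm u e
    rwa [he, mul_one] at this
  have h2 : |inner ℝ u e| ^ 2 = (inner ℝ u e : ℝ) ^ 2 := sq_abs _
  have h3 := abs_nonneg (inner ℝ u e : ℝ)
  nlinarith

lemma isFlatCoord_inner {e : H} {m s : ℝ} {W : Set H} (he : ‖e‖ = 1) (hs : 0 < s) (hm : 0 ≤ m)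
    (hms : m ≤ s / 500) (hsep : ∀ z ∈ W, ∀ z' ∈ W, z ≠ z' → s < dist z z')
    (hW : ∀ z ∈ W, ∀ z' ∈ W, ‖z - z'‖ ^ 2 ≤ inner ℝ (z - z') e ^ 2 + m ^ 2) :
    IsFlatCoord s W fun z => inner ℝ z e := by
  have hm2 : m ^ 2 ≤ s * (s / 1000) := by nlinarith
  refine ⟨fun z _ z' _ => ?_, fun z hz z' hz' hne => ?_, fun v hv z hz z' hz' hne hne' => ?_⟩
  · rw [← inner_sub_left, dist_eq_norm]
    have := abs_real_inner_le_norm (z - z') e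
    rwa [he, mul_one] at this
  · rw [← inner_sub_left, dist_eq_norm]
    have h := mul_norm_sub_abs_inner_le (s := s) he (hW z hz z' hz')
      (by rw [← dist_eq_norm]; exact (hsep z hz z' hz' hne).le)
    have := le_of_mul_le_mul_left (h.trans hm2) hs
    linarith
  · rw [← inner_sub_left, ← inner_sub_left]
    have hb : ∀ w ∈ W, w ≠ v → 9 / 10 * s ≤ |inner ℝ (w - v) e| := by
      intro w hw hwv
      have h := mul_norm_sub_abs_inner_le (s := s) he (hW w hw v hv)
        (by rw [← dist_eq_norm]; exact (hsep w hw v hv hwv).le)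
      have h1 := le_of_mul_le_mul_left (h.trans hm2) hs
      have h2 := hsep w hw v hv hwv
      rw [dist_eq_norm] at h2
      linarith
    have h := abs_inner_sub_mul_le he hm (hW z hz v hv) (hW z' hz' v hv)
    have hp : 1 / 2 * (s * s) ≤ |inner ℝ (z - v) e * inner ℝ (z' - v) e| := by
      rw [abs_mul]
      nlinarith [hb z hz hne, hb z' hz' hne']
    rw [abs_le] at h
    rcases abs_cases (inner ℝ (z - v) e * inner ℝ (z' - v) e) with ⟨h1, h2⟩ | ⟨h1, h2⟩ <;>
      constructor <;> intro h3 <;> nlinarith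

variable {x₀ y : H} {Z : Finset H} {G : Finset (H × H)} {s : ℝ} {ph : H → ℝ}

lemma ShortAdj.mem_right {H : Type u} [NormedAddCommGroup H] {x₀ : H} {Z : Finset H}
    {G : Finset (H × H)} (hG : IsConnGraph x₀ Z G) {ρ : ℝ} {v q : H} (h : ShortAdj G ρ v q) :
    q ∈ Z := by
  rcases h.1 with h | h
  · exact (hG.mem _ h).2
  · exact (hG.mem _ h).1

lemma ShortAdj.ne {H : Type u} [NormedAddCommGroup H] {x₀ : H} {Z : Finset H}
    {G : Finset (H × H)} (hG : IsConnGraph x₀ Z G) {ρ : ℝ} {v q : H} (h : ShortAdj G ρ v q) :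
    q ≠ v := by
  rcases h.1 with h | h
  · exact (hG.ne _ h).symm
  · exact hG.ne _ h

lemma IsConnGraph.insert_edge {H : Type u} {x₀ y : H} {Z : Finset H} {G : Finset (H × H)}
    (hG : IsConnGraph x₀ Z G) (hy : y ∉ Z) {p : H} (hp : p ∈ Z) :
    IsConnGraph x₀ (insert y Z) (insert (p, y) G) := by
  have hpy : p ≠ y := fun h => hy (h ▸ hp)
  have hmono : ∀ z, Relation.ReflTransGen (fun a b => (a, b) ∈ G ∨ (b, a) ∈ G) x₀ z →
      Relation.ReflTransGen (fun a b => (a, b) ∈ insert (p, y) G ∨ (b, a) ∈ insert (p, y) G) x₀ z :=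
    fun z hz => Relation.ReflTransGen.mono (fun a b (h : (a, b) ∈ G ∨ (b, a) ∈ G) => h.imp
      Finset.mem_insert_of_mem Finset.mem_insert_of_mem) x₀ z hz
  refine ⟨?_, ?_, ?_⟩
  · intro e he
    rcases Finset.mem_insert.1 he with rfl | he
    · exact ⟨Finset.mem_insert_of_mem hp, Finset.mem_insert_self _ _⟩
    · exact ⟨Finset.mem_insert_of_mem (hG.mem e he).1, Finset.mem_insert_of_mem (hG.mem e he).2⟩
  · intro e he
    rcases Finset.mem_insert.1 he with rfl | he
    · exact hpy
    · exact hG.ne e he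
  · intro z hz
    rcases Finset.mem_insert.1 hz with rfl | hz
    · exact (hmono p (hG.reach p hp)).tail (Or.inl (Finset.mem_insert_self _ _))
    · exact hmono z (hG.reach z hz)

lemma potential_insert_edge_le (hG : IsConnGraph x₀ Z G) (hy : y ∉ Z) {p : H} (hp : p ∈ Z)
    {ρ : ℝ} (hpy : dist p y ≤ ρ) (hph : ∀ v ∈ insert y Z, 0 ≤ ph v) :
    potential (insert y Z) (insert (p, y) G) ρ ph ≤ potential Z G ρ ph + dist p y + ph y -
      (freeSides G ρ p - freeSides (insert (p, y) G) ρ p) * ph p := by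
  have hnot : (p, y) ∉ G := fun h => hy (hG.mem _ h).2
  have hw : edgeWeight ρ (p, y) = dist p y := by unfold edgeWeight; rw [if_pos hpy]
  unfold potential
  rw [Finset.sum_insert hnot, Finset.sum_insert hy, hw]
  have h1 : freeSides (insert (p, y) G) ρ y * ph y ≤ ph y := by
    have h2 : freeSides (insert (p, y) G) ρ y ≤ 1 := freeSides_le_one (q := p)
      ⟨Or.inr (Finset.mem_insert_self _ _), by rwa [dist_comm]⟩
    nlinarith [hph y (Finset.mem_insert_self _ _)]
  have h2 : ∑ v ∈ Z, freeSides (insert (p, y) G) ρ v * ph v ≤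
      ∑ v ∈ Z, (freeSides G ρ v * ph v - if p = v then
        (freeSides G ρ p - freeSides (insert (p, y) G) ρ p) * ph p else 0) := by
    refine Finset.sum_le_sum fun v hv => ?_
    by_cases hpv : p = v
    · subst hpv
      rw [if_pos rfl]
      linarith
    · rw [if_neg hpv, sub_zero]
      refine mul_le_mul_of_nonneg_right (freeSides_mono fun q hq => ⟨?_, hq.2⟩)
        (hph v (Finset.mem_insert_of_mem hv))
      exact hq.1.imp Finset.mem_insert_of_mem Finset.mem_insert_of_mem
  rw [Finset.sum_sub_distrib, Finset.sum_ite_eq, if_pos hp] at h2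
  linarith

lemma freeSides_insert_edge_le (p : H) {ρ : ℝ} (v : H) :
    freeSides (insert (p, y) G) ρ v ≤ freeSides G ρ v :=
  freeSides_mono fun _ hq => ⟨hq.1.imp Finset.mem_insert_of_mem Finset.mem_insert_of_mem, hq.2⟩

/-- Attaching `y` to a one-sided vertex, when no short edge passes over `y`. -/
lemma exists_attach (hG : IsConnGraph x₀ Z G) (hs : 0 < s) (hy : y ∉ Z) {Y : Finset H}
    (hYZ : Y ⊆ Z) {W : Set H} {τ : H → ℝ} (hτ : IsFlatCoord s W τ)
    (hW : ∀ z ∈ insert y Z, dist z y ≤ 70 * s → z ∈ W)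
    (hsep : ∀ z ∈ insert y Z, ∀ z' ∈ insert y Z, z ≠ z' → s < dist z z')
    (hcov : ∃ p ∈ Y, dist y p ≤ 2 * s)
    (hno : ∀ a b, (a, b) ∈ G → dist a b ≤ 32 * s → 0 < inner ℝ (a - y) (b - y))
    (hph : ∀ v ∈ insert y Z, 0 ≤ ph v)
    (hphd : ∀ v ∈ Z, ph v - ph y = 2 * (infDist y (Y : Set H) - infDist v (Y : Set H))) :
    ∃ G', IsConnGraph x₀ (insert y Z) G' ∧
      potential (insert y Z) G' (32 * s) ph ≤ potential Z G (32 * s) ph := by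
  obtain ⟨p', hp'Y, hp'⟩ := hcov
  obtain ⟨p, hpY, hpmin⟩ := Y.exists_min_image (fun z => dist y z) ⟨p', hp'Y⟩
  have hpd : dist y p ≤ 2 * s := (hpmin p' hp'Y).trans hp'
  have hpinf : infDist y (Y : Set H) = dist y p := by
    apply le_antisymm (infDist_le_dist_of_mem hpY)
    rw [le_infDist ⟨p, hpY⟩]
    exact fun {z} hz => hpmin z hz
  have hyZ : y ∈ insert y Z := Finset.mem_insert_self _ _
  have hmem : ∀ z ∈ Z, z ∈ insert y Z := fun z hz => Finset.mem_insert_of_mem hz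
  have hney : ∀ z ∈ Z, z ≠ y := fun z hz h => hy (h ▸ hz)
  have hyW : y ∈ W := hW y hyZ (by rw [dist_self]; positivity)
  have hpZ : p ∈ Z := hYZ hpY
  have hpW : p ∈ W := hW p (hmem p hpZ) (by rw [dist_comm]; linarith)
  obtain ⟨v, hvS, hvmin⟩ := (Z.filter fun z => 0 < inner ℝ (z - y) (p - y)).exists_min_image
    (fun z => dist z y) ⟨p, by
      rw [Finset.mem_filter]
      refine ⟨hpZ, ?_⟩
      rw [real_inner_self_eq_norm_sq]
      have := norm_pos_iff.2 (sub_ne_zero.2 (hney p hpZ))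
      positivity⟩
  rw [Finset.mem_filter] at hvS
  have hvp : dist v y ≤ dist p y := hvmin p (by
    rw [Finset.mem_filter]
    refine ⟨hpZ, ?_⟩
    rw [real_inner_self_eq_norm_sq]
    have := norm_pos_iff.2 (sub_ne_zero.2 (hney p hpZ))
    positivity)
  rw [dist_comm y p] at hpd hpinf
  have hvZ := hvS.1
  have hvW : v ∈ W := hW v (hmem v hvZ) (by linarith)
  have hsign : ∀ c ∈ W, ∀ z ∈ W, ∀ z' ∈ W, z ≠ c → z' ≠ c →
      (0 < inner ℝ (z - c) (z' - c) ↔ 0 < (τ z - τ c) * (τ z' - τ c)) := by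
    intro c hc z hz z' hz' h1 h2
    have := hτ.sign c hc z hz z' hz' h1 h2
    constructor <;> intro h <;> by_contra hcon <;> push Not at hcon
    · linarith [this.2 hcon]
    · linarith [this.1 hcon]
  have hvpτ : 0 < (τ v - τ y) * (τ p - τ y) :=
    (hsign y hyW v hvW p hpW (hney v hvZ) (hney p hpZ)).1 hvS.2
  -- no neighbour of `v` on the side of `y`
  have hnb : ∀ q, ShortAdj G (32 * s) v q → q ∈ W ∧ (τ q - τ v) * (τ y - τ v) < 0 := by
    intro q hq
    have hqZ := hq.mem_right hG
    have hqv := hq.ne hG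
    have hqW : q ∈ W := hW q (hmem q hqZ) (by
      have := dist_triangle q v y
      rw [dist_comm q v] at this
      linarith [hq.2])
    refine ⟨hqW, ?_⟩
    have hstr : 0 < (τ v - τ y) * (τ q - τ y) := by
      rw [← hsign y hyW v hvW q hqW (hney v hvZ) (hney q hqZ)]
      rcases hq.1 with h | h
      · exact hno v q h hq.2
      · rw [real_inner_comm]; exact hno q v h (by rw [dist_comm]; exact hq.2)
    have hqS : 0 < inner ℝ (q - y) (p - y) := by
      rw [hsign y hyW q hqW p hpW (hney q hqZ) (hney p hpZ)]
      rcases pos_and_pos_or_neg_and_neg_of_mul_pos hvpτ with ⟨h1, h2⟩ | ⟨h1, h2⟩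
      · exact mul_pos (pos_of_mul_pos_right hstr h1.le) h2
      · exact mul_pos_of_neg_of_neg (neg_of_mul_pos_right hstr h1.le) h2
    have hmin := hvmin q (by rw [Finset.mem_filter]; exact ⟨hqZ, hqS⟩)
    have g1 := hτ.ge q hqW v hvW hqv
    have g2 := hτ.ge q hqW y hyW (hney q hqZ)
    have g3 := hτ.le v hvW y hyW
    have g4 := hsep q (hmem q hqZ) v (hmem v hvZ) hqv
    have g5 := hsep v (hmem v hvZ) y hyZ (hney v hvZ)
    rcases pos_and_pos_or_neg_and_neg_of_mul_pos hstr with ⟨h1, h2⟩ | ⟨h1, h2⟩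
    · rw [abs_of_pos h1] at g3
      rw [abs_of_pos h2] at g2
      rcases abs_cases (τ q - τ v) with ⟨h3, h4⟩ | ⟨h3, h4⟩ <;> rw [h3] at g1
      · nlinarith
      · linarith
    · rw [abs_of_neg h1] at g3
      rw [abs_of_neg h2] at g2
      rcases abs_cases (τ q - τ v) with ⟨h3, h4⟩ | ⟨h3, h4⟩ <;> rw [h3] at g1
      · linarith
      · nlinarith
  have hvy : dist v y ≤ 32 * s := by linarith
  have hadj : ShortAdj (insert (v, y) G) (32 * s) v y :=
    ⟨Or.inl (Finset.mem_insert_self _ _), hvy⟩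
  have hyv : y ≠ v := (hney v hvZ).symm
  have hdrop : 1 ≤ freeSides G (32 * s) v - freeSides (insert (v, y) G) (32 * s) v := by
    have hnt : ¬ TwoSided G (32 * s) v := by
      rintro ⟨q, q', hq, hq', hqq⟩
      obtain ⟨a1, a2⟩ := hnb q hq
      obtain ⟨b1, b2⟩ := hnb q' hq'
      have := (hτ.sign v hvW q a1 q' b1 (hq.ne hG) (hq'.ne hG)).1 hqq
      have h3 : 0 < ((τ q - τ v) * (τ y - τ v)) * ((τ q' - τ v) * (τ y - τ v)) :=
        mul_pos_of_neg_of_neg a2 b2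
      nlinarith [sq_nonneg (τ y - τ v)]
    by_cases he : ∃ q, ShortAdj G (32 * s) v q
    · have h1 : freeSides G (32 * s) v = 1 := by
        unfold freeSides; rw [if_neg hnt, if_pos he]
      obtain ⟨q, hq⟩ := he
      obtain ⟨a1, a2⟩ := hnb q hq
      have h2 : TwoSided (insert (v, y) G) (32 * s) v :=
        ⟨q, y, ⟨hq.1.imp Finset.mem_insert_of_mem Finset.mem_insert_of_mem, hq.2⟩, hadj,
          (hτ.sign v hvW q a1 y hyW (hq.ne hG) hyv).2 a2.le⟩
      rw [h1, freeSides_eq_zero h2, sub_zero]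
    · have h1 : freeSides G (32 * s) v = 2 := by
        unfold freeSides; rw [if_neg hnt, if_neg he]
      rw [h1]
      linarith [freeSides_le_one hadj]
  refine ⟨insert (v, y) G, hG.insert_edge hy hvZ, ?_⟩
  have hpot := potential_insert_edge_le hG hy hvZ hvy hph
  have hphv := hph v (hmem v hvZ)
  have hpay : dist v y ≤ ph v - ph y := by
    rw [hphd v hvZ, hpinf]
    have g1 := hsep v (hmem v hvZ) y hyZ (hney v hvZ)
    by_cases hvp' : v = p
    · have : infDist v (Y : Set H) = 0 := infDist_zero_of_mem (by rw [hvp']; exact hpY)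
      rw [this]; linarith
    · have h1 : infDist v (Y : Set H) ≤ dist v p := infDist_le_dist_of_mem hpY
      have g2 := hτ.ge v hvW p hpW hvp'
      have g3 := hτ.le p hpW y hyW
      have g4 := hτ.ge v hvW y hyW (hney v hvZ)
      have g5 := hτ.ge p hpW y hyW (hney p hpZ)
      have g6 := hτ.le v hvW y hyW
      have g7 := hsep v (hmem v hvZ) p (hmem p hpZ) hvp'
      rcases pos_and_pos_or_neg_and_neg_of_mul_pos hvpτ with ⟨h2, h3⟩ | ⟨h2, h3⟩
      · rw [abs_of_pos h3] at g3 g5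
        rw [abs_of_pos h2] at g4 g6
        rcases abs_cases (τ v - τ p) with ⟨h4, h5⟩ | ⟨h4, h5⟩ <;> rw [h4] at g2 <;> linarith
      · rw [abs_of_neg h3] at g3 g5
        rw [abs_of_neg h2] at g4 g6
        rcases abs_cases (τ v - τ p) with ⟨h4, h5⟩ | ⟨h4, h5⟩ <;> rw [h4] at g2 <;> linarith
  nlinarith

end Insertion

section Split

variable {H : Type*} [NormedAddCommGroup H] [InnerProductSpace ℝ H]
variable {x₀ y : H} {Z : Finset H} {G : Finset (H × H)} {s : ℝ} {ph : H → ℝ}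

lemma IsConnGraph.split_edge {H : Type u} {x₀ y : H} {Z : Finset H} {G : Finset (H × H)}
    (hG : IsConnGraph x₀ Z G) (hy : y ∉ Z) {a b : H} (hab : (a, b) ∈ G) :
    IsConnGraph x₀ (insert y Z) (insert (a, y) (insert (y, b) (G.erase (a, b)))) := by
  set G' := insert (a, y) (insert (y, b) (G.erase (a, b))) with hG'
  have ha := (hG.mem _ hab).1
  have hb := (hG.mem _ hab).2
  have hay : (a, y) ∈ G' := by simp [hG']
  have hyb : (y, b) ∈ G' := by simp [hG']
  have hold : ∀ e ∈ G, e ≠ (a, b) → e ∈ G' := fun e he hne => by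
    rw [hG']
    exact Finset.mem_insert_of_mem (Finset.mem_insert_of_mem (Finset.mem_erase.2 ⟨hne, he⟩))
  refine ⟨?_, ?_, ?_⟩
  · intro e he
    rcases Finset.mem_insert.1 he with rfl | he
    · exact ⟨Finset.mem_insert_of_mem ha, Finset.mem_insert_self _ _⟩
    rcases Finset.mem_insert.1 he with rfl | he
    · exact ⟨Finset.mem_insert_self _ _, Finset.mem_insert_of_mem hb⟩
    have he := Finset.mem_of_mem_erase he
    exact ⟨Finset.mem_insert_of_mem (hG.mem e he).1, Finset.mem_insert_of_mem (hG.mem e he).2⟩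
  · intro e he
    rcases Finset.mem_insert.1 he with rfl | he
    · exact fun h : a = y => hy (h ▸ ha)
    rcases Finset.mem_insert.1 he with rfl | he
    · exact fun h : y = b => hy (h ▸ hb)
    exact hG.ne e (Finset.mem_of_mem_erase he)
  · have hstep : ∀ p q, ((p, q) ∈ G ∨ (q, p) ∈ G) →
        Relation.ReflTransGen (fun a b => (a, b) ∈ G' ∨ (b, a) ∈ G') p q := by
      intro p q h
      rcases h with h | h
      · by_cases he : (p, q) = (a, b)
        · rw [Prod.mk.injEq] at he
          obtain ⟨rfl, rfl⟩ := he
          exact Relation.ReflTransGen.tail (b := y) (Relation.ReflTransGen.single (Or.inl hay))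
              (Or.inl hyb)
        · exact Relation.ReflTransGen.single (Or.inl (hold _ h he))
      · by_cases he : (q, p) = (a, b)
        · rw [Prod.mk.injEq] at he
          obtain ⟨rfl, rfl⟩ := he
          exact Relation.ReflTransGen.tail (b := y) (Relation.ReflTransGen.single (Or.inr hyb))
              (Or.inr hay)
        · exact Relation.ReflTransGen.single (Or.inr (hold _ h he))
    have hall : ∀ z ∈ Z, Relation.ReflTransGen (fun a b => (a, b) ∈ G' ∨ (b, a) ∈ G') x₀ z := by
      intro z hz
      have := hG.reach z hz
      clear hz
      induction this with
      | refl => exact Relation.ReflTransGen.refl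
      | tail _ h ih => exact ih.trans (hstep _ _ h)
    intro z hz
    rcases Finset.mem_insert.1 hz with rfl | hz
    · exact (hall a ha).tail (Or.inl hay)
    · exact hall z hz

/-- Routing a short edge that passes over `y` through `y`. -/
lemma exists_split (hG : IsConnGraph x₀ Z G) (hs : 0 < s) (hy : y ∉ Z)
    {W : Set H} {τ : H → ℝ} (hτ : IsFlatCoord s W τ)
    (hW : ∀ z ∈ insert y Z, dist z y ≤ 70 * s → z ∈ W)
    (hph : ∀ v ∈ insert y Z, 0 ≤ ph v) {a b : H} (hab : (a, b) ∈ G) (hd : dist a b ≤ 32 * s)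
    (hin : inner ℝ (a - y) (b - y) ≤ 0) :
    ∃ G', IsConnGraph x₀ (insert y Z) G' ∧
      potential (insert y Z) G' (32 * s) ph ≤ potential Z G (32 * s) ph +
        (dist a y + dist y b - dist a b) := by
  set G' := insert (a, y) (insert (y, b) (G.erase (a, b))) with hG'
  have ha := (hG.mem _ hab).1
  have hb := (hG.mem _ hab).2
  have hay : (a, y) ∈ G' := by simp [hG']
  have hyb : (y, b) ∈ G' := by simp [hG']
  have hya : a ≠ y := fun h => hy (h ▸ ha)
  have hyb' : b ≠ y := fun h => hy (h ▸ hb)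
  have hne : a ≠ b := hG.ne _ hab
  have hold : ∀ e ∈ G, e ≠ (a, b) → e ∈ G' := fun e he hne => by
    rw [hG']
    exact Finset.mem_insert_of_mem (Finset.mem_insert_of_mem (Finset.mem_erase.2 ⟨hne, he⟩))
  have hpyth : dist a b ^ 2 = dist a y ^ 2 + dist y b ^ 2 - 2 * inner ℝ (a - y) (b - y) := by
    rw [dist_eq_norm, dist_eq_norm, dist_comm y b, dist_eq_norm,
      show a - b = (a - y) - (b - y) by abel, norm_sub_sq_real]
    ring
  have hday : dist a y ≤ 32 * s := by
    refine le_trans ?_ hd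
    apply le_of_sq_le_sq _ dist_nonneg
    nlinarith [sq_nonneg (dist y b)]
  have hdyb : dist y b ≤ 32 * s := by
    refine le_trans ?_ hd
    apply le_of_sq_le_sq _ dist_nonneg
    nlinarith [sq_nonneg (dist a y)]
  have hmem : ∀ z ∈ Z, z ∈ insert y Z := fun z hz => Finset.mem_insert_of_mem hz
  have hyW : y ∈ W := hW y (Finset.mem_insert_self _ _) (by rw [dist_self]; positivity)
  have haW : a ∈ W := hW a (hmem a ha) (by linarith)
  have hbW : b ∈ W := hW b (hmem b hb) (by rw [dist_comm]; linarith)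
  refine ⟨G', hG.split_edge hy hab, ?_⟩
  have hbet : (τ a - τ y) * (τ b - τ y) ≤ 0 := (hτ.sign y hyW a haW b hbW hya hyb').1 hin
  -- turning from one end of the old edge towards `y` instead of the other end
  have hturn : ∀ v w, ((v = a ∧ w = b) ∨ (v = b ∧ w = a)) →
      freeSides G' (32 * s) v ≤ freeSides G (32 * s) v := by
    intro v w hvw
    have hv : v ∈ W ∧ w ∈ W ∧ w ≠ v ∧ y ≠ v ∧ dist v y ≤ 32 * s ∧ (τ v - τ y) * (τ w - τ y) ≤ 0 ∧
        ((v, y) ∈ G' ∨ (y, v) ∈ G') := by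
      rcases hvw with ⟨rfl, rfl⟩ | ⟨rfl, rfl⟩
      · exact ⟨haW, hbW, hne.symm, hya.symm, hday, hbet, Or.inl hay⟩
      · exact ⟨hbW, haW, hne, hyb'.symm, by rwa [dist_comm], by linarith, Or.inr hyb⟩
    obtain ⟨hvW, hwW, hwv, hyv, hvy, hbt, hvyG⟩ := hv
    have hnbW : ∀ q, ShortAdj G (32 * s) v q → q ∈ W := fun q hq => hW q (hmem q (hq.mem_right hG))
        (by
      have := dist_triangle q v y
      rw [dist_comm q v] at this
      linarith [hq.2])
    have hsame : ∀ x, (τ w - τ v) * x ≤ 0 → (τ y - τ v) * x ≤ 0 := by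
      intro x hx
      by_contra hcon
      push Not at hcon
      rcases pos_and_pos_or_neg_and_neg_of_mul_pos hcon with ⟨h1, h2⟩ | ⟨h1, h2⟩
      · have h3 : τ w - τ v ≤ 0 := by nlinarith
        nlinarith
      · have h3 : 0 ≤ τ w - τ v := by nlinarith
        nlinarith
    refine freeSides_le_of_map (fun q => if q = w then y else q) ?_ ?_
    · intro q hq
      split_ifs with hqw
      · exact ⟨hvyG, hvy⟩
      · refine ⟨hq.1.imp (fun h => hold _ h ?_) (fun h => hold _ h ?_), hq.2⟩
        · rw [Ne, Prod.mk.injEq]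
          rintro ⟨rfl, rfl⟩
          rcases hvw with ⟨-, rfl⟩ | ⟨rfl, rfl⟩
          · exact hqw rfl
          · exact hwv rfl
        · rw [Ne, Prod.mk.injEq]
          rintro ⟨rfl, rfl⟩
          rcases hvw with ⟨rfl, rfl⟩ | ⟨-, rfl⟩
          · exact hwv rfl
          · exact hqw rfl
    · intro q q' hq hq' hqq
      have h1 := (hτ.sign v hvW q (hnbW q hq) q' (hnbW q' hq') (hq.ne hG) (hq'.ne hG)).1 hqq
      split_ifs with h2 h3 h3
      · exfalso
        rw [h2, h3, real_inner_self_eq_norm_sq] at hqq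
        have := norm_pos_iff.2 (sub_ne_zero.2 hwv)
        nlinarith
      · rw [hτ.sign v hvW y hyW q' (hnbW q' hq') hyv (hq'.ne hG)]
        rw [h2] at h1
        exact hsame _ h1
      · rw [hτ.sign v hvW q (hnbW q hq) y hyW (hq.ne hG) hyv]
        rw [h3] at h1
        rw [mul_comm] at h1 ⊢
        exact hsame _ h1
      · exact hqq
  have hfree : ∀ v ∈ Z, freeSides G' (32 * s) v ≤ freeSides G (32 * s) v := by
    intro v _
    by_cases hva : v = a
    · exact hturn v b (Or.inl ⟨hva, rfl⟩)
    by_cases hvb : v = b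
    · exact hturn v a (Or.inr ⟨hvb, rfl⟩)
    refine freeSides_mono fun q hq => ⟨hq.1.imp (fun h => hold _ h ?_) (fun h => hold _ h ?_), hq.2⟩
    · rw [Ne, Prod.mk.injEq]
      exact fun h => hva h.1
    · rw [Ne, Prod.mk.injEq]
      exact fun h => hvb h.2
  have hfy : freeSides G' (32 * s) y = 0 :=
    freeSides_eq_zero ⟨a, b, ⟨Or.inr hay, by rwa [dist_comm]⟩, ⟨Or.inl hyb, hdyb⟩, hin⟩
  have hedge : ∑ e ∈ G', edgeWeight (32 * s) e =
      ∑ e ∈ G, edgeWeight (32 * s) e + (dist a y + dist y b - dist a b) := by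
    have n1 : (y, b) ∉ G.erase (a, b) := fun h => hy (hG.mem _ (Finset.mem_of_mem_erase h)).1
    have n2 : (a, y) ∉ insert (y, b) (G.erase (a, b)) := by
      rw [Finset.mem_insert]
      rintro (h | h)
      · rw [Prod.mk.injEq] at h; exact hya h.1
      · exact hy (hG.mem _ (Finset.mem_of_mem_erase h)).2
    rw [hG', Finset.sum_insert n2, Finset.sum_insert n1, ← Finset.add_sum_erase G _ hab]
    simp only [edgeWeight, if_pos hd, if_pos hday, if_pos hdyb]
    ring
  unfold potential
  rw [Finset.sum_insert hy, hfy, zero_mul, zero_add, hedge]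
  have : ∑ v ∈ Z, freeSides G' (32 * s) v * ph v ≤ ∑ v ∈ Z, freeSides G (32 * s) v * ph v :=
    Finset.sum_le_sum fun v hv => mul_le_mul_of_nonneg_right (hfree v hv) (hph v (hmem v hv))
  linarith

/-- The detour through a point lying between `a` and `b` near their line is short. -/
lemma detour_le {e a b y : H} {m s : ℝ} (he : ‖e‖ = 1) (hs : 0 < s) (hm : 0 ≤ m) (hms : m ≤ s / 500)
    (hay : s < dist a y) (hby : s < dist b y) (hab : a = b ∨ s < dist a b)
    (hW : ∀ z ∈ ({a, b, y} : Set H), ∀ z' ∈ ({a, b, y} : Set H),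
      ‖z - z'‖ ^ 2 ≤ inner ℝ (z - z') e ^ 2 + m ^ 2)
    (hin : inner ℝ (a - y) (b - y) ≤ 0) :
    s * (dist a y + dist y b - dist a b) ≤ 2 * m ^ 2 := by
  have hay' : a ≠ y := fun h => by rw [h, dist_self] at hay; linarith
  have hby' : b ≠ y := fun h => by rw [h, dist_self] at hby; linarith
  have hflat : IsFlatCoord s ({a, b, y} : Set H) fun z => inner ℝ z e := by
    refine isFlatCoord_inner he hs hm hms ?_ hW
    rintro z (rfl | rfl | rfl) z' (rfl | rfl | rfl) hne <;>
      first
        | exact absurd rfl hne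
        | assumption
        | (rw [dist_comm]; assumption)
        | exact hab.resolve_left hne
        | (rw [dist_comm]; exact hab.resolve_left (Ne.symm hne))
  have h1 := (hflat.sign y (by simp) a (by simp) b (by simp) hay' hby').1 hin
  have h2 := hflat.le a (by simp) b (by simp)
  have h3 := mul_norm_sub_abs_inner_le (s := s) he (hW a (by simp) y (by simp))
    (by rw [← dist_eq_norm]; exact hay.le)
  have h4 := mul_norm_sub_abs_inner_le (s := s) he (hW b (by simp) y (by simp))
    (by rw [← dist_eq_norm]; exact hby.le)
  rw [← dist_eq_norm, inner_sub_left] at h3 h4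
  have h5 : |(inner ℝ a e - inner ℝ y e : ℝ)| + |(inner ℝ b e - inner ℝ y e : ℝ)| ≤
      |(inner ℝ a e - inner ℝ b e : ℝ)| := by
    rcases abs_cases (inner ℝ a e - inner ℝ y e : ℝ) with ⟨g1, g2⟩ | ⟨g1, g2⟩ <;>
    rcases abs_cases (inner ℝ b e - inner ℝ y e : ℝ) with ⟨g3, g4⟩ | ⟨g3, g4⟩ <;>
    rcases abs_cases (inner ℝ a e - inner ℝ b e : ℝ) with ⟨g5, g6⟩ | ⟨g5, g6⟩ <;>
    rw [g1, g3, g5] <;> nlinarith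
  have h6 : dist y b = dist b y := dist_comm _ _
  nlinarith

/-- Inserting one point costs at most its flatness defect. -/
lemma exists_insert (hG : IsConnGraph x₀ Z G) (hs : 0 < s) (hy : y ∉ Z) {Y : Finset H}
    (hYZ : Y ⊆ Z) (hsep : ∀ z ∈ insert y Z, ∀ z' ∈ insert y Z, z ≠ z' → s < dist z z')
    (hcov : ∃ p ∈ Y, dist y p ≤ 2 * s) {b : ℝ} (hb : 0 ≤ b)
    (hflat : ∀ b' > b, ∃ e : H, ‖e‖ = 1 ∧ ∀ z ∈ insert y Z, ∀ z' ∈ insert y Z,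
      dist z y ≤ 70 * s → dist z' y ≤ 70 * s →
        ‖z - z'‖ ^ 2 ≤ inner ℝ (z - z') e ^ 2 + (2 * b' * s) ^ 2)
    (hph : ∀ v ∈ insert y Z, 0 ≤ ph v) (hphy : ph y ≤ 8 * s)
    (hphd : ∀ v ∈ Z, ph v - ph y = 2 * (infDist y (Y : Set H) - infDist v (Y : Set H))) :
    ∃ G', IsConnGraph x₀ (insert y Z) G' ∧
      potential (insert y Z) G' (32 * s) ph ≤ potential Z G (32 * s) ph + 20000000 * b ^ 2 * s := by
  by_cases hb1 : b < 1 / 1000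
  · obtain ⟨e, he, hW⟩ := hflat (1 / 1000) hb1
    let W : Set H := {z | z ∈ insert y Z ∧ dist z y ≤ 70 * s}
    have hτ : IsFlatCoord s W fun z => inner ℝ z e :=
      isFlatCoord_inner he hs (m := 2 * (1 / 1000) * s) (by positivity) (by linarith)
        (fun z hz z' hz' => hsep z hz.1 z' hz'.1)
        (fun z hz z' hz' => hW z hz.1 z' hz'.1 hz.2 hz'.2)
    by_cases hst : ∃ a c, (a, c) ∈ G ∧ dist a c ≤ 32 * s ∧ inner ℝ (a - y) (c - y) ≤ 0
    · obtain ⟨a, c, hac, hd, hin⟩ := hst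
      obtain ⟨G', hG', hpot⟩ := exists_split hG hs hy hτ (fun z hz hd => ⟨hz, hd⟩) hph hac hd hin
      refine ⟨G', hG', hpot.trans ?_⟩
      have haZ := (hG.mem _ hac).1
      have hcZ := (hG.mem _ hac).2
      have ha : a ∈ insert y Z := Finset.mem_insert_of_mem haZ
      have hc : c ∈ insert y Z := Finset.mem_insert_of_mem hcZ
      have hyy : y ∈ insert y Z := Finset.mem_insert_self _ _
      have hay := hsep a ha y hyy (fun h => hy (h ▸ haZ))
      have hcy := hsep c hc y hyy (fun h => hy (h ▸ hcZ))
      have hpyth : dist a c ^ 2 = dist a y ^ 2 + dist c y ^ 2 - 2 * inner ℝ (a - y) (c - y) := by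
        rw [dist_eq_norm, dist_eq_norm, dist_eq_norm,
          show a - c = (a - y) - (c - y) by abel, norm_sub_sq_real]
        ring
      have hda : dist a y ≤ 70 * s := by
        have : dist a y ≤ dist a c := by
          apply le_of_sq_le_sq _ dist_nonneg
          nlinarith [sq_nonneg (dist c y)]
        linarith
      have hdc : dist c y ≤ 70 * s := by
        have : dist c y ≤ dist a c := by
          apply le_of_sq_le_sq _ dist_nonneg
          nlinarith [sq_nonneg (dist a y)]
        linarith
      have hdet : ∀ b' ∈ Ioo b (1 / 1000),
          s * (dist a y + dist y c - dist a c) ≤ 2 * (2 * b' * s) ^ 2 := by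
        intro b' hb'
        obtain ⟨e', he', hW'⟩ := hflat b' hb'.1
        have hb0 : 0 ≤ b' := hb.trans hb'.1.le
        refine detour_le he' hs (by positivity) (by nlinarith [hb'.2]) hay hcy
          (or_iff_not_imp_left.2 (hsep a ha c hc)) ?_ hin
        have hmm : ∀ z ∈ ({a, c, y} : Set H), z ∈ insert y Z ∧ dist z y ≤ 70 * s := by
          rintro z (rfl | rfl | rfl)
          · exact ⟨ha, hda⟩
          · exact ⟨hc, hdc⟩
          · exact ⟨hyy, by rw [dist_self]; positivity⟩
        exact fun z hz z' hz' => hW' z (hmm z hz).1 z' (hmm z' hz').1 (hmm z hz).2 (hmm z' hz').2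
      have hlim : s * (dist a y + dist y c - dist a c) ≤ 2 * (2 * b * s) ^ 2 := by
        have ht : Filter.Tendsto (fun b' : ℝ => 2 * (2 * b' * s) ^ 2) (nhdsWithin b (Ioi b))
            (nhds (2 * (2 * b * s) ^ 2)) :=
          (Continuous.tendsto (by fun_prop) b).mono_left nhdsWithin_le_nhds
        refine ge_of_tendsto ht ?_
        filter_upwards [Ioo_mem_nhdsGT hb1] with b' hb'
        exact hdet b' hb'
      have : dist a y + dist y c - dist a c ≤ 8 * b ^ 2 * s := by
        have h8 : 2 * (2 * b * s) ^ 2 = s * (8 * b ^ 2 * s) := by ring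
        rw [h8] at hlim
        exact le_of_mul_le_mul_left hlim hs
      nlinarith [mul_nonneg (sq_nonneg b) hs.le]
    · push Not at hst
      obtain ⟨G', hG', hpot⟩ := exists_attach hG hs hy hYZ hτ (fun z hz hd => ⟨hz, hd⟩) hsep hcov
        (fun a c hac hd => hst a c hac hd) hph hphd
      refine ⟨G', hG', hpot.trans ?_⟩
      have : 0 ≤ 20000000 * b ^ 2 * s := by positivity
      linarith
  · push Not at hb1
    obtain ⟨p, hpY, hp⟩ := hcov
    have hpZ := hYZ hpY
    refine ⟨insert (p, y) G, hG.insert_edge hy hpZ, ?_⟩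
    rw [dist_comm] at hp
    have h1 := potential_insert_edge_le hG hy hpZ (ρ := 32 * s) (by linarith) hph
    have h2 := freeSides_insert_edge_le (y := y) (G := G) p (ρ := 32 * s) p
    have h3 := mul_nonneg (sub_nonneg.2 h2) (hph p (Finset.mem_insert_of_mem hpZ))
    have h4 : 10 * s ≤ 20000000 * b ^ 2 * s := by
      have : (1 / 1000 : ℝ) ^ 2 ≤ b ^ 2 := by gcongr
      nlinarith
    linarith

end Split

section Stage

variable {H : Type*} [NormedAddCommGroup H] [InnerProductSpace ℝ H]

/-- Refining a graph on `Y` to a graph on a finer net `Y'`. -/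
lemma exists_stage {x₀ : H} {Y Y' : Finset H} {G : Finset (H × H)} {s : ℝ} (hs : 0 < s)
    (hG : IsConnGraph x₀ Y G) (hYY : Y ⊆ Y')
    (hsep : ∀ z ∈ Y', ∀ z' ∈ Y', z ≠ z' → s < dist z z')
    (hcov : ∀ y ∈ Y', ∃ p ∈ Y, dist y p ≤ 2 * s) {b : H → ℝ} (hb : ∀ y, 0 ≤ b y)
    (hflat : ∀ y ∈ Y' \ Y, ∀ b' > b y, ∃ e : H, ‖e‖ = 1 ∧ ∀ z ∈ Y', ∀ z' ∈ Y',
      dist z y ≤ 70 * s → dist z' y ≤ 70 * s →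
        ‖z - z'‖ ^ 2 ≤ inner ℝ (z - z') e ^ 2 + (2 * b' * s) ^ 2) :
    ∃ G', IsConnGraph x₀ Y' G' ∧
      potential Y' G' (32 * s) (fun _ => 4 * s) ≤ potential Y G (32 * s) (fun _ => 8 * s) +
        20000000 * ∑ y ∈ Y' \ Y, b y ^ 2 * s := by
  let ph : H → ℝ := fun v => 4 * s + 2 * (2 * s - infDist v (Y : Set H))
  have hph4 : ∀ v ∈ Y', 4 * s ≤ ph v := by
    intro v hv
    obtain ⟨p, hp, hd⟩ := hcov v hv
    have : infDist v (Y : Set H) ≤ dist v p := infDist_le_dist_of_mem hp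
    simp only [ph]
    linarith
  have hind : ∀ T : Finset H, T ⊆ Y' \ Y → ∃ G', IsConnGraph x₀ (T ∪ Y) G' ∧
      potential (T ∪ Y) G' (32 * s) ph ≤ potential Y G (32 * s) ph +
        20000000 * ∑ y ∈ T, b y ^ 2 * s := by
    intro T
    induction T using Finset.induction_on with
    | empty => exact fun _ => ⟨G, by simpa using hG, by simp⟩
    | insert y T hyT ih =>
      intro hT
      obtain ⟨G₁, hG₁, hp₁⟩ := ih ((Finset.subset_insert _ _).trans hT)
      have hyY := Finset.mem_sdiff.1 (hT (Finset.mem_insert_self _ _))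
      have hy : y ∉ T ∪ Y := by simp [hyT, hyY.2]
      have hsub : insert y (T ∪ Y) ⊆ Y' := by
        intro z hz
        rcases Finset.mem_insert.1 hz with rfl | hz
        · exact hyY.1
        rcases Finset.mem_union.1 hz with hz | hz
        · exact (Finset.mem_sdiff.1 (hT (Finset.mem_insert_of_mem hz))).1
        · exact hYY hz
      obtain ⟨G', hG', hp'⟩ := exists_insert (ph := ph) hG₁ hs hy Finset.subset_union_right
        (fun z hz z' hz' => hsep z (hsub hz) z' (hsub hz')) (hcov y hyY.1) (hb y)
        (fun b' hb' => by
          obtain ⟨e, he, h⟩ := hflat y (hT (Finset.mem_insert_self _ _)) b' hb'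
          exact ⟨e, he, fun z hz z' hz' => h z (hsub hz) z' (hsub hz')⟩)
        (fun v hv => by linarith [hph4 v (hsub hv)])
        (by
          have := infDist_nonneg (x := y) (s := (Y : Set H))
          simp only [ph]; linarith)
        (fun v _ => by simp only [ph]; ring)
      rw [Finset.insert_union, Finset.sum_insert hyT]
      exact ⟨G', hG', by linarith⟩
  obtain ⟨G', hG', hp⟩ := hind _ subset_rfl
  rw [Finset.sdiff_union_of_subset hYY] at hG' hp
  refine ⟨G', hG', ?_⟩
  have h1 : potential Y' G' (32 * s) (fun _ => 4 * s) ≤ potential Y' G' (32 * s) ph := by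
    unfold potential
    gcongr with v hv
    · exact freeSides_nonneg
    · exact hph4 v hv
  have h2 : potential Y G (32 * s) ph = potential Y G (32 * s) (fun _ => 8 * s) := by
    unfold potential
    congr 1
    refine Finset.sum_congr rfl fun v hv => ?_
    have : infDist v (Y : Set H) = 0 := infDist_zero_of_mem hv
    simp only [ph, this]
    ring
  linarith

lemma exists_connGraph {x₀ : H} {Y : ℕ → Finset H} {s : ℝ} (hs : 0 < s) (hY0 : Y 0 = {x₀})
    (hY : ∀ k, Y k ⊆ Y (k + 1))
    (hsep : ∀ k, ∀ z ∈ Y k, ∀ z' ∈ Y k, z ≠ z' → s / 2 ^ k < dist z z')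
    (hcov : ∀ k, ∀ y ∈ Y (k + 1), ∃ p ∈ Y k, dist y p ≤ s / 2 ^ k)
    {b : ℕ → H → ℝ} (hb : ∀ k y, 0 ≤ b k y)
    (hflat : ∀ k, ∀ y ∈ Y (k + 1), ∀ b' > b k y, ∃ e : H, ‖e‖ = 1 ∧
      ∀ z ∈ Y (k + 1), ∀ z' ∈ Y (k + 1),
      dist z y ≤ 70 * (s / 2 ^ (k + 1)) → dist z' y ≤ 70 * (s / 2 ^ (k + 1)) →
        ‖z - z'‖ ^ 2 ≤ inner ℝ (z - z') e ^ 2 + (2 * b' * (s / 2 ^ (k + 1))) ^ 2) (k : ℕ) :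
    ∃ G, IsConnGraph x₀ (Y k) G ∧
      potential (Y k) G (32 * (s / 2 ^ k)) (fun _ => 4 * (s / 2 ^ k)) ≤ 8 * s +
        20000000 * ∑ j ∈ Finset.range k, ∑ y ∈ Y (j + 1) \ Y j, b j y ^ 2 * (s / 2 ^ (j + 1)) := by
  induction k with
  | zero =>
    refine ⟨∅, ⟨by simp, by simp, ?_⟩, ?_⟩
    · intro z hz
      rw [hY0, Finset.mem_singleton] at hz
      rw [hz]
    · rw [hY0]
      have := @freeSides_le_two _ _ _ ∅ (32 * (s / 2 ^ 0)) x₀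
      simp only [potential, Finset.sum_empty, Finset.sum_singleton, Finset.range_zero]
      simp only [pow_zero, div_one] at this ⊢
      nlinarith
  | succ k ih =>
    obtain ⟨G, hG, hp⟩ := ih
    have h2 : s / 2 ^ k = 2 * (s / 2 ^ (k + 1)) := by rw [pow_succ]; field_simp
    have hs' : 0 < s / 2 ^ (k + 1) := by positivity
    obtain ⟨G', hG', hp'⟩ := exists_stage (b := b k) hs' hG (hY k) (hsep (k + 1))
      (fun y hy => by rw [← h2]; exact hcov k y hy) (hb k)
      (fun y hy => hflat k y (Finset.mem_sdiff.1 hy).1)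
    refine ⟨G', hG', ?_⟩
    have h3 := potential_half_le hG (ρ := 32 * (s / 2 ^ k)) (c := 4 * (s / 2 ^ k))
      (by positivity) (by ring_nf; rfl)
    rw [Finset.sum_range_succ]
    have h4 : 32 * (s / 2 ^ k) / 2 = 32 * (s / 2 ^ (k + 1)) := by rw [h2]; ring
    have h5 : 4 * (s / 2 ^ k) = 8 * (s / 2 ^ (k + 1)) := by rw [h2]; ring
    rw [h4] at h3
    rw [h5] at h3 hp
    linarith

end Stage

section Nets

variable {X : Type*} [MetricSpace X]

lemma exists_maximal_separated {F Y : Finset X} (hYF : Y ⊆ F) {r : ℝ}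
    (hsep : ∀ z ∈ Y, ∀ z' ∈ Y, z ≠ z' → r < dist z z') :
    ∃ Y', Y ⊆ Y' ∧ Y' ⊆ F ∧ (∀ z ∈ Y', ∀ z' ∈ Y', z ≠ z' → r < dist z z') ∧
      ∀ z ∈ F, z ∉ Y' → ∃ p ∈ Y', dist z p ≤ r := by
  obtain ⟨Y', hY', hmax⟩ := (F.powerset.filter fun Y' => Y ⊆ Y' ∧
    ∀ z ∈ Y', ∀ z' ∈ Y', z ≠ z' → r < dist z z').exists_max_image Finset.card
    ⟨Y, by simp [hYF]; exact hsep⟩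
  simp only [Finset.mem_filter, Finset.mem_powerset] at hY' hmax
  refine ⟨Y', hY'.2.1, hY'.1, hY'.2.2, fun z hz hzY => ?_⟩
  by_contra hcon
  push Not at hcon
  have := hmax (insert z Y') ⟨Finset.insert_subset hz hY'.1,
    hY'.2.1.trans (Finset.subset_insert _ _), ?_⟩
  · rw [Finset.card_insert_of_notMem hzY] at this
    omega
  · intro a ha c hc hac
    rcases Finset.mem_insert.1 ha with rfl | ha' <;> rcases Finset.mem_insert.1 hc with rfl | hc'
    · exact absurd rfl hac
    · exact hcon c hc'
    · rw [dist_comm]; exact hcon a ha'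
    · exact hY'.2.2 a ha' c hc' hac

lemma exists_nets {F : Finset X} {x₀ : X} (hx₀ : x₀ ∈ F) {s : ℝ} (hs : 0 < s)
    (hF : ∀ z ∈ F, dist z x₀ ≤ s) :
    ∃ Y : ℕ → Finset X, Y 0 = {x₀} ∧ (∀ k, Y k ⊆ Y (k + 1)) ∧ (∀ k, Y k ⊆ F) ∧
      (∀ k, ∀ z ∈ Y k, ∀ z' ∈ Y k, z ≠ z' → s / 2 ^ k < dist z z') ∧
      (∀ k, ∀ z ∈ F, ∃ p ∈ Y k, dist z p ≤ s / 2 ^ k) ∧ ∃ k, Y k = F := by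
  let P : ℕ → Finset X → Prop := fun k Y => Y ⊆ F ∧
    (∀ z ∈ Y, ∀ z' ∈ Y, z ≠ z' → s / 2 ^ k < dist z z') ∧ ∀ z ∈ F, ∃ p ∈ Y, dist z p ≤ s / 2 ^ k
  have hP0 : P 0 {x₀} := by
    refine ⟨by simpa using hx₀, ?_, fun z hz => ⟨x₀, by simp, by simpa using hF z hz⟩⟩
    intro z hz z' hz' hne
    rw [Finset.mem_singleton] at hz hz'
    exact absurd (hz.trans hz'.symm) hne
  have hstep : ∀ k Y, P k Y → ∃ Y', P (k + 1) Y' ∧ Y ⊆ Y' := by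
    intro k Y hY
    obtain ⟨Y', h1, h2, h3, h4⟩ := exists_maximal_separated hY.1 (r := s / 2 ^ (k + 1))
      (fun z hz z' hz' hne => lt_of_le_of_lt (by gcongr <;> simp) (hY.2.1 z hz z' hz' hne))
    refine ⟨Y', ⟨h2, h3, fun z hz => ?_⟩, h1⟩
    by_cases hzY : z ∈ Y'
    · exact ⟨z, hzY, by rw [dist_self]; positivity⟩
    · exact h4 z hz hzY
  choose! next hn1 hn2 using hstep
  let Y : ℕ → Finset X := fun k => Nat.rec {x₀} (fun k Y => next k Y) k
  have hY : ∀ k, P k (Y k) := by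
    intro k
    induction k with
    | zero => exact hP0
    | succ k ih => exact hn1 k _ ih
  refine ⟨Y, rfl, fun k => hn2 k _ (hY k), fun k => (hY k).1, fun k => (hY k).2.1,
    fun k => (hY k).2.2, ?_⟩
  obtain ⟨δ, hδ, hδF⟩ : ∃ δ > 0, ∀ z ∈ F, ∀ z' ∈ F, z ≠ z' → δ ≤ dist z z' := by
    rcases F.offDiag.eq_empty_or_nonempty with h0 | h0
    · refine ⟨1, one_pos, fun z hz z' hz' hne => ?_⟩
      have : (z, z') ∈ F.offDiag := Finset.mem_offDiag.2 ⟨hz, hz', hne⟩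
      rw [h0] at this
      exact absurd this (Finset.notMem_empty _)
    · obtain ⟨p, hp, hmin⟩ := F.offDiag.exists_min_image (fun p => dist p.1 p.2) h0
      exact ⟨dist p.1 p.2, dist_pos.2 (Finset.mem_offDiag.1 hp).2.2,
        fun z hz z' hz' hne => hmin (z, z') (Finset.mem_offDiag.2 ⟨hz, hz', hne⟩)⟩
  obtain ⟨k, hk⟩ := exists_pow_lt_of_lt_one (div_pos hδ hs) (by norm_num : (1 / 2 : ℝ) < 1)
  refine ⟨k, subset_antisymm (hY k).1 fun z hz => ?_⟩
  obtain ⟨p, hp, hd⟩ := (hY k).2.2 z hz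
  by_cases hzp : z = p
  · rwa [hzp]
  · have h1 := hδF z hz p ((hY k).1 hp) hzp
    have h2 : s / 2 ^ k < δ := by
      rw [lt_div_iff₀ hs] at hk
      rw [div_eq_mul_inv, ← inv_pow, mul_comm]
      simpa using hk
    linarith

end Nets

section Beta

variable {H : Type u} [NormedAddCommGroup H] [InnerProductSpace ℝ H]

lemma norm_sub_inner_smul_le_infDist {a v z : H} (hv : v ≠ 0) :
    ‖(z - a) - (inner ℝ (z - a) (‖v‖⁻¹ • v) : ℝ) • (‖v‖⁻¹ • v)‖ ≤ infDist z (lineThrough a v) := by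
  set e := ‖v‖⁻¹ • v with he
  have hv' : ‖v‖ ≠ 0 := norm_ne_zero_iff.2 hv
  have hee : ‖e‖ = 1 := by rw [he, norm_smul, norm_inv, norm_norm, inv_mul_cancel₀ hv']
  have hve : v = ‖v‖ • e := by rw [he, smul_smul, mul_inv_cancel₀ hv', one_smul]
  have hne : (lineThrough a v).Nonempty := ⟨a, 0, by simp⟩
  rw [le_infDist hne]
  rintro _ ⟨t, rfl⟩
  rw [dist_eq_norm]
  set u := z - a with hu
  have h1 : z - (a + t • v) = (u - (inner ℝ u e : ℝ) • e) + ((inner ℝ u e : ℝ) - t * ‖v‖) • e := by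
    rw [hu]; nth_rewrite 1 [hve]
    rw [smul_smul]; module
  have horth : inner ℝ (u - (inner ℝ u e : ℝ) • e) (((inner ℝ u e : ℝ) - t * ‖v‖) • e) = (0 : ℝ) := by
    rw [inner_smul_right, inner_sub_left u, inner_smul_left, real_inner_self_eq_norm_sq, hee]
    simp
  rw [h1]
  apply le_of_sq_le_sq _ (norm_nonneg _)
  rw [norm_add_sq_real, horth]
  nlinarith [norm_nonneg (((inner ℝ u e : ℝ) - t * ‖v‖) • e)]

lemma norm_sq_le_of_infDist_lineThrough {a v : H} (hv : v ≠ 0) {η : ℝ} {z z' : H}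
    (hz : infDist z (lineThrough a v) ≤ η) (hz' : infDist z' (lineThrough a v) ≤ η) :
    ‖z - z'‖ ^ 2 ≤ inner ℝ (z - z') (‖v‖⁻¹ • v) ^ 2 + (2 * η) ^ 2 := by
  have h1 := (norm_sub_inner_smul_le_infDist (a := a) (z := z) hv).trans hz
  have h2 := (norm_sub_inner_smul_le_infDist (a := a) (z := z') hv).trans hz'
  set e := ‖v‖⁻¹ • v with he
  have hv' : ‖v‖ ≠ 0 := norm_ne_zero_iff.2 hv
  have hee : ‖e‖ = 1 := by rw [he, norm_smul, norm_inv, norm_norm, inv_mul_cancel₀ hv']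
  set w := ((z - a) - (inner ℝ (z - a) e : ℝ) • e) - ((z' - a) - (inner ℝ (z' - a) e : ℝ) • e) with
      hw
  have hw2 : ‖w‖ ≤ 2 * η := (norm_sub_le _ _).trans (by linarith)
  have h3 : z - z' = w + (inner ℝ (z - z') e : ℝ) • e := by
    have : (inner ℝ (z - z') e : ℝ) = inner ℝ (z - a) e - inner ℝ (z' - a) e := by
      rw [← inner_sub_left]; congr 1; abel
    rw [hw, this]; module
  have horth : inner ℝ w ((inner ℝ (z - z') e : ℝ) • e) = (0 : ℝ) := by
    have h4 : w = (z - z') - (inner ℝ (z - z') e : ℝ) • e := eq_sub_of_add_eq h3.symm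
    rw [inner_smul_right, h4]
    generalize z - z' = u
    rw [inner_sub_left, inner_smul_left, real_inner_self_eq_norm_sq, hee]
    simp
  have h5 : ‖z - z'‖ ^ 2 = ‖w‖ ^ 2 + (inner ℝ (z - z') e : ℝ) ^ 2 := by
    nth_rewrite 1 [h3]
    rw [norm_add_sq_real, horth, norm_smul, hee, mul_one, Real.norm_eq_abs, sq_abs]
    ring
  rw [h5]
  nlinarith [norm_nonneg w]

lemma jonesBeta_nonneg (E Q : Set H) : 0 ≤ jonesBeta E Q := by
  unfold jonesBeta
  split_ifs
  · exact le_rfl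
  · apply Real.sInf_nonneg
    rintro r ⟨a, v, -, rfl⟩
    apply Real.sSup_nonneg
    rintro _ ⟨x, -, rfl⟩
    exact div_nonneg infDist_nonneg diam_nonneg

lemma exists_line_of_jonesBeta_lt [Nontrivial H] {E Q : Set H} (hE : IsBounded E)
    (hEQ : (E ∩ Q).Nonempty) {b : ℝ} (hb : jonesBeta E Q < b) :
    ∃ a v : H, v ≠ 0 ∧ ∀ z ∈ E ∩ Q, infDist z (lineThrough a v) / Metric.diam Q ≤ b := by
  unfold jonesBeta at hb
  rw [if_neg hEQ.ne_empty] at hb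
  obtain ⟨v₀, hv₀⟩ := exists_ne (0 : H)
  have hne : {r : ℝ | ∃ a v : H, v ≠ 0 ∧ r =
      sSup ((fun x => infDist x (lineThrough a v) / Metric.diam Q) '' (E ∩ Q))}.Nonempty :=
    ⟨_, 0, v₀, hv₀, rfl⟩
  obtain ⟨_, ⟨a, v, hv, rfl⟩, hlt⟩ := exists_lt_of_csInf_lt hne hb
  refine ⟨a, v, hv, fun z hz => le_trans ?_ hlt.le⟩
  refine le_csSup ?_ (mem_image_of_mem _ hz)
  obtain ⟨R, hR⟩ := hE.subset_closedBall a
  refine ⟨R / Metric.diam Q, ?_⟩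
  rintro _ ⟨x, hx, rfl⟩
  have : infDist x (lineThrough a v) ≤ dist x a := infDist_le_dist_of_mem (show a ∈ lineThrough a v
      from ⟨(0:ℝ), by rw [zero_smul, add_zero]⟩)
  have h2 : dist x a ≤ R := hR hx.1
  exact div_le_div_of_nonneg_right (this.trans h2) diam_nonneg

lemma jonesBeta_le {E Q : Set H} (a v : H) (hv : v ≠ 0) {r : ℝ} (hr : 0 ≤ r)
    (h : ∀ z ∈ E ∩ Q, infDist z (lineThrough a v) ≤ r * Metric.diam Q) : jonesBeta E Q ≤ r := by
  unfold jonesBeta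
  split_ifs with h0
  · exact hr
  · refine csInf_le_of_le (b := sSup ((fun x => infDist x (lineThrough a v) / Metric.diam Q) ''
        (E ∩ Q))) ?_ ⟨a, v, hv, rfl⟩ ?_
    · refine ⟨0, ?_⟩
      rintro r ⟨a, v, -, rfl⟩
      apply Real.sSup_nonneg
      rintro _ ⟨x, -, rfl⟩
      exact div_nonneg infDist_nonneg diam_nonneg
    · apply Real.sSup_le _ hr
      rintro _ ⟨x, hx, rfl⟩
      exact div_le_of_le_mul₀ diam_nonneg hr (h x hx)

end Beta

section Sums

lemma sum_le_tsum_of_injOn {ι α : Type*} (S : Finset ι) (f : ι → α) (hf : Set.InjOn f S)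
    (g : α → ℝ≥0∞) : ∑ i ∈ S, g (f i) ≤ ∑' a, g a := by
  rw [← Finset.sum_image hf]
  exact ENNReal.sum_le_tsum _

end Sums

section Sufficiency

variable {H : Type u} [NormedAddCommGroup H] [InnerProductSpace ℝ H]

lemma exists_pathLen_le {A : ℝ} (hA : 240 ≤ A) {E : Set H} {net : ℤ → Set H} (hE : IsBounded E)
    (hnet : IsMultiresolution E net) (hsum : betaSum E net A 2 < ⊤) (hd : 0 < Metric.diam E)
    {F : Finset H} (hF : (F : Set H) ⊆ E) :
    ∃ l : List H, (∀ x ∈ F, x ∈ l) ∧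
      pathLen l ≤ 80000000 * A * (Metric.diam E + (betaSum E net A 2).toReal) := by
  have hA0 : 0 < A := by linarith
  rcases F.eq_empty_or_nonempty with rfl | ⟨x₀, hx₀⟩
  · exact ⟨[], by simp, by simp only [pathLen]; positivity⟩
  have hEsub : ¬ E.Subsingleton := fun h => by
    rw [Metric.diam_subsingleton h] at hd; exact lt_irrefl _ hd
  obtain ⟨p, -, q, -, hpq⟩ := Set.not_subsingleton_iff.1 hEsub
  have hnt : Nontrivial H := ⟨p, q, hpq⟩
  obtain ⟨n, hn1, hn2⟩ := exists_mem_Ico_zpow hd (by norm_num : (1 : ℝ) < 2)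
  set s : ℝ := 2 ^ (n + 1) with hs
  have hs0 : 0 < s := by positivity
  have hs2 : s ≤ 2 * Metric.diam E := by
    rw [hs, zpow_add₀ (by norm_num), zpow_one]; linarith
  have hscale : ∀ k : ℕ, (2 : ℝ) ^ (-((k : ℤ) + 1 - n)) = s / 2 ^ (k + 1) / 2 := by
    intro k
    rw [hs, div_div, ← pow_succ, ← zpow_natCast, ← zpow_sub₀ (by norm_num)]
    congr 1
    push_cast
    ring
  obtain ⟨Y, hY0, hYmono, hYF, hYsep, hYcov, K, hYK⟩ := exists_nets hx₀ hs0 (fun z hz =>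
    (dist_le_diam_of_mem hE (hF hz) (hF hx₀)).trans hn2.le)
  have hpick : ∀ (k : ℕ) (y : H), ∃ x : H, y ∈ F →
      x ∈ net ((k : ℤ) + 1 - n) ∧ dist y x ≤ s / 2 ^ (k + 1) / 2 := by
    intro k y
    by_cases hy : y ∈ F
    · obtain ⟨x, hx, hxd⟩ := hnet.2 ((k : ℤ) + 1 - n) y (hF hy)
      exact ⟨x, fun _ => ⟨hx, (hscale k) ▸ hxd⟩⟩
    · exact ⟨0, fun h => absurd h hy⟩
  choose c hc using hpick
  let Q : ℕ → H → Set H := fun k y => closedBall (c k y) (A * (2 : ℝ) ^ (-((k : ℤ) + 1 - n)))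
  have hQdiam : ∀ k y, Metric.diam (Q k y) = A * (s / 2 ^ (k + 1)) := by
    intro k y
    simp only [Q]
    rw [hscale, diam_closedBall_eq _ (by positivity)]
    ring
  let b : ℕ → H → ℝ := fun k y => A * jonesBeta E (Q k y)
  have hb : ∀ k y, 0 ≤ b k y := fun k y => mul_nonneg hA0.le (jonesBeta_nonneg _ _)
  obtain ⟨G, hG, hpot⟩ := exists_connGraph hs0 hY0 hYmono hYsep
    (fun k y hy => hYcov k y (hYF _ hy)) hb (fun k y hy b' hb' => by
      have hyF := hYF _ hy
      obtain ⟨hcn, hcd⟩ := hc k y hyF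
      have hs' : 0 < s / 2 ^ (k + 1) := by positivity
      have hwin : ∀ z, dist z y ≤ 70 * (s / 2 ^ (k + 1)) → z ∈ Q k y := by
        intro z hz
        simp only [Q, mem_closedBall]
        rw [hscale]
        have := dist_triangle z y (c k y)
        nlinarith
      have hlt : jonesBeta E (Q k y) < b' / A := by
        rw [lt_div_iff₀ hA0, mul_comm]; exact hb'
      obtain ⟨a, v, hv, hav⟩ := exists_line_of_jonesBeta_lt hE
        ⟨y, hF hyF, hwin y (by rw [dist_self]; positivity)⟩ hlt
      have hdist : ∀ z ∈ Y (k + 1), dist z y ≤ 70 * (s / 2 ^ (k + 1)) →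
          infDist z (lineThrough a v) ≤ b' * (s / 2 ^ (k + 1)) := by
        intro z hz hzy
        have := hav z ⟨hF (hYF _ hz), hwin z hzy⟩
        rw [hQdiam, div_le_div_iff₀ (by positivity) hA0] at this
        have h2 : b' * (A * (s / 2 ^ (k + 1))) = (b' * (s / 2 ^ (k + 1))) * A := by ring
        rw [h2] at this
        exact le_of_mul_le_mul_right this hA0
      refine ⟨‖v‖⁻¹ • v, ?_, fun z hz z' hz' hzd hzd' => ?_⟩
      · rw [norm_smul, norm_inv, norm_norm, inv_mul_cancel₀ (norm_ne_zero_iff.2 hv)]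
      · rw [mul_assoc]
        exact norm_sq_le_of_infDist_lineThrough hv (hdist z hz hzd) (hdist z' hz' hzd')) K
  obtain ⟨l, T, hT, hl⟩ := exists_tour G x₀ (Y K) hG.reach
  refine ⟨l, fun x hx => hl x (by rw [hYK]; exact hx), ?_⟩
  have h1 : pathLen l ≤ 2 * ∑ e ∈ G, dist e.1 e.2 := by
    refine hT.len.trans ?_
    have := Finset.sum_le_sum_of_subset_of_nonneg hT.subset
      (fun e _ _ => dist_nonneg (x := e.1) (y := e.2))
    linarith
  have h2 := sum_dist_le_potential (G := G) (ρ := 32 * (s / 2 ^ K)) (Z := Y K)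
    (ph := fun _ => 4 * (s / 2 ^ K)) (fun _ _ => by positivity)
  have h3 : ∑ j ∈ Finset.range K, ∑ y ∈ Y (j + 1) \ Y j, b j y ^ 2 * (s / 2 ^ (j + 1)) ≤
      A * (betaSum E net A 2).toReal := by
    have h4 : ∀ j y, b j y ^ 2 * (s / 2 ^ (j + 1)) =
        A * (jonesBeta E (Q j y) ^ (2 : ℝ) * Metric.diam (Q j y)) := by
      intro j y
      rw [hQdiam, Real.rpow_two]
      simp only [b]
      ring
    simp only [h4, ← Finset.mul_sum]
    refine mul_le_mul_of_nonneg_left ?_ hA0.le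
    have hnn : ∀ j y, 0 ≤ jonesBeta E (Q j y) ^ (2 : ℝ) * Metric.diam (Q j y) := fun j y =>
      mul_nonneg (Real.rpow_nonneg (jonesBeta_nonneg _ _) _) diam_nonneg
    rw [← ENNReal.ofReal_le_iff_le_toReal hsum.ne,
      ENNReal.ofReal_sum_of_nonneg fun j _ => Finset.sum_nonneg fun y _ => hnn j y]
    unfold betaSum
    have h5 : Set.InjOn (fun j : ℕ => (j : ℤ) + 1 - n) (Finset.range K : Set ℕ) := by
      intro i _ j _ hij
      simp only at hij
      omega
    refine le_trans ?_ (sum_le_tsum_of_injOn (Finset.range K) (fun j : ℕ => (j : ℤ) + 1 - n) h5 _)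
    refine Finset.sum_le_sum fun j _ => ?_
    rw [ENNReal.ofReal_sum_of_nonneg fun y _ => hnn j y]
    obtain ⟨w, hw, -⟩ := hnet.2 ((j : ℤ) + 1 - n) x₀ (hF hx₀)
    let ι : H → net ((j : ℤ) + 1 - n) := fun y =>
      if hy : y ∈ F then ⟨c j y, (hc j y hy).1⟩ else ⟨w, hw⟩
    have hι : ∀ y ∈ F, (ι y : H) = c j y := fun y hy => by simp only [ι, dif_pos hy]
    have hinj : Set.InjOn ι (Y (j + 1) \ Y j : Finset H) := by
      intro y hy y' hy' hyy
      have hy := (Finset.mem_sdiff.1 hy).1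
      have hy' := (Finset.mem_sdiff.1 hy').1
      by_contra hne
      have h6 : c j y = c j y' := by
        rw [← hι y (hYF _ hy), ← hι y' (hYF _ hy'), hyy]
      have h7 := hYsep (j + 1) y hy y' hy' hne
      have h8 := (hc j y (hYF _ hy)).2
      have h9 := (hc j y' (hYF _ hy')).2
      rw [← h6] at h9
      have := dist_triangle_right y y' (c j y)
      linarith
    refine le_trans ?_ (sum_le_tsum_of_injOn _ ι hinj _)
    refine Finset.sum_le_sum fun y hy => ?_
    rw [hι y (hYF _ (Finset.mem_sdiff.1 hy).1)]
  have h5 : (0 : ℝ) ≤ (betaSum E net A 2).toReal := ENNReal.toReal_nonneg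
  nlinarith

lemma hausdorffMeasure_image_Icc_le {H : Type u} [NormedAddCommGroup H] [MeasurableSpace H]
    [BorelSpace H] {f : ℝ → H}
    (hf : LipschitzWith 1 f) {L : ℝ} (hL : 0 ≤ L) :
    IsRectifiableCurve (f '' Icc 0 L) ∧ μH[1] (f '' Icc 0 L) ≤ ENNReal.ofReal L := by
  have h1 : μH[1] (f '' Icc 0 L) ≤ ENNReal.ofReal L := by
    have := hf.hausdorffMeasure_image_le (d := 1) zero_le_one (Icc 0 L)
    simpa [hausdorffMeasure_real] using this
  refine ⟨⟨⟨fun t => f (L * t), (hf.continuous.comp (by fun_prop)).continuousOn, ?_⟩,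
    h1.trans_lt ENNReal.ofReal_lt_top⟩, h1⟩
  ext x
  constructor
  · rintro ⟨t, ht, rfl⟩
    rcases hL.eq_or_lt with h | h
    · have : t = 0 := le_antisymm (h ▸ ht.2) ht.1
      exact ⟨0, by simp, by simp [this]⟩
    · exact ⟨t / L, ⟨div_nonneg ht.1 hL, div_le_one_of_le₀ ht.2 hL⟩, by
        simp only; rw [mul_div_cancel₀ _ h.ne']⟩
  · rintro ⟨t, ht, rfl⟩
    exact ⟨L * t, ⟨mul_nonneg hL ht.1, mul_le_of_le_one_right hL ht.2⟩, rfl⟩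

lemma exists_curve_of_betaSum [CompleteSpace H] [MeasurableSpace H] [BorelSpace H] {A : ℝ}
    (hA : 240 ≤ A) {E : Set H} {net : ℤ → Set H} (hne : E.Nonempty) (hE : IsBounded E)
    (hnet : IsMultiresolution E net) (hsum : betaSum E net A 2 < ⊤) :
    ∃ Γ : Set H, E ⊆ Γ ∧ IsRectifiableCurve Γ ∧
      μH[1] Γ ≤ ENNReal.ofReal (80000000 * A) * SEp E net A 2 := by
  have hA0 : 0 < A := by linarith
  rcases (diam_nonneg (s := E)).eq_or_lt with h0 | hd
  · obtain ⟨x, hx⟩ := hne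
    have hlip : LipschitzWith 1 fun _ : ℝ => x := (LipschitzWith.const x).weaken zero_le_one
    obtain ⟨h1, h2⟩ := hausdorffMeasure_image_Icc_le hlip le_rfl
    refine ⟨(fun _ : ℝ => x) '' Icc 0 0, fun y hy => ⟨0, by simp, ?_⟩, h1, h2.trans (by simp)⟩
    have := dist_le_diam_of_mem hE hx hy
    rw [← h0] at this
    exact dist_le_zero.1 this
  · obtain ⟨hL, f, hf, hEf⟩ := exists_lipschitz_curve hne
      (fun F hF => exists_pathLen_le hA hE hnet hsum hd hF)
    obtain ⟨h1, h2⟩ := hausdorffMeasure_image_Icc_le hf hL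
    refine ⟨_, hEf, h1, h2.trans ?_⟩
    rw [ENNReal.ofReal_mul (by positivity), ENNReal.ofReal_add hd.le ENNReal.toReal_nonneg,
      ENNReal.ofReal_toReal hsum.ne]
    rfl

end Sufficiency

section Cover

variable {X : Type u} [MetricSpace X]

/-- A finite cover of `Γ` by bounded sets of diameter at most `δ`. -/
def IsFineCover (Γ : Set X) (δ : ℝ) (𝒰 : Finset (Set X)) : Prop :=
  Γ ⊆ ⋃ U ∈ 𝒰, U ∧ ∀ U ∈ 𝒰, IsBounded U ∧ Metric.diam U ≤ δ

/-- The finite-cover version of the one-dimensional Hausdorff premeasure at scale `δ`. -/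
def coverLength (Γ : Set X) (δ : ℝ) : ℝ :=
  sInf ((fun 𝒰 : Finset (Set X) => ∑ U ∈ 𝒰, Metric.diam U) '' {𝒰 | IsFineCover Γ δ 𝒰})

/-- The members of `𝒰` meeting `T`. -/
def meeting (𝒰 : Finset (Set X)) (T : Set X) : Finset (Set X) :=
  𝒰.filter fun U => (U ∩ T).Nonempty

lemma coverLength_le_sum {Γ : Set X} {δ : ℝ} {𝒰 : Finset (Set X)} (h : IsFineCover Γ δ 𝒰) :
    coverLength Γ δ ≤ ∑ U ∈ 𝒰, Metric.diam U := by
  refine csInf_le ⟨0, ?_⟩ ⟨𝒰, h, rfl⟩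
  rintro _ ⟨𝒱, -, rfl⟩
  exact Finset.sum_nonneg fun _ _ => diam_nonneg

lemma coverLength_nonneg (Γ : Set X) (δ : ℝ) : 0 ≤ coverLength Γ δ := by
  apply Real.sInf_nonneg
  rintro _ ⟨𝒱, -, rfl⟩
  exact Finset.sum_nonneg fun _ _ => diam_nonneg

lemma exists_isFineCover {f : ℝ → X} (hf : LipschitzWith 1 f) {L δ : ℝ} (hL : 0 ≤ L) (hδ : 0 < δ) :
    ∃ 𝒰, IsFineCover (f '' Icc 0 L) δ 𝒰 ∧ ∑ U ∈ 𝒰, Metric.diam U ≤ L := by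
  obtain ⟨m, hm⟩ := exists_nat_gt (L / δ)
  have hm0 : (0 : ℝ) < m := lt_of_le_of_lt (by positivity) hm
  have hd : ∀ j : ℕ, Metric.diam (f '' Icc (j * (L / m)) ((j + 1) * (L / m))) ≤ L / m := by
    intro j
    refine diam_le_of_forall_dist_le (by positivity) ?_
    rintro _ ⟨s, hs, rfl⟩ _ ⟨t, ht, rfl⟩
    refine (hf.dist_le_mul s t).trans ?_
    rw [NNReal.coe_one, one_mul, Real.dist_eq, abs_le]
    constructor <;> nlinarith [hs.1, hs.2, ht.1, ht.2]
  refine ⟨(Finset.range m).image fun j : ℕ => f '' Icc (j * (L / m)) ((j + 1) * (L / m)),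
    ⟨?_, ?_⟩, ?_⟩
  · rintro _ ⟨t, ht, rfl⟩
    simp only [Finset.mem_image, Finset.mem_range, iUnion_exists, biUnion_and',
        iUnion_iUnion_eq_right,
      mem_iUnion]
    rcases ht.1.eq_or_lt with rfl | ht0
    · exact ⟨0, by exact_mod_cast hm0, 0, by constructor <;> simp; positivity, rfl⟩
    · have hL0 : 0 < L := ht0.trans_le ht.2
      have hLm : 0 < L / m := by positivity
      have hc : 0 < ⌈t / (L / m)⌉₊ := Nat.ceil_pos.2 (by positivity)
      refine ⟨⌈t / (L / m)⌉₊ - 1, ?_, t, ⟨?_, ?_⟩, rfl⟩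
      · have : ⌈t / (L / m)⌉₊ ≤ m := by
          apply Nat.ceil_le.2
          rw [div_le_iff₀ hLm, mul_div_cancel₀ _ hm0.ne']
          exact ht.2
        omega
      · have := Nat.ceil_lt_add_one (show 0 ≤ t / (L / m) by positivity)
        rw [Nat.cast_sub (by omega), ← le_div_iff₀ hLm]
        push_cast; linarith
      · rw [Nat.cast_sub (by omega), ← div_le_iff₀ hLm]
        have := Nat.le_ceil (t / (L / m))
        push_cast; linarith
  · intro U hU
    obtain ⟨j, -, rfl⟩ := Finset.mem_image.1 hU
    refine ⟨(isCompact_Icc.image hf.continuous).isBounded, (hd j).trans ?_⟩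
    rw [div_le_iff₀ hm0]
    rw [div_lt_iff₀ hδ] at hm
    linarith
  · refine (Finset.sum_image_le_of_nonneg fun _ _ => diam_nonneg).trans ?_
    refine (Finset.sum_le_sum fun j _ => hd j).trans ?_
    rw [Finset.sum_const, Finset.card_range, nsmul_eq_mul, mul_div_cancel₀ _ hm0.ne']

lemma coverLength_le {f : ℝ → X} (hf : LipschitzWith 1 f) {L δ : ℝ} (hL : 0 ≤ L) (hδ : 0 < δ) :
    coverLength (f '' Icc 0 L) δ ≤ L := by
  obtain ⟨𝒰, h, h'⟩ := exists_isFineCover hf hL hδ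
  exact (coverLength_le_sum h).trans h'

lemma le_sum_diam_meeting {Γ : Set X} {δ : ℝ} {𝒰 : Finset (Set X)} (h𝒰 : IsFineCover Γ δ 𝒰)
    {T : Set X} (hT : T ⊆ Γ) {φ : X → ℝ} (hφ : ∀ x y, |φ x - φ y| ≤ dist x y) {α β : ℝ}
    (hαβ : Icc α β ⊆ φ '' T) : β - α ≤ ∑ U ∈ meeting 𝒰 T, Metric.diam U := by
  have h1 : Icc α β ⊆ ⋃ U ∈ meeting 𝒰 T, φ '' U := by
    intro t ht
    obtain ⟨p, hp, rfl⟩ := hαβ ht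
    obtain ⟨U, hU, hpU⟩ := mem_iUnion₂.1 (h𝒰.1 (hT hp))
    exact mem_iUnion₂.2 ⟨U, Finset.mem_filter.2 ⟨hU, p, hpU, hp⟩, mem_image_of_mem _ hpU⟩
  have h2 : ∀ U ∈ meeting 𝒰 T, volume (φ '' U) ≤ ENNReal.ofReal (Metric.diam U) := by
    intro U hU
    refine (Real.volume_le_diam _).trans ?_
    apply ediam_le
    rintro _ ⟨x, hx, rfl⟩ _ ⟨y, hy, rfl⟩
    rw [edist_dist, Real.dist_eq]
    exact ENNReal.ofReal_le_ofReal ((hφ x y).trans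
      (dist_le_diam_of_mem (h𝒰.2 U (Finset.mem_filter.1 hU).1).1 hx hy))
  have h3 := (measure_mono h1).trans ((measure_biUnion_finset_le (μ := volume) _ _).trans
    (Finset.sum_le_sum h2))
  rw [Real.volume_Icc, ← ENNReal.ofReal_sum_of_nonneg fun _ _ => diam_nonneg] at h3
  exact (ENNReal.ofReal_le_ofReal_iff (Finset.sum_nonneg fun _ _ => diam_nonneg)).1 h3

lemma coverLength_add_le {ι κ : Type*} {Γ : Set X} {δ δ' d : ℝ} (hδ : 0 < δ) (hd0 : 0 ≤ d)
    (hδδ' : d + 2 * δ ≤ δ') (hne : ∃ 𝒰, IsFineCover Γ δ 𝒰) (J : Finset ι) (Y : Finset κ) (σ : ι → κ)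
    (hσ : ∀ i ∈ J, σ i ∈ Y) (T : ι → Set X) (m : ι → ℝ)
    (hsep : ∀ i ∈ J, ∀ j ∈ J, i ≠ j → ∀ u ∈ T i, ∀ v ∈ T j, δ < dist u v)
    (hm : ∀ 𝒰, IsFineCover Γ δ 𝒰 → ∀ j ∈ J, m j ≤ ∑ U ∈ meeting 𝒰 (T j), Metric.diam U)
    (hd : ∀ i ∈ J, ∀ j ∈ J, σ i = σ j → ∀ u ∈ T i, ∀ v ∈ T j, dist u v ≤ d) :
    coverLength Γ δ' + ∑ j ∈ J, m j ≤ coverLength Γ δ + Y.card * (d + 2 * δ) := by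
  rw [← sub_le_iff_le_add]
  refine le_csInf (Set.Nonempty.image _ hne) ?_
  rintro _ ⟨𝒰, h𝒰, rfl⟩
  change _ ≤ ∑ U ∈ 𝒰, Metric.diam U
  let V : κ → Set X := fun y => ⋃ U ∈ 𝒰.filter fun U => ∃ j ∈ J, σ j = y ∧ (U ∩ T j).Nonempty, U
  let 𝒱 := 𝒰.filter fun U => ¬ ∃ j ∈ J, (U ∩ T j).Nonempty
  have hVb : ∀ y, IsBounded (V y) := fun y =>
    (isBounded_biUnion_finset _).2 fun U hU => (h𝒰.2 U (Finset.mem_filter.1 hU).1).1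
  have hVd : ∀ y, Metric.diam (V y) ≤ d + 2 * δ := by
    intro y
    refine diam_le_of_forall_dist_le (by linarith) fun u hu v hv => ?_
    obtain ⟨U, hU, hu⟩ := mem_iUnion₂.1 hu
    obtain ⟨U', hU', hv⟩ := mem_iUnion₂.1 hv
    obtain ⟨hU, i, hi, hiy, u', hu'⟩ := Finset.mem_filter.1 hU
    obtain ⟨hU', j, hj, hjy, v', hv'⟩ := Finset.mem_filter.1 hU'
    have h1 := hd i hi j hj (hiy.trans hjy.symm) u' hu'.2 v' hv'.2
    have h2 := (dist_le_diam_of_mem (h𝒰.2 U hU).1 hu hu'.1).trans (h𝒰.2 U hU).2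
    have h3 := (dist_le_diam_of_mem (h𝒰.2 U' hU').1 hv'.1 hv).trans (h𝒰.2 U' hU').2
    have := dist_triangle4 u u' v' v
    linarith
  have hcov : IsFineCover Γ δ' (𝒱 ∪ Y.image V) := by
    constructor
    · intro p hp
      obtain ⟨U, hU, hpU⟩ := mem_iUnion₂.1 (h𝒰.1 hp)
      by_cases h : ∃ j ∈ J, (U ∩ T j).Nonempty
      · obtain ⟨j, hj, hne⟩ := h
        exact mem_iUnion₂.2 ⟨V (σ j), Finset.mem_union_right _ (Finset.mem_image_of_mem _
            (hσ j hj)),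
          mem_iUnion₂.2 ⟨U, Finset.mem_filter.2 ⟨hU, j, hj, rfl, hne⟩, hpU⟩⟩
      · exact mem_iUnion₂.2 ⟨U, Finset.mem_union_left _ (Finset.mem_filter.2 ⟨hU, h⟩), hpU⟩
    · intro U hU
      rcases Finset.mem_union.1 hU with hU | hU
      · have := h𝒰.2 U (Finset.mem_filter.1 hU).1
        exact ⟨this.1, by linarith⟩
      · obtain ⟨y, -, rfl⟩ := Finset.mem_image.1 hU
        exact ⟨hVb y, (hVd y).trans hδδ'⟩
  have h1 : coverLength Γ δ' ≤ ∑ U ∈ 𝒱, Metric.diam U + Y.card * (d + 2 * δ) := by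
    refine (coverLength_le_sum hcov).trans ?_
    have h2 : ∑ U ∈ Y.image V, Metric.diam U ≤ Y.card * (d + 2 * δ) := by
      refine (Finset.sum_image_le_of_nonneg fun _ _ => diam_nonneg).trans ?_
      refine (Finset.sum_le_sum fun y _ => hVd y).trans ?_
      rw [Finset.sum_const, nsmul_eq_mul]
    have h3 := Finset.sum_union_inter (s₁ := 𝒱) (s₂ := Y.image V) (f := fun U => Metric.diam U)
    have h4 : 0 ≤ ∑ U ∈ 𝒱 ∩ Y.image V, Metric.diam U := Finset.sum_nonneg fun _ _ => diam_nonneg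
    linarith
  have h2 : ∑ j ∈ J, m j ≤ ∑ U ∈ 𝒰.filter fun U => ∃ j ∈ J, (U ∩ T j).Nonempty, Metric.diam U := by
    refine (Finset.sum_le_sum (hm 𝒰 h𝒰)).trans ?_
    rw [← Finset.sum_biUnion]
    · refine Finset.sum_le_sum_of_subset_of_nonneg ?_ fun _ _ _ => diam_nonneg
      intro U hU
      obtain ⟨j, hj, hU⟩ := Finset.mem_biUnion.1 hU
      obtain ⟨hU, hne⟩ := Finset.mem_filter.1 hU
      exact Finset.mem_filter.2 ⟨hU, j, hj, hne⟩
    · intro i hi j hj hij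
      refine Finset.disjoint_left.2 fun U hU hU' => ?_
      obtain ⟨hU, u, hu⟩ := Finset.mem_filter.1 hU
      obtain ⟨-, v, hv⟩ := Finset.mem_filter.1 hU'
      have := hsep i hi j hj hij u hu.2 v hv.2
      have h5 := (dist_le_diam_of_mem (h𝒰.2 U hU).1 hu.1 hv.1).trans (h𝒰.2 U hU).2
      linarith
  have h3 := Finset.sum_filter_add_sum_filter_not 𝒰 (fun U => ∃ j ∈ J, (U ∩ T j).Nonempty)
    fun U => Metric.diam U
  linarith

end Cover

section Telescope

lemma sum_sub_shift_le {a : ℕ → ℝ} {B : ℝ} (h0 : ∀ i, 0 ≤ a i) (hB : ∀ i, a i ≤ B) (q K : ℕ) :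
    ∑ j ∈ Finset.range K, (a (j + q) - a j) ≤ q * B := by
  have h1 := Finset.sum_range_add a q K
  have h2 := Finset.sum_range_add a K q
  rw [add_comm q K, h2] at h1
  have h3 : ∑ j ∈ Finset.range q, a (K + j) ≤ q * B := by
    refine (Finset.sum_le_sum fun j _ => hB (K + j)).trans ?_
    rw [Finset.sum_const, Finset.card_range, nsmul_eq_mul]
  have h4 : 0 ≤ ∑ j ∈ Finset.range q, a j := Finset.sum_nonneg fun i _ => h0 i
  rw [Finset.sum_sub_distrib]
  simp only [add_comm q] at h1
  linarith

variable {X : Type u} [MetricSpace X]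

lemma IsFineCover.mono {Γ : Set X} {δ δ' : ℝ} (h : δ ≤ δ') {𝒰 : Finset (Set X)}
    (h𝒰 : IsFineCover Γ δ 𝒰) : IsFineCover Γ δ' 𝒰 :=
  ⟨h𝒰.1, fun U hU => ⟨(h𝒰.2 U hU).1, (h𝒰.2 U hU).2.trans h⟩⟩

lemma coverLength_anti {Γ : Set X} {δ δ' : ℝ} (h : δ ≤ δ') (hne : ∃ 𝒰, IsFineCover Γ δ 𝒰) :
    coverLength Γ δ' ≤ coverLength Γ δ := by
  refine le_csInf (Set.Nonempty.image _ hne) ?_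
  rintro _ ⟨𝒰, h𝒰, rfl⟩
  exact coverLength_le_sum (h𝒰.mono h)

lemma sum_coverLength_sub_le {f : ℝ → X} (hf : LipschitzWith 1 f) {L : ℝ} (hL : 0 ≤ L) {h₀ : ℝ}
    (hh₀ : 0 < h₀) {κ κ' : ℝ} (hκ : 0 < κ) (hκ' : 0 < κ') :
    ∃ C : ℝ, 0 ≤ C ∧ ∀ K, ∑ j ∈ Finset.range K, (coverLength (f '' Icc 0 L) (κ * (h₀ / 2 ^ j)) -
      coverLength (f '' Icc 0 L) (κ' * (h₀ / 2 ^ j))) ≤ C := by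
  obtain ⟨q, hq⟩ := pow_unbounded_of_one_lt (κ' / κ) (one_lt_two (α := ℝ))
  rw [div_lt_iff₀ hκ] at hq
  refine ⟨q * L, by positivity, fun K => ?_⟩
  refine le_trans (Finset.sum_le_sum fun j _ => ?_)
    (sum_sub_shift_le (a := fun i => coverLength (f '' Icc 0 L) (κ * 2 ^ q * (h₀ / 2 ^ i)))
    (fun i => coverLength_nonneg _ _) (fun i => coverLength_le hf hL (by positivity)) q K)
  have h1 : κ * 2 ^ q * (h₀ / 2 ^ (j + q)) = κ * (h₀ / 2 ^ j) := by
    rw [pow_add]; field_simp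
  rw [h1]
  have hp : 0 < h₀ / 2 ^ j := by positivity
  obtain ⟨𝒰, h𝒰, -⟩ := exists_isFineCover hf hL (δ := κ' * (h₀ / 2 ^ j)) (by positivity)
  have := coverLength_anti (Γ := f '' Icc 0 L) (δ := κ' * (h₀ / 2 ^ j))
    (δ' := κ * 2 ^ q * (h₀ / 2 ^ j)) (by nlinarith) ⟨𝒰, h𝒰⟩
  linarith

end Telescope

section Nets

variable {X : Type u} [MetricSpace X]

/-- `N j` is a maximal `h₀ / 2 ^ j`-separated subset of `Γ`. -/
structure IsNetFamily (Γ : Set X) (h₀ : ℝ) (N : ℕ → Finset X) : Prop where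
  mem : ∀ j, ∀ x ∈ N j, x ∈ Γ
  sep : ∀ j, ∀ x ∈ N j, ∀ y ∈ N j, x ≠ y → h₀ / 2 ^ j ≤ dist x y
  exists_near : ∀ j, ∀ p ∈ Γ, ∃ x ∈ N j, dist p x ≤ h₀ / 2 ^ j

/-- The points of `N` having more than `C₀` points of `N` within distance `R`. -/
def crowded (N : Finset X) (R : ℝ) (C₀ : ℕ) : Finset X :=
  N.filter fun x => C₀ < (N.filter fun y => dist y x ≤ R).card

lemma Icc_subset_dist_image {Γ : Set X} (hΓ : IsPreconnected Γ) {x p : X} (hx : x ∈ Γ) (hp : p ∈ Γ)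
    {r : ℝ} (hr : r ≤ dist p x) :
    Icc 0 r ⊆ (fun y => dist y x) '' (Γ ∩ closedBall x r) := by
  intro t ht
  obtain ⟨y, hy, hyt⟩ := hΓ.intermediate_value hx hp
    (f := fun y => dist y x) (by fun_prop) ⟨by simpa using ht.1, ht.2.trans hr⟩
  exact ⟨y, ⟨hy, hyt.trans_le ht.2⟩, hyt⟩

lemma le_sum_diam_meeting_closedBall {Γ : Set X} (hΓ : IsPreconnected Γ) {x p : X} (hx : x ∈ Γ)
    (hp : p ∈ Γ) {r : ℝ} (hr : r ≤ dist p x) {δ : ℝ} {𝒰 : Finset (Set X)}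
    (h𝒰 : IsFineCover Γ δ 𝒰) : r ≤ ∑ U ∈ meeting 𝒰 (Γ ∩ closedBall x r), Metric.diam U := by
  have := le_sum_diam_meeting h𝒰 inter_subset_left (φ := fun y => dist y x)
    (fun y z => abs_dist_sub_le y z x) (Icc_subset_dist_image hΓ hx hp hr)
  linarith

lemma card_crowded_mul_le {Γ : Set X} (hΓ : IsPreconnected Γ) {N : Finset X} {h : ℝ} (hh : 0 < h)
    (hN : ∀ x ∈ N, x ∈ Γ) (hsep : ∀ x ∈ N, ∀ y ∈ N, x ≠ y → h ≤ dist x y)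
    (hbig : ∀ x ∈ Γ, ∃ p ∈ Γ, h ≤ dist p x) (hne : ∃ 𝒰, IsFineCover Γ (h / 8) 𝒰)
    {ρ : ℝ} (hρ : 1 ≤ ρ) {C₀ : ℕ} (hC₀ : 48 * ρ + 6 ≤ C₀) :
    coverLength Γ (8 * ρ * h) + (crowded N (ρ * h) C₀).card * (h / 8) ≤ coverLength Γ (h / 8) := by
  obtain ⟨Y, -, hYF, hYsep, hYmax⟩ := exists_maximal_separated (F := crowded N (ρ * h) C₀) (Y := ∅)
    (Finset.empty_subset _) (r := 3 * (ρ * h)) (by simp)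
  have hρh : h ≤ ρ * h := by nlinarith
  have hYN : ∀ y ∈ Y, y ∈ N := fun y hy => (Finset.mem_filter.1 (hYF hy)).1
  have key : ∀ x : X, (∃ y ∈ Y, dist x y ≤ 3 * (ρ * h)) →
      ∃ y ∈ Y, dist x y ≤ 3 * (ρ * h) ∧ ∀ y' ∈ Y, dist x y' ≤ ρ * h → y = y' := by
    intro x hx
    by_cases h1 : ∃ y ∈ Y, dist x y ≤ ρ * h
    · obtain ⟨y, hy, hxy⟩ := h1
      refine ⟨y, hy, by linarith, fun y' hy' hxy' => ?_⟩
      by_contra hyy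
      have := hYsep y hy y' hy' hyy
      have := dist_triangle_left y y' x
      linarith
    · obtain ⟨y, hy, hxy⟩ := hx
      exact ⟨y, hy, hxy, fun y' hy' hxy' => (h1 ⟨y', hy', hxy'⟩).elim⟩
  choose! σ hσY hσd hσu using key
  let J := N.filter fun x => ∃ y ∈ Y, dist x y ≤ 3 * (ρ * h)
  have hJN : ∀ x ∈ J, x ∈ N := fun x hx => (Finset.mem_filter.1 hx).1
  have hJ : ∀ x ∈ J, ∃ y ∈ Y, dist x y ≤ 3 * (ρ * h) := fun x hx => (Finset.mem_filter.1 hx).2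
  have hsub : crowded N (ρ * h) C₀ ⊆ J := by
    intro x hx
    refine Finset.mem_filter.2 ⟨(Finset.mem_filter.1 hx).1, ?_⟩
    by_cases hxY : x ∈ Y
    · exact ⟨x, hxY, by rw [dist_self]; linarith⟩
    · exact hYmax x hx hxY
  have hcard : Y.card * C₀ ≤ J.card := by
    rw [Finset.card_eq_sum_card_fiberwise (f := σ) (s := J) (t := Y) fun x hx => hσY x (hJ x hx)]
    rw [← smul_eq_mul, ← Finset.sum_const]
    refine Finset.sum_le_sum fun y hy => ?_
    refine (Finset.mem_filter.1 (hYF hy)).2.le.trans (Finset.card_le_card ?_)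
    intro x hx
    obtain ⟨hxN, hxy⟩ := Finset.mem_filter.1 hx
    have hx3 : ∃ y ∈ Y, dist x y ≤ 3 * (ρ * h) := ⟨y, hy, by linarith⟩
    exact Finset.mem_filter.2 ⟨Finset.mem_filter.2 ⟨hxN, hx3⟩, hσu x hx3 y hy hxy⟩
  have hmerge := coverLength_add_le (Γ := Γ) (δ := h / 8) (δ' := 8 * ρ * h) (d := 6 * (ρ * h) +
      h / 2)
    (by positivity) (by positivity) (by linarith) hne J Y σ (fun x hx => hσY x (hJ x hx))
    (fun x => Γ ∩ closedBall x (h / 4)) (fun _ => h / 4) ?_ ?_ ?_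
  · rw [Finset.sum_const, nsmul_eq_mul] at hmerge
    have h1 : ((crowded N (ρ * h) C₀).card : ℝ) ≤ J.card := by
      exact_mod_cast Finset.card_le_card hsub
    have h2 : (Y.card : ℝ) * C₀ ≤ J.card := by exact_mod_cast hcard
    have h3 : (Y.card : ℝ) * (48 * ρ + 6) ≤ J.card :=
      (mul_le_mul_of_nonneg_left hC₀ (Nat.cast_nonneg _)).trans h2
    nlinarith
  · intro x hx y hy hxy u hu v hv
    have h1 := hsep x (hJN x hx) y (hJN y hy) hxy
    have h2 : dist u x ≤ h / 4 := hu.2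
    have h3 : dist v y ≤ h / 4 := hv.2
    have := dist_triangle4 x u v y
    rw [dist_comm x u] at this
    linarith
  · intro 𝒰 h𝒰 x hx
    obtain ⟨p, hp, hpx⟩ := hbig x (hN x (hJN x hx))
    exact le_sum_diam_meeting_closedBall hΓ (hN x (hJN x hx)) hp (by linarith) h𝒰
  · intro x hx y hy hxy u hu v hv
    have h2 : dist u x ≤ h / 4 := hu.2
    have h3 : dist v y ≤ h / 4 := hv.2
    have h4 := hσd x (hJ x hx)
    have h5 := hσd y (hJ y hy)
    rw [← hxy] at h5
    have h6 := dist_triangle_right x y (σ x)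
    have := dist_triangle4 u x y v
    rw [dist_comm y v] at this
    linarith

lemma exists_bound_sum_crowded {f : ℝ → X} (hf : LipschitzWith 1 f) {L : ℝ} (hL : 0 ≤ L) {h₀ : ℝ}
    (hh₀ : 0 < h₀) {N : ℕ → Finset X} (hN : IsNetFamily (f '' Icc 0 L) h₀ N)
    (hbig : ∀ x ∈ f '' Icc 0 L, ∃ p ∈ f '' Icc 0 L, h₀ ≤ dist p x)
    {ρ : ℝ} (hρ : 1 ≤ ρ) {C₀ : ℕ} (hC₀ : 48 * ρ + 6 ≤ C₀) :
    ∃ C : ℝ, 0 ≤ C ∧ ∀ K, ∑ j ∈ Finset.range K,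
      ((crowded (N j) (ρ * (h₀ / 2 ^ j)) C₀).card : ℝ) * (h₀ / 2 ^ j) ≤ C := by
  obtain ⟨C, hC, hsum⟩ := sum_coverLength_sub_le hf hL hh₀ (κ := 1 / 8) (κ' := 8 * ρ) (by norm_num)
    (by positivity)
  refine ⟨8 * C, by positivity, fun K => ?_⟩
  refine le_trans ?_ (mul_le_mul_of_nonneg_left (hsum K) (by norm_num))
  rw [Finset.mul_sum]
  refine Finset.sum_le_sum fun j _ => ?_
  have hp : 0 < h₀ / 2 ^ j := by positivity
  have hle : h₀ / 2 ^ j ≤ h₀ := div_le_self hh₀.le (one_le_pow₀ one_le_two)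
  have hconn : IsPreconnected (f '' Icc 0 L) := isPreconnected_Icc.image _
      hf.continuous.continuousOn
  obtain ⟨𝒰, h𝒰, -⟩ := exists_isFineCover hf hL (δ := h₀ / 2 ^ j / 8) (by positivity)
  have := card_crowded_mul_le hconn hp (hN.mem j) (hN.sep j)
    (fun x hx => (hbig x hx).imp fun p hp => ⟨hp.1, hle.trans hp.2⟩) ⟨𝒰, h𝒰⟩ hρ hC₀
  rw [show 1 / 8 * (h₀ / 2 ^ j) = h₀ / 2 ^ j / 8 by ring]
  linarith

/-- The number of net points at each scale is controlled by the length of the curve. -/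
lemma card_mul_le_of_isNetFamily {f : ℝ → X} (hf : LipschitzWith 1 f) {L : ℝ} (hL : 0 ≤ L) {h₀ : ℝ}
    (hh₀ : 0 < h₀) {N : ℕ → Finset X} (hN : IsNetFamily (f '' Icc 0 L) h₀ N)
    (hbig : ∀ x ∈ f '' Icc 0 L, ∃ p ∈ f '' Icc 0 L, h₀ ≤ dist p x) (j : ℕ) :
    ((N j).card : ℝ) * (h₀ / 2 ^ j) ≤ 4 * L := by
  set h := h₀ / 2 ^ j with hh
  have hp : 0 < h := by positivity
  have hle : h ≤ h₀ := div_le_self hh₀.le (one_le_pow₀ one_le_two)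
  have hconn : IsPreconnected (f '' Icc 0 L) := isPreconnected_Icc.image _
      hf.continuous.continuousOn
  obtain ⟨𝒰, h𝒰, hs⟩ := exists_isFineCover hf hL (δ := h / 8) (by positivity)
  have hm : ∀ x ∈ N j, h / 4 ≤
      ∑ U ∈ meeting 𝒰 (f '' Icc 0 L ∩ closedBall x (h / 4)), Metric.diam U := by
    intro x hx
    obtain ⟨p, hp', hpx⟩ := hbig x (hN.mem j x hx)
    exact le_sum_diam_meeting_closedBall hconn (hN.mem j x hx) hp' (by linarith) h𝒰
  have h1 := Finset.sum_le_sum hm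
  rw [← Finset.sum_biUnion, Finset.sum_const, nsmul_eq_mul] at h1
  · have h2 := h1.trans ((Finset.sum_le_sum_of_subset_of_nonneg (t := 𝒰) (by
      intro U hU
      obtain ⟨x, -, hU⟩ := Finset.mem_biUnion.1 hU
      exact (Finset.mem_filter.1 hU).1) fun _ _ _ => diam_nonneg).trans hs)
    linarith
  · intro x hx y hy hxy
    refine Finset.disjoint_left.2 fun U hU hU' => ?_
    obtain ⟨hU, u, hu⟩ := Finset.mem_filter.1 hU
    obtain ⟨-, v, hv⟩ := Finset.mem_filter.1 hU'
    have h1 := hN.sep j x hx y hy hxy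
    have h2 : dist u x ≤ h / 4 := hu.2.2
    have h3 : dist v y ≤ h / 4 := hv.2.2
    have := dist_triangle4 x u v y
    rw [dist_comm x u] at this
    have h5 := (dist_le_diam_of_mem (h𝒰.2 U hU).1 hu.1 hv.1).trans (h𝒰.2 U hU).2
    linarith

end Nets

section SegmentDist

variable {H : Type u} [NormedAddCommGroup H] [InnerProductSpace ℝ H]

lemma infDist_segment_attained (p u v : H) :
    ∃ z ∈ segment ℝ u v, infDist p (segment ℝ u v) = dist p z := by
  have hc : IsCompact (segment ℝ u v) := by
    rw [segment_eq_image_lineMap]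
    exact isCompact_Icc.image (AffineMap.lineMap_continuous)
  exact hc.exists_infDist_eq_dist ⟨u, left_mem_segment ℝ u v⟩ p

lemma infDist_segment_le_add {p u v c d : H} {r : ℝ} (hc : infDist c (segment ℝ u v) ≤ r)
    (hd : infDist d (segment ℝ u v) ≤ r) :
    infDist p (segment ℝ u v) ≤ infDist p (segment ℝ c d) + r := by
  obtain ⟨q, ⟨α, β, hα, hβ, hαβ, rfl⟩, hq⟩ := infDist_segment_attained p c d
  obtain ⟨c', hc', hcc⟩ := infDist_segment_attained c u v
  obtain ⟨d', hd', hdd⟩ := infDist_segment_attained d u v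
  have h1 := convex_segment (𝕜 := ℝ) u v hc' hd' hα hβ hαβ
  refine (infDist_le_dist_of_mem h1).trans ((dist_triangle _ (α • c + β • d) _).trans ?_)
  rw [hq]
  gcongr
  rw [dist_eq_norm, show α • c + β • d - (α • c' + β • d') = α • (c - c') + β • (d - d') by module]
  refine (norm_add_le _ _).trans ?_
  rw [norm_smul, norm_smul, Real.norm_of_nonneg hα, Real.norm_of_nonneg hβ, ← dist_eq_norm,
    ← dist_eq_norm]
  rw [hcc] at hc
  rw [hdd] at hd
  have e1 := mul_le_mul_of_nonneg_left hc hα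
  have e2 := mul_le_mul_of_nonneg_left hd hβ
  have e3 : α * r + β * r = r := by rw [← add_mul, hαβ, one_mul]
  linarith

/-- A point on an ellipse of small eccentricity defect is close to the focal segment. -/
lemma infDist_segment_sq_le {p u v : H} {r : ℝ} (hr : dist p u ≤ r) :
    infDist p (segment ℝ u v) ^ 2 ≤ 2 * r * (dist p u + dist p v - dist u v) := by
  have hw : 0 ≤ dist p u + dist p v - dist u v := by
    have := dist_triangle_left u v p; linarith
  have hr0 : 0 ≤ r := dist_nonneg.trans hr
  set a := dist p u with ha
  set b := dist p v with hb
  set d := dist u v with hd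
  have ha0 : 0 ≤ a := dist_nonneg
  have hb0 : 0 ≤ b := dist_nonneg
  have hd0 : 0 ≤ d := dist_nonneg
  rcases ha0.eq_or_lt with h0 | hapos
  · have : infDist p (segment ℝ u v) ≤ 0 := by
      refine (infDist_le_dist_of_mem (left_mem_segment ℝ u v)).trans ?_
      rw [← ha, ← h0]
    have h2 : infDist p (segment ℝ u v) = 0 := le_antisymm this infDist_nonneg
    rw [h2]; have := mul_nonneg (mul_nonneg two_pos.le hr0) hw; simpa using this
  have hs : 0 < a + b := by linarith
  set θ := a / (a + b) with hθ
  have hθ' : 1 - θ = b / (a + b) := by rw [hθ]; field_simp; ring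
  have hz : (1 - θ) • u + θ • v ∈ segment ℝ u v :=
    ⟨1 - θ, θ, by rw [hθ']; positivity, by positivity, by ring, rfl⟩
  have h1 : infDist p (segment ℝ u v) ≤ dist p ((1 - θ) • u + θ • v) := infDist_le_dist_of_mem hz
  have h2 : dist p ((1 - θ) • u + θ • v) ^ 2 = (1 - θ) * a ^ 2 + θ * b ^ 2 - θ * (1 - θ) * d ^ 2 := by
    have e1 : d = ‖(p - v) - (p - u)‖ := by rw [hd, dist_eq_norm]; congr 1; abel
    have e2 : dist p ((1 - θ) • u + θ • v) = ‖(1 - θ) • (p - u) + θ • (p - v)‖ := by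
      rw [dist_eq_norm]; congr 1; module
    rw [e1, e2, ha, hb, dist_eq_norm p u, dist_eq_norm p v, norm_add_sq_real, norm_sub_sq_real
        (p - v), norm_smul, norm_smul,
      inner_smul_left, inner_smul_right, real_inner_comm (p - v) (p - u)]
    simp only [Real.norm_eq_abs, mul_pow, sq_abs, conj_trivial]
    ring
  have h3 : (1 - θ) * a ^ 2 + θ * b ^ 2 - θ * (1 - θ) * d ^ 2
      = a * b * (a + b - d) * (a + b + d) / (a + b) ^ 2 := by
    rw [hθ', hθ]; field_simp; ring
  have h4 : a * b * (a + b - d) * (a + b + d) / (a + b) ^ 2 ≤ 2 * r * (a + b - d) := by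
    rw [div_le_iff₀ (by positivity)]
    have h5 : a * b * (a + b + d) ≤ r * (a + b) * (2 * (a + b)) := by
      have : a * b ≤ r * (a + b) := by nlinarith
      have h6 : a + b + d ≤ 2 * (a + b) := by linarith
      exact mul_le_mul this h6 (by positivity) (by positivity)
    nlinarith
  calc infDist p (segment ℝ u v) ^ 2 ≤ dist p ((1 - θ) • u + θ • v) ^ 2 :=
        pow_le_pow_left₀ infDist_nonneg h1 2
    _ ≤ _ := by rw [h2, h3]; exact h4

end SegmentDist

section ArcLength

variable {X : Type u} [MetricSpace X]

/-- The variation of `f` along a (finite) set of parameters. -/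
def arcLen (f : ℝ → X) (P : Set ℝ) : ℝ := (eVariationOn f P).toReal

lemma arcLen_mono (f : ℝ → X) {P Q : Set ℝ} (hQ : Q.Finite) (h : P ⊆ Q) :
    arcLen f P ≤ arcLen f Q :=
  have : Finite Q := hQ
  ENNReal.toReal_mono (BoundedVariationOn.of_finite f Q) (eVariationOn.mono f h)

lemma arcLen_nonneg (f : ℝ → X) (P : Set ℝ) : 0 ≤ arcLen f P := ENNReal.toReal_nonneg

lemma arcLen_le {f : ℝ → X} (hf : LipschitzWith 1 f) {L : ℝ} (hL : 0 ≤ L) {P : Set ℝ}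
    (hP : P ⊆ Icc 0 L) : arcLen f P ≤ L := by
  have h1 : eVariationOn f P ≤ ENNReal.ofReal L := by
    refine (eVariationOn.mono f hP).trans ?_
    have h2 := (hf.lipschitzOnWith (s := univ)).comp_eVariationOn_le (g := (id : ℝ → ℝ))
      (mapsTo_univ _ (Icc 0 L))
    have h3 := (monotone_id.monotoneOn (Icc (0 : ℝ) L)).eVariationOn_eq
      (left_mem_Icc.2 hL) (right_mem_Icc.2 hL)
    rw [inter_self] at h3
    rw [h3] at h2
    simpa using h2
  exact (ENNReal.toReal_mono ENNReal.ofReal_ne_top h1).trans_eq (ENNReal.toReal_ofReal hL)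

lemma arcLen_diff_Ioo (f : ℝ → X) {P : Set ℝ} (hP : P.Finite) {a b : ℝ} (ha : a ∈ P) (hb : b ∈ P)
    (hab : a ≤ b) :
    arcLen f (P \ Ioo a b) + arcLen f (P ∩ Icc a b) = arcLen f P + dist (f a) (f b) := by
  have h1 : P \ Ioo a b = (P ∩ Iic a) ∪ (P ∩ Ici b) := by
    ext t; simp only [mem_sdiff, mem_Ioo, mem_union, mem_inter_iff, mem_Iic, mem_Ici]; grind
  have h2 : eVariationOn f (P \ Ioo a b) = eVariationOn f (P ∩ Iic a) + edist (f a) (f b) +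
      eVariationOn f (P ∩ Ici b) := by
    rw [h1]
    exact eVariationOn.union' f ⟨⟨ha, self_mem_Iic⟩, fun t ht => ht.2⟩ ⟨⟨hb, self_mem_Ici⟩,
        fun t ht => ht.2⟩ hab
  have h3 : P = (P ∩ Iic a ∪ P ∩ Icc a b) ∪ P ∩ Ici b := by
    ext t; simp only [mem_union, mem_inter_iff, mem_Iic, mem_Ici, mem_Icc]; grind
  have h4 : eVariationOn f P = eVariationOn f (P ∩ Iic a) + eVariationOn f (P ∩ Icc a b) +
      eVariationOn f (P ∩ Ici b) := by
    conv_lhs => rw [h3]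
    rw [eVariationOn.union f (x := b), eVariationOn.union f (x := a)]
    · exact ⟨⟨ha, self_mem_Iic⟩, fun t ht => ht.2⟩
    · exact ⟨⟨ha, le_rfl, hab⟩, fun t ht => ht.2.1⟩
    · exact ⟨Or.inr ⟨hb, hab, le_rfl⟩, fun t ht => ht.elim (fun h => h.2.trans hab) fun h => h.2.2⟩
    · exact ⟨⟨hb, self_mem_Ici⟩, fun t ht => ht.2⟩
  have hfin : ∀ Q ⊆ P, eVariationOn f Q ≠ ⊤ := fun Q hQ =>
    have : Finite Q := hP.subset hQ
    BoundedVariationOn.of_finite f Q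
  unfold arcLen
  rw [h2, h4, ENNReal.toReal_add, ENNReal.toReal_add, ENNReal.toReal_add, ENNReal.toReal_add,
    ← dist_edist]
  · ring
  all_goals first
    | exact hfin _ inter_subset_left
    | exact edist_ne_top _ _
    | exact ENNReal.add_ne_top.2 ⟨hfin _ inter_subset_left, hfin _ inter_subset_left⟩
    | exact ENNReal.add_ne_top.2 ⟨hfin _ inter_subset_left, edist_ne_top _ _⟩

lemma dist_add_dist_le_arcLen (f : ℝ → X) {P : Set ℝ} (hP : P.Finite) {a b c : ℝ} (ha : a ∈ P)
    (hb : b ∈ P) (hc : c ∈ P) (hac : a ≤ c) (hcb : c ≤ b) :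
    dist (f c) (f a) + dist (f c) (f b) ≤ arcLen f (P ∩ Icc a b) := by
  have h1 := eVariationOn.Icc_add_Icc f hac hcb hc
  have h2 : edist (f c) (f a) ≤ eVariationOn f (P ∩ Icc a c) :=
    eVariationOn.edist_le f ⟨hc, hac, le_rfl⟩ ⟨ha, le_rfl, hac⟩
  have h3 : edist (f c) (f b) ≤ eVariationOn f (P ∩ Icc c b) :=
    eVariationOn.edist_le f ⟨hc, le_rfl, hcb⟩ ⟨hb, hcb, le_rfl⟩
  have : Finite ↑(P ∩ Icc a b) := hP.subset inter_subset_left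
  have h4 := ENNReal.toReal_mono (BoundedVariationOn.of_finite f (P ∩ Icc a b))
    ((add_le_add h2 h3).trans_eq h1)
  rwa [ENNReal.toReal_add (edist_ne_top _ _) (edist_ne_top _ _), ← dist_edist, ← dist_edist] at h4

/-- `W` is a family of pairs from `P` spanning pairwise disjoint open intervals. -/
structure IsWindowFamily (P : Set ℝ) (W : Finset (ℝ × ℝ)) : Prop where
  left_mem : ∀ w ∈ W, w.1 ∈ P
  right_mem : ∀ w ∈ W, w.2 ∈ P
  lt : ∀ w ∈ W, w.1 < w.2
  disjoint : ∀ w ∈ W, ∀ w' ∈ W, w ≠ w' → Disjoint (Ioo w.1 w.2) (Ioo w'.1 w'.2)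

lemma IsWindowFamily.notMem {P : Set ℝ} {W : Finset (ℝ × ℝ)} (hW : IsWindowFamily P W)
    {w w' : ℝ × ℝ}
    (hw : w ∈ W) (hw' : w' ∈ W) (hne : w ≠ w') {t : ℝ} (ht : t ∈ Icc w.1 w.2) :
    t ∉ Ioo w'.1 w'.2 := by
  intro ht'
  have h1 := hW.lt w hw
  have hd := hW.disjoint w hw w' hw' hne
  rw [Set.disjoint_left] at hd
  rcases ht.1.eq_or_lt with h | h
  · obtain ⟨s, hs1, hs2⟩ := exists_between (lt_min h1 (h ▸ ht'.2))
    exact hd (a := s) ⟨hs1, (lt_min_iff.1 hs2).1⟩ ⟨(ht'.1.trans_eq h.symm).trans hs1,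
        (lt_min_iff.1 hs2).2⟩
  · obtain ⟨s, hs1, hs2⟩ := exists_between (max_lt h ht'.1)
    exact hd (a := s) ⟨(max_lt_iff.1 hs1).1, hs2.trans_le ht.2⟩ ⟨(max_lt_iff.1 hs1).2,
        hs2.trans ht'.2⟩

lemma IsWindowFamily.sum_excess_le (f : ℝ → X) {P : Set ℝ} (hP : P.Finite) {W : Finset (ℝ × ℝ)}
    (hW : IsWindowFamily P W) :
    arcLen f (P \ ⋃ w ∈ W, Ioo w.1 w.2) +
      ∑ w ∈ W, (arcLen f (P ∩ Icc w.1 w.2) - dist (f w.1) (f w.2)) ≤ arcLen f P := by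
  induction W using Finset.induction_on with
  | empty => simp
  | insert w W hw ih =>
    have hW' : IsWindowFamily P W :=
      ⟨fun v hv => hW.left_mem v (Finset.mem_insert_of_mem hv),
        fun v hv => hW.right_mem v (Finset.mem_insert_of_mem hv),
        fun v hv => hW.lt v (Finset.mem_insert_of_mem hv),
        fun v hv v' hv' => hW.disjoint v (Finset.mem_insert_of_mem hv) v' (Finset.mem_insert_of_mem
            hv')⟩
    have hwW := Finset.mem_insert_self w W
    set Q := P \ ⋃ w ∈ W, Ioo w.1 w.2 with hQ
    have hin : ∀ t ∈ P, t ∈ Icc w.1 w.2 → t ∈ Q := by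
      intro t ht htw
      refine ⟨ht, fun h => ?_⟩
      obtain ⟨v, hv, htv⟩ := mem_iUnion₂.1 h
      exact hW.notMem hwW (Finset.mem_insert_of_mem hv) (fun h => hw (h ▸ hv)) htw htv
    have h1 := arcLen_diff_Ioo f (hP.subset sdiff_subset : Q.Finite)
      (hin w.1 (hW.left_mem w hwW) ⟨le_rfl, (hW.lt w hwW).le⟩)
      (hin w.2 (hW.right_mem w hwW) ⟨(hW.lt w hwW).le, le_rfl⟩) (hW.lt w hwW).le
    have h2 : Q ∩ Icc w.1 w.2 = P ∩ Icc w.1 w.2 :=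
      Subset.antisymm (inter_subset_inter_left _ sdiff_subset) fun t ht => ⟨hin t ht.1 ht.2, ht.2⟩
    have h3 : P \ ⋃ v ∈ insert w W, Ioo v.1 v.2 = Q \ Ioo w.1 w.2 := by
      rw [Finset.set_biUnion_insert, hQ, union_comm, sdiff_sdiff]
    rw [h3, Finset.sum_insert hw]
    rw [h2] at h1
    have := ih hW'
    linarith

end ArcLength

section ArcDeviation

variable {H : Type u} [NormedAddCommGroup H] [InnerProductSpace ℝ H]

/-- The largest distance from the arc `f '' [a, b]` to the chord joining its end points. -/
def arcDev (f : ℝ → H) (a b : ℝ) : ℝ :=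
  sSup ((fun t => infDist (f t) (segment ℝ (f a) (f b))) '' Icc a b)

lemma infDist_segment_le_sub {f : ℝ → H} (hf : LipschitzWith 1 f) {a b t : ℝ} (ht : t ∈ Icc a b) :
    infDist (f t) (segment ℝ (f a) (f b)) ≤ b - a := by
  refine (infDist_le_dist_of_mem (left_mem_segment ℝ _ _)).trans ((hf.dist_le_mul t a).trans ?_)
  rw [NNReal.coe_one, one_mul, Real.dist_eq, abs_of_nonneg (sub_nonneg.2 ht.1)]
  linarith [ht.2]

lemma infDist_le_arcDev {f : ℝ → H} (hf : LipschitzWith 1 f) {a b t : ℝ} (ht : t ∈ Icc a b) :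
    infDist (f t) (segment ℝ (f a) (f b)) ≤ arcDev f a b :=
  le_csSup ⟨b - a, by rintro _ ⟨s, hs, rfl⟩; exact infDist_segment_le_sub hf hs⟩ ⟨t, ht, rfl⟩

lemma arcDev_nonneg (f : ℝ → H) (a b : ℝ) : 0 ≤ arcDev f a b :=
  Real.sSup_nonneg (by rintro _ ⟨s, -, rfl⟩; exact infDist_nonneg)

lemma arcDev_le {f : ℝ → H} {a b r : ℝ} (hr : 0 ≤ r)
    (h : ∀ t ∈ Icc a b, infDist (f t) (segment ℝ (f a) (f b)) ≤ r) : arcDev f a b ≤ r :=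
  Real.sSup_le (by rintro _ ⟨s, hs, rfl⟩; exact h s hs) hr

/-- Pairs of consecutive elements of `P`. -/
def gaps (P : Finset ℝ) : Finset (ℝ × ℝ) :=
  (P ×ˢ P).filter fun w => w.1 < w.2 ∧ ∀ p ∈ P, ¬ (w.1 < p ∧ p < w.2)

lemma mem_gaps {P : Finset ℝ} {w : ℝ × ℝ} :
    w ∈ gaps P ↔ w.1 ∈ P ∧ w.2 ∈ P ∧ w.1 < w.2 ∧ ∀ p ∈ P, ¬ (w.1 < p ∧ p < w.2) := by
  simp [gaps, and_assoc]

lemma eq_of_mem_gaps {P : Finset ℝ} {w w' : ℝ × ℝ} (hw : w ∈ gaps P) (hw' : w' ∈ gaps P)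
    {t : ℝ} (ht : t ∈ Ioc w.1 w.2) (ht' : t ∈ Ioc w'.1 w'.2) : w = w' := by
  rw [mem_gaps] at hw hw'
  obtain ⟨h1, h2, h3, h4⟩ := hw
  obtain ⟨h1', h2', h3', h4'⟩ := hw'
  have := ht.1; have := ht.2; have := ht'.1; have := ht'.2
  have a1 := h4 _ h1'
  have a2 := h4 _ h2'
  have a3 := h4' _ h1
  have a4 := h4' _ h2
  ext <;> grind

lemma isWindowFamily_gaps {P Q : Finset ℝ} (h : Q ⊆ P) : IsWindowFamily (P : Set ℝ) (gaps Q) where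
  left_mem w hw := h (mem_gaps.1 hw).1
  right_mem w hw := h (mem_gaps.1 hw).2.1
  lt w hw := (mem_gaps.1 hw).2.2.1
  disjoint w hw w' hw' hne := by
    rw [Set.disjoint_left]
    exact fun t ht ht' => hne (eq_of_mem_gaps hw hw' ⟨ht.1, ht.2.le⟩ ⟨ht'.1, ht'.2.le⟩)

lemma exists_gap {P : Finset ℝ} {a b t : ℝ} (ha : a ∈ P) (hb : b ∈ P) (hat : a < t) (htb : t ≤ b) :
    ∃ w ∈ gaps P, t ∈ Ioc w.1 w.2 ∧ a ≤ w.1 ∧ w.2 ≤ b := by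
  obtain ⟨c, hc, hcmax⟩ := (P.filter (· < t)).exists_max_image id ⟨a, Finset.mem_filter.2 ⟨ha, hat⟩⟩
  obtain ⟨d, hd, hdmin⟩ := (P.filter (t ≤ ·)).exists_min_image id ⟨b, Finset.mem_filter.2 ⟨hb, htb⟩⟩
  rw [Finset.mem_filter] at hc hd
  have h1 := hcmax a (Finset.mem_filter.2 ⟨ha, hat⟩)
  have h2 := hdmin b (Finset.mem_filter.2 ⟨hb, htb⟩)
  refine ⟨(c, d), mem_gaps.2 ⟨hc.1, hd.1, hc.2.trans_le hd.2, fun p hp h => ?_⟩, ⟨hc.2, hd.2⟩, h1,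
      h2⟩
  rcases lt_or_ge p t with h' | h'
  · exact absurd (hcmax p (Finset.mem_filter.2 ⟨hp, h'⟩)) (not_le.2 h.1)
  · exact absurd (hdmin p (Finset.mem_filter.2 ⟨hp, h'⟩)) (not_le.2 h.2)

lemma card_gaps_le (P : Finset ℝ) : (gaps P).card ≤ P.card := by
  refine Finset.card_le_card_of_injOn Prod.snd (fun w hw => (mem_gaps.1 hw).2.1) ?_
  intro w hw w' hw' h
  have h1 := (mem_gaps.1 hw).2.2.1
  have h2 := (mem_gaps.1 hw').2.2.1
  exact eq_of_mem_gaps hw hw' ⟨h1, le_rfl⟩ ⟨by rw [h]; exact h2, h.le⟩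

/-- Sum of the squared deviations of `f` over the gaps of `P`. -/
def gapSum (f : ℝ → H) (P : Finset ℝ) : ℝ := ∑ w ∈ gaps P, arcDev f w.1 w.2 ^ 2

lemma gapSum_nonneg (f : ℝ → H) (P : Finset ℝ) : 0 ≤ gapSum f P :=
  Finset.sum_nonneg fun _ _ => sq_nonneg _

lemma arcDev_sq_le {f : ℝ → H} (hf : LipschitzWith 1 f) {P : Finset ℝ} {a b ρ : ℝ} (ha : a ∈ P)
    (hb : b ∈ P) (hab : a < b) (hρ : ∀ t ∈ Icc a b, dist (f t) (f a) ≤ ρ) :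
    arcDev f a b ^ 2 ≤ 4 * ρ * (arcLen f (P ∩ Icc a b) - dist (f a) (f b)) +
      2 * ∑ w ∈ gaps P with a ≤ w.1 ∧ w.2 ≤ b, arcDev f w.1 w.2 ^ 2 := by
  set ex := arcLen f (P ∩ Icc a b) - dist (f a) (f b) with hex
  set S := ∑ w ∈ gaps P with a ≤ w.1 ∧ w.2 ≤ b, arcDev f w.1 w.2 ^ 2 with hS
  have hS0 : 0 ≤ S := Finset.sum_nonneg fun _ _ => sq_nonneg _
  have hρ0 : 0 ≤ ρ := dist_nonneg.trans (hρ a ⟨le_rfl, hab.le⟩)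
  have hex0 : 0 ≤ ex := by
    have := dist_add_dist_le_arcLen f P.finite_toSet ha hb ha le_rfl hab.le
    rw [dist_self, zero_add] at this; linarith
  have hpt : ∀ c ∈ P, c ∈ Icc a b → infDist (f c) (segment ℝ (f a) (f b)) ≤ √(2 * ρ * ex) := by
    intro c hc hcab
    refine Real.le_sqrt_of_sq_le ((infDist_segment_sq_le (hρ c hcab)).trans ?_)
    have := dist_add_dist_le_arcLen f P.finite_toSet ha hb hc hcab.1 hcab.2
    gcongr
    linarith
  have h1 : arcDev f a b ≤ √S + √(2 * ρ * ex) := by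
    refine arcDev_le (by positivity) fun t ht => ?_
    rcases ht.1.eq_or_lt with h | h
    · rw [← h]
      have := hpt a ha ⟨le_rfl, hab.le⟩
      linarith [Real.sqrt_nonneg S]
    · obtain ⟨w, hw, htw, haw, hwb⟩ := exists_gap ha hb h ht.2
      have hw' := mem_gaps.1 hw
      refine (infDist_segment_le_add (hpt w.1 hw'.1 ⟨haw, hw'.2.2.1.le.trans hwb⟩)
        (hpt w.2 hw'.2.1 ⟨haw.trans hw'.2.2.1.le, hwb⟩)).trans ?_
      gcongr
      refine (infDist_le_arcDev hf (Ioc_subset_Icc_self htw)).trans (Real.le_sqrt_of_sq_le ?_)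
      exact Finset.single_le_sum (f := fun w : ℝ × ℝ => arcDev f w.1 w.2 ^ 2)
        (fun _ _ => sq_nonneg _) (Finset.mem_filter.2 ⟨hw, haw, hwb⟩)
  have h2 := Real.sq_sqrt hS0
  have h3 := Real.sq_sqrt (show 0 ≤ 2 * ρ * ex by positivity)
  have h4 := pow_le_pow_left₀ (arcDev_nonneg f a b) h1 2
  nlinarith [sq_nonneg (√S - √(2 * ρ * ex))]

lemma IsWindowFamily.sum_arcDev_sq_le {f : ℝ → H} (hf : LipschitzWith 1 f) {P : Finset ℝ}
    {W : Finset (ℝ × ℝ)} (hW : IsWindowFamily (P : Set ℝ) W) {ρ : ℝ} (hρ0 : 0 ≤ ρ)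
    (hρ : ∀ w ∈ W, ∀ t ∈ Icc w.1 w.2, dist (f t) (f w.1) ≤ ρ) :
    ∑ w ∈ W, arcDev f w.1 w.2 ^ 2 ≤
      4 * ρ * (arcLen f P - arcLen f (P \ ⋃ w ∈ W, Ioo w.1 w.2)) + 2 * gapSum f P := by
  have h1 := hW.sum_excess_le f P.finite_toSet
  have h2 : ∑ w ∈ W, ∑ v ∈ gaps P with w.1 ≤ v.1 ∧ v.2 ≤ w.2, arcDev f v.1 v.2 ^ 2 ≤ gapSum f P := by
    rw [← Finset.sum_biUnion]
    · refine Finset.sum_le_sum_of_subset_of_nonneg ?_ fun _ _ _ => sq_nonneg _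
      exact Finset.biUnion_subset.2 fun w _ => Finset.filter_subset _ _
    · intro w hw w' hw' hne
      refine Finset.disjoint_left.2 fun v hv hv' => ?_
      rw [Finset.mem_filter] at hv hv'
      obtain ⟨s, hs1, hs2⟩ := exists_between (mem_gaps.1 hv.1).2.2.1
      exact Set.disjoint_left.1 (hW.disjoint w hw w' hw' hne)
        (show s ∈ Ioo w.1 w.2 from ⟨hv.2.1.trans_lt hs1, hs2.trans_le hv.2.2⟩)
        ⟨hv'.2.1.trans_lt hs1, hs2.trans_le hv'.2.2⟩
  calc ∑ w ∈ W, arcDev f w.1 w.2 ^ 2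
      ≤ ∑ w ∈ W, (4 * ρ * (arcLen f (P ∩ Icc w.1 w.2) - dist (f w.1) (f w.2)) +
        2 * ∑ v ∈ gaps P with w.1 ≤ v.1 ∧ v.2 ≤ w.2, arcDev f v.1 v.2 ^ 2) :=
        Finset.sum_le_sum fun w hw =>
          arcDev_sq_le hf (hW.left_mem w hw) (hW.right_mem w hw) (hW.lt w hw) (hρ w hw)
    _ = 4 * ρ * ∑ w ∈ W, (arcLen f (P ∩ Icc w.1 w.2) - dist (f w.1) (f w.2)) +
        2 * ∑ w ∈ W, ∑ v ∈ gaps P with w.1 ≤ v.1 ∧ v.2 ≤ w.2, arcDev f v.1 v.2 ^ 2 := by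
        rw [Finset.sum_add_distrib, Finset.mul_sum, Finset.mul_sum]
    _ ≤ _ := by
        gcongr
        linarith

/-- Between consecutive elements of `P` the path `f` moves by at most `δ`. -/
def IsFineMesh (f : ℝ → H) (P : Finset ℝ) (δ : ℝ) : Prop :=
  ∀ w ∈ gaps P, ∀ t ∈ Icc w.1 w.2, dist (f t) (f w.1) ≤ δ

lemma exists_coarsening {f : ℝ → H} (hf : LipschitzWith 1 f) {P : Finset ℝ} {L δ : ℝ} (hδ : 0 < δ)
    (h0 : 0 ∈ P) (hL : L ∈ P) (hPL : (P : Set ℝ) ⊆ Icc 0 L) (hP : IsFineMesh f P δ) :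
    ∃ P' ⊆ P, 0 ∈ P' ∧ L ∈ P' ∧ IsFineMesh f P' (8 * δ) ∧
      gapSum f P' ≤ 32 * δ * (arcLen f P - arcLen f P') + 2 * gapSum f P ∧
      ∀ W : Finset (ℝ × ℝ), IsWindowFamily (P : Set ℝ) W →
        (∀ w ∈ W, ∀ t ∈ Icc w.1 w.2, dist (f t) (f w.1) ≤ 8 * δ) →
        ∑ w ∈ W, arcDev f w.1 w.2 ^ 2 ≤ 32 * δ * (arcLen f P - arcLen f P') + 2 * gapSum f P := by
  set 𝒬 := P.powerset.filter fun Q => 0 ∈ Q ∧ L ∈ Q ∧ IsFineMesh f Q (8 * δ) with h𝒬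
  have hP𝒬 : P ∈ 𝒬 := Finset.mem_filter.2 ⟨Finset.mem_powerset_self _, h0, hL,
    fun w hw t ht => (hP w hw t ht).trans (by linarith)⟩
  obtain ⟨P', hP', hmin⟩ := 𝒬.exists_min_image (fun Q => arcLen f (Q : Set ℝ)) ⟨P, hP𝒬⟩
  obtain ⟨hP'P, h0', hL', hfine⟩ := Finset.mem_filter.1 hP'
  rw [Finset.mem_powerset] at hP'P
  refine ⟨P', hP'P, h0', hL', hfine, ?_, fun W hW hρ => ?_⟩
  · have h1 := (isWindowFamily_gaps hP'P).sum_arcDev_sq_le hf (by positivity) hfine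
    have h2 : arcLen f P' ≤ arcLen f (P \ ⋃ w ∈ gaps P', Ioo w.1 w.2) := by
      refine arcLen_mono f (P.finite_toSet.subset sdiff_subset) fun p hp => ⟨hP'P hp, fun h => ?_⟩
      obtain ⟨w, hw, hpw⟩ := mem_iUnion₂.1 h
      exact (mem_gaps.1 hw).2.2.2 p hp hpw
    calc gapSum f P' ≤ _ := h1
      _ ≤ 4 * (8 * δ) * (arcLen f P - arcLen f P') + 2 * gapSum f P := by gcongr
      _ = _ := by ring
  · have h1 := hW.sum_arcDev_sq_le hf (by positivity) hρ
    set Q := P.filter fun p => p ∉ ⋃ w ∈ W, Ioo w.1 w.2 with hQ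
    have hQc : (Q : Set ℝ) = (P : Set ℝ) \ ⋃ w ∈ W, Ioo w.1 w.2 := by ext p; simp [hQ]
    have hend : ∀ s ∈ P, (s ≤ 0 ∨ L ≤ s) → s ∈ Q := by
      intro s hs hs'
      refine Finset.mem_filter.2 ⟨hs, fun h => ?_⟩
      obtain ⟨w, hw, hsw⟩ := mem_iUnion₂.1 h
      have a1 := (hPL (hW.left_mem w hw)).1
      have a2 := (hPL (hW.right_mem w hw)).2
      rcases hs' with h' | h'
      · linarith [hsw.1]
      · linarith [hsw.2]
    have hwQ : ∀ w ∈ W, ∀ s ∈ P, s ∈ Icc w.1 w.2 → s ∉ Ioo w.1 w.2 → s ∈ Q := by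
      intro w hw s hs hsw hsw'
      refine Finset.mem_filter.2 ⟨hs, fun h => ?_⟩
      obtain ⟨v, hv, hsv⟩ := mem_iUnion₂.1 h
      by_cases hvw : w = v
      · exact hsw' (hvw ▸ hsv)
      · exact hW.notMem hw hv hvw hsw hsv
    have hQ𝒬 : Q ∈ 𝒬 := by
      refine Finset.mem_filter.2 ⟨Finset.mem_powerset.2 (Finset.filter_subset _ _),
        hend 0 h0 (Or.inl le_rfl), hend L hL (Or.inr le_rfl), fun g hg t ht => ?_⟩
      obtain ⟨hg1, hg2, hg3, hg4⟩ := mem_gaps.1 hg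
      by_cases hex : ∃ p ∈ P, g.1 < p ∧ p < g.2
      · obtain ⟨p, hp, hp1, hp2⟩ := hex
        have hpQ : p ∉ Q := fun h => hg4 p h ⟨hp1, hp2⟩
        have hpU : p ∈ ⋃ w ∈ W, Ioo w.1 w.2 := by
          by_contra h; exact hpQ (Finset.mem_filter.2 ⟨hp, h⟩)
        obtain ⟨w, hw, hpw⟩ := mem_iUnion₂.1 hpU
        have hlt := hW.lt w hw
        have e1 := hg4 _ (hwQ w hw w.1 (hW.left_mem w hw) ⟨le_rfl, hlt.le⟩ (by simp))
        have e2 := hg4 _ (hwQ w hw w.2 (hW.right_mem w hw) ⟨hlt.le, le_rfl⟩ (by simp))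
        have hout : ∀ s ∈ Q, s ∉ Ioo w.1 w.2 := fun s hs h =>
          (Finset.mem_filter.1 hs).2 (mem_iUnion₂.2 ⟨w, hw, h⟩)
        have e3 := hout _ hg1
        have e4 := hout _ hg2
        simp only [mem_Ioo] at e3 e4 hpw
        have e5 : g.1 = w.1 := by grind
        have e6 : g.2 = w.2 := by grind
        rw [e5]
        exact hρ w hw t (by rw [← e5, ← e6]; exact ht)
      · push Not at hex
        refine (hP g (mem_gaps.2 ⟨(Finset.mem_filter.1 hg1).1, (Finset.mem_filter.1 hg2).1, hg3,
          fun p hp h => absurd (hex p hp h.1) (not_le.2 h.2)⟩) t ht).trans (by linarith)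
    have h2 := hmin Q hQ𝒬
    simp only [hQc] at h2
    calc _ ≤ _ := h1
      _ ≤ 4 * (8 * δ) * (arcLen f P - arcLen f P') + 2 * gapSum f P := by gcongr
      _ = _ := by ring

lemma exists_initial_mesh {f : ℝ → H} (hf : LipschitzWith 1 f) {L δ : ℝ} (hL : 0 ≤ L) (hδ : 0 < δ) :
    ∃ P : Finset ℝ, 0 ∈ P ∧ L ∈ P ∧ (P : Set ℝ) ⊆ Icc 0 L ∧ IsFineMesh f P δ ∧
      gapSum f P ≤ δ := by
  obtain ⟨m, hm⟩ := exists_nat_gt (max (L / δ) (2 * L ^ 2 / δ))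
  obtain ⟨hm1, hm2⟩ := max_lt_iff.1 hm
  have hm0 : (0 : ℝ) < m := lt_of_le_of_lt (by positivity) hm1
  set P : Finset ℝ := (Finset.range (m + 1)).image fun i : ℕ => i * (L / m) with hP
  have hmem : ∀ i : ℕ, i ≤ m → (i * (L / m) : ℝ) ∈ P := fun i hi =>
    Finset.mem_image.2 ⟨i, Finset.mem_range.2 (by omega), rfl⟩
  have hgap : ∀ w ∈ gaps P, w.2 - w.1 ≤ L / m := by
    intro w hw
    obtain ⟨h1, h2, h3, h4⟩ := mem_gaps.1 hw
    obtain ⟨i, hi, hi'⟩ := Finset.mem_image.1 h1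
    obtain ⟨k, hk, hk'⟩ := Finset.mem_image.1 h2
    rw [Finset.mem_range] at hi hk
    have hLm : 0 < L / m := by
      refine lt_of_le_of_ne (by positivity) fun h => ?_
      rw [← h] at hi' hk'
      rw [← hi', ← hk'] at h3; simp at h3
    have hik : i < k := by
      rw [← hi', ← hk'] at h3
      exact_mod_cast (mul_lt_mul_iff_left₀ hLm).1 h3
    by_contra! hcon
    refine h4 _ (hmem (i + 1) (by omega)) ⟨?_, ?_⟩
    · rw [← hi']; push_cast; linarith
    · rw [← hi'] at hcon; push_cast; linarith
  refine ⟨P, by simpa using hmem 0 (Nat.zero_le _), ?_, ?_, ?_, ?_⟩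
  · have := hmem m le_rfl
    rwa [mul_div_cancel₀ _ hm0.ne'] at this
  · intro p hp
    obtain ⟨i, hi, rfl⟩ := Finset.mem_image.1 hp
    rw [Finset.mem_range] at hi
    refine ⟨by positivity, ?_⟩
    have : (i : ℝ) ≤ m := by exact_mod_cast Nat.lt_succ_iff.1 hi
    calc (i : ℝ) * (L / m) ≤ m * (L / m) := by gcongr
      _ = L := mul_div_cancel₀ _ hm0.ne'
  · intro w hw t ht
    refine (hf.dist_le_mul t w.1).trans ?_
    rw [NNReal.coe_one, one_mul, Real.dist_eq, abs_of_nonneg (sub_nonneg.2 ht.1)]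
    have h1 := hgap w hw
    have h2 : L / m < δ := by rw [div_lt_iff₀ hm0]; rw [div_lt_iff₀ hδ] at hm1; linarith
    linarith [ht.2]
  · calc gapSum f P ≤ ∑ w ∈ gaps P, (L / m) ^ 2 := by
          refine Finset.sum_le_sum fun w hw => pow_le_pow_left₀ (arcDev_nonneg f _ _) ?_ 2
          exact arcDev_le (by positivity) fun t ht => (infDist_segment_le_sub hf ht).trans
              (hgap w hw)
      _ = (gaps P).card * (L / m) ^ 2 := by rw [Finset.sum_const, nsmul_eq_mul]
      _ ≤ (2 * m) * (L / m) ^ 2 := by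
          gcongr
          have h1 : (gaps P).card ≤ m + 1 :=
            (card_gaps_le P).trans (Finset.card_image_le.trans (Finset.card_range _).le)
          have h2 : 1 ≤ m := by exact_mod_cast hm0
          calc ((gaps P).card : ℝ) ≤ ((2 * m : ℕ) : ℝ) := by exact_mod_cast (by omega)
            _ = _ := by push_cast; ring
      _ = 2 * L ^ 2 / m := by field_simp
      _ ≤ δ := by rw [div_le_iff₀ hm0]; rw [div_lt_iff₀ hδ] at hm2; linarith

lemma exists_mesh_chain {f : ℝ → H} (hf : LipschitzWith 1 f) {L δ : ℝ} (hL : 0 ≤ L) (hδ : 0 < δ) :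
    ∃ P : ℕ → Finset ℝ, (∀ k, 0 ∈ P k ∧ L ∈ P k ∧ (P k : Set ℝ) ⊆ Icc 0 L ∧
        IsFineMesh f (P k) (8 ^ k * δ)) ∧
      ∀ W : ℕ → Finset (ℝ × ℝ), (∀ k, IsWindowFamily (P k : Set ℝ) (W k)) →
        (∀ k, ∀ w ∈ W k, ∀ t ∈ Icc w.1 w.2, dist (f t) (f w.1) ≤ 8 * (8 ^ k * δ)) →
        ∀ K, ∑ k ∈ Finset.range K, (∑ w ∈ W k, arcDev f w.1 w.2 ^ 2) / (8 ^ k * δ) ≤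
          48 * (L + 1) := by
  obtain ⟨P₀, h00, h0L, h0P, h0f, h0g⟩ := exists_initial_mesh hf hL hδ
  have hstep : ∀ (k : ℕ) (P : {P : Finset ℝ // 0 ∈ P ∧ L ∈ P ∧ (P : Set ℝ) ⊆ Icc 0 L ∧
      IsFineMesh f P (8 ^ k * δ)}), ∃ P' : {P : Finset ℝ // 0 ∈ P ∧ L ∈ P ∧ (P : Set ℝ) ⊆ Icc 0 L ∧
      IsFineMesh f P (8 ^ (k + 1) * δ)}, P'.1 ⊆ P.1 ∧
      gapSum f P'.1 ≤ 32 * (8 ^ k * δ) * (arcLen f P.1 - arcLen f P'.1) + 2 * gapSum f P.1 ∧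
      ∀ W : Finset (ℝ × ℝ), IsWindowFamily (P.1 : Set ℝ) W →
        (∀ w ∈ W, ∀ t ∈ Icc w.1 w.2, dist (f t) (f w.1) ≤ 8 * (8 ^ k * δ)) →
        ∑ w ∈ W, arcDev f w.1 w.2 ^ 2 ≤
          32 * (8 ^ k * δ) * (arcLen f P.1 - arcLen f P'.1) + 2 * gapSum f P.1 := by
    rintro k ⟨P, h0, hL, hPL, hP⟩
    obtain ⟨P', hP', a1, a2, a3, a4, a5⟩ := exists_coarsening hf (by positivity) h0 hL hPL hP
    refine ⟨⟨P', a1, a2, fun p hp => hPL (hP' hp), ?_⟩, hP', a4, a5⟩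
    convert a3 using 1; ring
  choose nxt hnxt0 hnxt1 hnxt2 using hstep
  let Q : ∀ k : ℕ, {P : Finset ℝ // 0 ∈ P ∧ L ∈ P ∧ (P : Set ℝ) ⊆ Icc 0 L ∧
      IsFineMesh f P (8 ^ k * δ)} := fun k =>
    Nat.rec ⟨P₀, h00, h0L, h0P, by simpa using h0f⟩ nxt k
  refine ⟨fun k => (Q k).1, fun k => (Q k).2, fun W hW hρ K => ?_⟩
  have e0 : ∀ k, (Q (k + 1)).1 ⊆ (Q k).1 := fun k => hnxt0 k (Q k)
  have e1 : ∀ k, gapSum f (Q (k + 1)).1 ≤ 32 * (8 ^ k * δ) *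
    (arcLen f (Q k).1 - arcLen f (Q (k + 1)).1) + 2 * gapSum f (Q k).1 := fun k => hnxt1 k (Q k)
  have e2 : ∀ k, ∑ w ∈ W k, arcDev f w.1 w.2 ^ 2 ≤ 32 * (8 ^ k * δ) *
    (arcLen f (Q k).1 - arcLen f (Q (k + 1)).1) + 2 * gapSum f (Q k).1 :=
    fun k => hnxt2 k (Q k) (W k) (hW k) (hρ k)
  have hg0 : gapSum f (Q 0).1 ≤ δ := h0g
  have ha0 : arcLen f (Q 0).1 ≤ L := arcLen_le hf hL (Q 0).2.2.2.1
  clear_value Q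
  have key : ∀ K, ∑ k ∈ Finset.range K, (∑ w ∈ W k, arcDev f w.1 w.2 ^ 2) / (8 ^ k * δ) +
      (8 / 3) * (gapSum f (Q K).1 / (8 ^ K * δ)) + (48 : ℝ) * arcLen f (Q K).1 ≤ 48 * L + 8 / 3 := by
    intro K
    induction K with
    | zero =>
      have : gapSum f (Q 0).1 / (8 ^ 0 * δ) ≤ 1 := by
        rw [div_le_one (by positivity)]; simpa using hg0
      simp only [Finset.range_zero, Finset.sum_empty]
      linarith
    | succ K ih =>
      rw [Finset.sum_range_succ]
      have hp : 0 < 8 ^ K * δ := by positivity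
      have b1 : (∑ w ∈ W K, arcDev f w.1 w.2 ^ 2) / (8 ^ K * δ) ≤
          32 * (arcLen f (Q K).1 - arcLen f (Q (K + 1)).1) + 2 * (gapSum f (Q K).1 / (8 ^ K * δ)) := by
        rw [div_le_iff₀ hp]
        refine (e2 K).trans_eq ?_
        field_simp
      have b2 : gapSum f (Q (K + 1)).1 / (8 ^ (K + 1) * δ) ≤
          4 * (arcLen f (Q K).1 - arcLen f (Q (K + 1)).1) +
            (1 / 4) * (gapSum f (Q K).1 / (8 ^ K * δ)) := by
        rw [div_le_iff₀ (by positivity)]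
        refine (e1 K).trans_eq ?_
        field_simp; ring
      have b3 : arcLen f (Q (K + 1)).1 ≤ arcLen f (Q K).1 := by
        exact arcLen_mono f (Q K).1.finite_toSet (e0 K)
      have b4 : 0 ≤ gapSum f (Q K).1 / (8 ^ K * δ) := div_nonneg (gapSum_nonneg _ _) hp.le
      linarith
  have := key K
  have b4 : 0 ≤ gapSum f (Q K).1 / (8 ^ K * δ) := div_nonneg (gapSum_nonneg _ _) (by positivity)
  have b5 := arcLen_nonneg f (Q K).1
  linarith

end ArcDeviation

lemma exists_separated_sum_le {X : Type u} [MetricSpace X] (F : Finset X) {r : ℝ} (hr : 0 ≤ r)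
    {C₀ : ℕ}
    (hC : ∀ x ∈ F, (F.filter fun y => dist y x ≤ r).card ≤ C₀) {val : X → ℝ}
    (hval : ∀ x, 0 ≤ val x) :
    ∃ Y ⊆ F, (∀ x ∈ Y, ∀ y ∈ Y, x ≠ y → r < dist x y) ∧ ∑ x ∈ F, val x ≤ C₀ * ∑ x ∈ Y, val x := by
  induction F using Finset.strongInduction with
  | H F ih =>
    rcases F.eq_empty_or_nonempty with rfl | hne
    · exact ⟨∅, Finset.Subset.refl _, by simp, by simp⟩
    obtain ⟨x, hx, hmax⟩ := F.exists_max_image val hne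
    have hsub : (F.filter fun y => ¬ dist y x ≤ r) ⊂ F := by
      refine Finset.filter_ssubset.2 ⟨x, hx, ?_⟩
      simpa using hr
    obtain ⟨Y, hYF, hsep, hY⟩ := ih _ hsub fun z hz =>
      (Finset.card_le_card (Finset.filter_subset_filter _ hsub.1)).trans (hC z (hsub.1 hz))
    have hfar : ∀ y ∈ Y, r < dist y x := fun y hy => not_le.1 (Finset.mem_filter.1 (hYF hy)).2
    refine ⟨insert x Y, Finset.insert_subset hx (hYF.trans hsub.1), ?_, ?_⟩
    · intro a ha b hb hab
      rcases Finset.mem_insert.1 ha with rfl | ha' <;> rcases Finset.mem_insert.1 hb with rfl | hb'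
      · exact absurd rfl hab
      · rw [dist_comm]; exact hfar b hb'
      · exact hfar a ha'
      · exact hsep a ha' b hb' hab
    · have hxY : x ∉ Y := fun h => absurd (hfar x h) (by simpa using hr)
      rw [Finset.sum_insert hxY, ← Finset.sum_filter_add_sum_filter_not F (fun y => dist y x ≤ r),
        mul_add]
      refine add_le_add ?_ hY
      calc ∑ y ∈ F with dist y x ≤ r, val y ≤ (F.filter fun y => dist y x ≤ r).card • val x :=
            Finset.sum_le_card_nsmul _ _ _ fun y hy => hmax y (Finset.mem_filter.1 hy).1
        _ ≤ C₀ * val x := by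
            rw [nsmul_eq_mul]
            exact mul_le_mul_of_nonneg_right (by exact_mod_cast hC x hx) (hval x)

section Axis

variable {H : Type u} [NormedAddCommGroup H] [InnerProductSpace ℝ H]

lemma exists_window {H : Type u} [NormedAddCommGroup H] {f : ℝ → H}
    (hf : LipschitzWith 1 f) {P : Finset ℝ} {L δ R s : ℝ} (h0 : 0 ∈ P)
    (hL : L ∈ P) (hδ : 0 < δ) (hP : IsFineMesh f P δ) (hs : s ∈ Icc 0 L) (hR : 2 * δ ≤ R)
    (hs0 : R ≤ dist (f 0) (f s)) (hsL : R ≤ dist (f L) (f s)) :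
    ∃ a ∈ P, ∃ b ∈ P, a < s ∧ s < b ∧ R ≤ dist (f a) (f s) ∧ R ≤ dist (f b) (f s) ∧
      ∀ t ∈ Icc a b, dist (f t) (f s) ≤ R + 2 * δ := by
  obtain ⟨a, ha, hamax⟩ := (P.filter fun p => p ≤ s ∧ R ≤ dist (f p) (f s)).exists_max_image id
    ⟨0, Finset.mem_filter.2 ⟨h0, hs.1, hs0⟩⟩
  obtain ⟨b, hb, hbmin⟩ := (P.filter fun p => s ≤ p ∧ R ≤ dist (f p) (f s)).exists_min_image id
    ⟨L, Finset.mem_filter.2 ⟨hL, hs.2, hsL⟩⟩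
  obtain ⟨haP, has, haR⟩ := Finset.mem_filter.1 ha
  obtain ⟨hbP, hbs, hbR⟩ := Finset.mem_filter.1 hb
  have hne : ∀ p, R ≤ dist (f p) (f s) → p ≠ s := by
    rintro p hp rfl
    rw [dist_self] at hp; linarith
  have has' := lt_of_le_of_ne has (hne a haR)
  have hbs' := lt_of_le_of_ne hbs (hne b hbR).symm
  have hin : ∀ p ∈ P, a < p → p < b → dist (f p) (f s) < R := by
    intro p hp hap hpb
    by_contra! hcon
    rcases le_total p s with h | h
    · exact absurd (hamax p (Finset.mem_filter.2 ⟨hp, h, hcon⟩)) (not_le.2 hap)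
    · exact absurd (hbmin p (Finset.mem_filter.2 ⟨hp, h, hcon⟩)) (not_le.2 hpb)
  refine ⟨a, haP, b, hbP, has', hbs', haR, hbR, ?_⟩
  have hclosed : IsClosed {t | dist (f t) (f s) ≤ R + 2 * δ} :=
    isClosed_le (hf.continuous.dist continuous_const) continuous_const
  have hIoc : Ioc a b ⊆ {t | dist (f t) (f s) ≤ R + 2 * δ} := by
    intro t ht
    obtain ⟨w, hw, htw, haw, hwb⟩ := exists_gap haP hbP ht.1 ht.2
    have hw' := mem_gaps.1 hw
    have h1 := hP w hw t (Ioc_subset_Icc_self htw)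
    have h2 := hP w hw w.2 ⟨hw'.2.2.1.le, le_rfl⟩
    have h3 := dist_triangle (f t) (f w.1) (f s)
    rw [Set.mem_ofPred_eq]
    by_cases hs1 : s < w.1
    · have := hin w.1 hw'.1 (has'.trans hs1) (hw'.2.2.1.trans_le hwb)
      linarith
    by_cases hs2 : w.2 < s
    · have := hin w.2 hw'.2.1 (haw.trans_lt hw'.2.2.1) (hs2.trans hbs')
      have := dist_triangle (f w.1) (f w.2) (f s)
      rw [dist_comm (f w.1) (f w.2)] at this
      linarith
    · have := hP w hw s ⟨not_lt.1 hs1, not_lt.1 hs2⟩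
      rw [dist_comm] at this
      linarith
  have := closure_minimal hIoc hclosed
  rwa [closure_Ioc (has'.trans hbs').ne] at this

/-- The set `Γ` contains points projecting to every point of the segment of half-length `r`
around `x` in direction `e`, each at distance at most `D` from its projection. -/
structure IsAxis (Γ : Set H) (x e : H) (r D : ℝ) : Prop where
  norm_eq : ‖e‖ = 1
  exists_mem : ∀ τ : ℝ, |τ| ≤ r → ∃ p ∈ Γ, ‖p - x - τ • e‖ ≤ D ∧ inner ℝ (p - x) e = τ

/-- The infimum of the widths of the axes of `Γ` through `x` of half-length `r`,
truncated at `h`. -/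
def arcDefect (Γ : Set H) (x : H) (r h : ℝ) : ℝ :=
  sInf {D : ℝ | 0 ≤ D ∧ (h ≤ D ∨ ∃ e, IsAxis Γ x e r D)}

lemma arcDefect_nonneg (Γ : Set H) (x : H) (r h : ℝ) : 0 ≤ arcDefect Γ x r h :=
  Real.sInf_nonneg fun _ hD => hD.1

lemma arcDefect_le {Γ : Set H} {x : H} {r h D : ℝ} (hD : 0 ≤ D)
    (h' : h ≤ D ∨ ∃ e, IsAxis Γ x e r D) : arcDefect Γ x r h ≤ D :=
  csInf_le ⟨0, fun _ hD => hD.1⟩ ⟨hD, h'⟩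

lemma exists_isAxis_of_arcDefect_lt {Γ : Set H} {x : H} {r h d : ℝ} (hh : 0 ≤ h)
    (hd : arcDefect Γ x r h < d) (hdh : d ≤ h) : ∃ D e, 0 ≤ D ∧ D < d ∧ IsAxis Γ x e r D := by
  obtain ⟨D, ⟨hD0, hD⟩, hDd⟩ := exists_lt_of_csInf_lt
    (s := {D : ℝ | 0 ≤ D ∧ (h ≤ D ∨ ∃ e, IsAxis Γ x e r D)}) ⟨h, hh, Or.inl le_rfl⟩ hd
  rcases hD with hD | ⟨e, he⟩
  · linarith
  · exact ⟨D, e, hD0, hDd, he⟩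

lemma norm_sub_inner_smul_le {e : H} (he : ‖e‖ = 1) (u : H) : ‖u - (inner ℝ u e : ℝ) • e‖ ≤ ‖u‖ := by
  have h1 : ‖u - (inner ℝ u e : ℝ) • e‖ ^ 2 = ‖u‖ ^ 2 - (inner ℝ u e : ℝ) ^ 2 := by
    rw [norm_sub_sq_real, norm_smul, he, inner_smul_right]
    simp only [Real.norm_eq_abs, mul_one, sq_abs]; ring
  refine le_of_sq_le_sq ?_ (norm_nonneg _)
  nlinarith [sq_nonneg (inner ℝ u e : ℝ)]

lemma exists_isAxis_of_window {f : ℝ → H} (hf : LipschitzWith 1 f) {L a b s R r : ℝ}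
    (hab : Icc a b ⊆ Icc 0 L) (hs : s ∈ Icc a b) (hr : 0 ≤ r) (hD : 2 * arcDev f a b + r < R)
    (ha : R ≤ dist (f a) (f s)) (hb : R ≤ dist (f b) (f s)) :
    ∃ e, IsAxis (f '' Icc 0 L) (f s) e r (2 * arcDev f a b) := by
  set D := arcDev f a b with hDdef
  have hD0 : 0 ≤ D := arcDev_nonneg f a b
  have hseg : ∀ t ∈ Icc a b, ∃ β : ℝ, 0 ≤ β ∧ β ≤ 1 ∧ ‖f t - f a - β • (f b - f a)‖ ≤ D := by
    intro t ht
    obtain ⟨z, ⟨α, β, hα, hβ, hαβ, rfl⟩, hz⟩ := infDist_segment_attained (f t) (f a) (f b)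
    refine ⟨β, hβ, by linarith, ?_⟩
    have h1 := infDist_le_arcDev hf ht
    rw [hz, dist_eq_norm] at h1
    rwa [show f t - f a - β • (f b - f a) = f t - (α • f a + β • f b) by
      rw [show α = 1 - β by linarith]; module]
  set v := f b - f a with hv
  obtain ⟨β, hβ0, hβ1, hβ⟩ := hseg s hs
  have hna : R - D ≤ β * ‖v‖ := by
    have h1 : dist (f a) (f s) ≤ ‖f s - f a - β • v‖ + ‖β • v‖ := by
      rw [dist_comm, dist_eq_norm]
      exact (congrArg norm (by abel)).trans_le (norm_add_le (f s - f a - β • v) (β • v))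
    rw [norm_smul, Real.norm_of_nonneg hβ0] at h1
    linarith
  have hnb : R - D ≤ (1 - β) * ‖v‖ := by
    have h1 : dist (f b) (f s) ≤ ‖f s - f a - β • v‖ + ‖(1 - β) • v‖ := by
      rw [dist_eq_norm]
      rw [← norm_neg (f s - f a - β • v)]
      refine (congrArg norm ?_).trans_le (norm_add_le (-(f s - f a - β • v)) ((1 - β) • v))
      rw [hv]; module
    rw [norm_smul, Real.norm_of_nonneg (by linarith : 0 ≤ 1 - β)] at h1
    linarith
  have hv0 : 0 < ‖v‖ := by
    by_contra! hcon
    have : ‖v‖ = 0 := le_antisymm hcon (norm_nonneg _)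
    rw [this, mul_zero] at hna; linarith
  set e := ‖v‖⁻¹ • v with he
  have hen : ‖e‖ = 1 := by rw [he, norm_smul, norm_inv, norm_norm, inv_mul_cancel₀ hv0.ne']
  have hve : v = ‖v‖ • e := by rw [he, smul_smul, mul_inv_cancel₀ hv0.ne', one_smul]
  have hvi : ∀ c : ℝ, inner ℝ (c • v) e = c * ‖v‖ := by
    intro c
    nth_rw 1 [hve]
    rw [smul_smul, inner_smul_left, real_inner_self_eq_norm_sq, hen]; simp
  set y := f s - f a - β • v with hy
  have hyi : |inner ℝ y e| ≤ D := by
    have := abs_real_inner_le_norm y e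
    rw [hen, mul_one] at this; linarith
  have hyi' := abs_le.1 hyi
  refine ⟨e, hen, fun τ hτ => ?_⟩
  have hτ' := abs_le.1 hτ
  have hcont : ContinuousOn (fun t => inner ℝ (f t - f s) e) (Icc a b) :=
    ((hf.continuous.sub continuous_const).inner continuous_const).continuousOn
  have hIVT := intermediate_value_Icc (hs.1.trans hs.2) hcont
  have ea : inner ℝ (f a - f s) e ≤ τ := by
    rw [show f a - f s = (-β) • v - y by rw [hy]; module, inner_sub_left, hvi]
    nlinarith
  have eb : τ ≤ inner ℝ (f b - f s) e := by
    rw [show f b - f s = (1 - β) • v - y by rw [hy, hv]; module, inner_sub_left, hvi]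
    nlinarith
  obtain ⟨t, ht, htτ⟩ := hIVT ⟨ea, eb⟩
  simp only at htτ
  refine ⟨f t, mem_image_of_mem f (hab ht), ?_, htτ⟩
  obtain ⟨γ, -, -, hγ⟩ := hseg t ht
  set z := f t - f a - γ • v with hz
  have h1 : f t - f s = (z - y) + (γ - β) • v := by rw [hz, hy]; module
  have h2 : f t - f s - τ • e = (z - y) - (inner ℝ (z - y) e : ℝ) • e := by
    rw [← htτ, h1, inner_add_left, hvi, add_smul]
    nth_rw 1 [hve]
    rw [smul_smul]; module
  rw [h2]
  refine (norm_sub_inner_smul_le hen _).trans ((norm_sub_le _ _).trans ?_)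
  linarith

lemma exists_windowFamily {f : ℝ → H} (hf : LipschitzWith 1 f) {P : Finset ℝ} {L r h : ℝ}
    (h0 : 0 ∈ P) (hL : L ∈ P) (hPL : (P : Set ℝ) ⊆ Icc 0 L) (hh : 0 < h) (hhr : 2 * h ≤ r)
    (hP : IsFineMesh f P r) {F : Finset H} (hF : ∀ x ∈ F, x ∈ f '' Icc 0 L)
    (hF0 : ∀ x ∈ F, 2 * r ≤ dist (f 0) x) (hFL : ∀ x ∈ F, 2 * r ≤ dist (f L) x) {C₀ : ℕ}
    (hC : ∀ x ∈ F, (F.filter fun y => dist y x ≤ 8 * r).card ≤ C₀) :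
    ∃ W, IsWindowFamily (P : Set ℝ) W ∧
      (∀ w ∈ W, ∀ t ∈ Icc w.1 w.2, dist (f t) (f w.1) ≤ 8 * r) ∧
      ∑ x ∈ F, arcDefect (f '' Icc 0 L) x r h ^ 2 ≤
        4 * C₀ * ∑ w ∈ W, arcDev f w.1 w.2 ^ 2 := by
  obtain ⟨Y, hYF, hsep, hY⟩ := exists_separated_sum_le F (by linarith : 0 ≤ 8 * r) hC
    (val := fun x => arcDefect (f '' Icc 0 L) x r h ^ 2) (fun x => sq_nonneg _)
  have hwin : ∀ x : H, ∃ w : ℝ × ℝ, x ∈ F → ∃ s, f s = x ∧ w.1 ∈ P ∧ w.2 ∈ P ∧ w.1 < s ∧ s < w.2 ∧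
      2 * r ≤ dist (f w.1) x ∧ 2 * r ≤ dist (f w.2) x ∧
      ∀ t ∈ Icc w.1 w.2, dist (f t) x ≤ 4 * r := by
    intro x
    by_cases hx : x ∈ F
    · obtain ⟨s, hs, hsx⟩ := hF x hx
      obtain ⟨a, ha, b, hb, h1, h2, h3, h4, h5⟩ := exists_window hf h0 hL (by linarith) hP hs le_rfl
        (by rw [hsx]; exact hF0 x hx) (by rw [hsx]; exact hFL x hx)
      rw [hsx] at h3 h4 h5
      exact ⟨(a, b), fun _ => ⟨s, hsx, ha, hb, h1, h2, h3, h4, fun t ht => by linarith [h5 t ht]⟩⟩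
    · exact ⟨(0, 0), fun h => absurd h hx⟩
  choose w hw using hwin
  have hmeet : ∀ x ∈ Y, ∀ y ∈ Y, ∀ t, t ∈ Ioo (w x).1 (w x).2 → t ∈ Ioo (w y).1 (w y).2 → x = y := by
    intro x hx y hy t htx hty
    by_contra hne
    obtain ⟨-, -, -, -, -, -, -, -, h1⟩ := hw x (hYF hx)
    obtain ⟨-, -, -, -, -, -, -, -, h2⟩ := hw y (hYF hy)
    have := h1 t (Ioo_subset_Icc_self htx)
    have := h2 t (Ioo_subset_Icc_self hty)
    have := hsep x hx y hy hne
    have := dist_triangle_left x y (f t)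
    linarith
  have hinj : Set.InjOn w Y := by
    intro x hx y hy hxy
    obtain ⟨s, -, -, -, h1, h2, -⟩ := hw x (hYF hx)
    exact hmeet x hx y hy s ⟨h1, h2⟩ (by rw [← hxy]; exact ⟨h1, h2⟩)
  refine ⟨Y.image w, ⟨?_, ?_, ?_, ?_⟩, ?_, ?_⟩
  · rintro _ hv
    obtain ⟨x, hx, rfl⟩ := Finset.mem_image.1 hv
    obtain ⟨s, -, h1, -⟩ := hw x (hYF hx)
    exact h1
  · rintro _ hv
    obtain ⟨x, hx, rfl⟩ := Finset.mem_image.1 hv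
    obtain ⟨s, -, -, h1, -⟩ := hw x (hYF hx)
    exact h1
  · rintro _ hv
    obtain ⟨x, hx, rfl⟩ := Finset.mem_image.1 hv
    obtain ⟨s, -, -, -, h1, h2, -⟩ := hw x (hYF hx)
    exact h1.trans h2
  · intro v hv v' hv' hne
    obtain ⟨x, hx, rfl⟩ := Finset.mem_image.1 hv
    obtain ⟨y, hy, rfl⟩ := Finset.mem_image.1 hv'
    refine Set.disjoint_left.2 fun t ht ht' => hne ?_
    rw [hmeet x hx y hy t ht ht']
  · intro v hv t ht
    obtain ⟨x, hx, rfl⟩ := Finset.mem_image.1 hv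
    obtain ⟨s, -, -, -, h1, h2, -, -, h5⟩ := hw x (hYF hx)
    have := h5 t ht
    have := h5 (w x).1 ⟨le_rfl, (h1.trans h2).le⟩
    have := dist_triangle_right (f t) (f (w x).1) x
    linarith
  · rw [Finset.sum_image hinj]
    refine hY.trans ?_
    rw [mul_comm (4 : ℝ), mul_assoc, Finset.mul_sum _ _ (4 : ℝ)]
    refine mul_le_mul_of_nonneg_left (Finset.sum_le_sum fun x hx => ?_) (Nat.cast_nonneg _)
    obtain ⟨s, hs, h1, h2, h3, h4, h5, h6, -⟩ := hw x (hYF hx)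
    have hd0 := arcDev_nonneg f (w x).1 (w x).2
    have : arcDefect (f '' Icc 0 L) x r h ≤ 2 * arcDev f (w x).1 (w x).2 := by
      refine arcDefect_le (by positivity) ?_
      rcases le_or_gt h (2 * arcDev f (w x).1 (w x).2) with h7 | h7
      · exact Or.inl h7
      · right
        have := exists_isAxis_of_window (r := r) (R := 2 * r) hf (Icc_subset_Icc (hPL h1).1
            (hPL h2).2) ⟨h3.le, h4.le⟩
          (by linarith) (by linarith) (by rwa [hs]) (by rwa [hs])
        rwa [hs] at this
    calc arcDefect (f '' Icc 0 L) x r h ^ 2 ≤ (2 * arcDev f (w x).1 (w x).2) ^ 2 :=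
          pow_le_pow_left₀ (arcDefect_nonneg _ _ _ _) this 2
      _ = _ := by ring

lemma sum_range_three_mul_le {g : ℕ → ℝ} (hg : ∀ j, 0 ≤ g j) (K : ℕ) :
    ∑ j ∈ Finset.range K, g j ≤ ∑ i ∈ Finset.range 3, ∑ k ∈ Finset.range (K + 1),
        g (3 * (K - k) + i) := by
  have h1 : ∀ i, ∑ k ∈ Finset.range (K + 1), g (3 * (K - k) + i) =
      ∑ k ∈ Finset.range (K + 1), g (3 * k + i) := fun i => by
    rw [← Finset.sum_range_reflect (fun k => g (3 * k + i))]
    rfl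
  have h2 : ∀ m, ∑ j ∈ Finset.range (3 * m), g j =
      ∑ i ∈ Finset.range 3, ∑ k ∈ Finset.range m, g (3 * k + i) := by
    intro m
    induction m with
    | zero => simp
    | succ m ih =>
      rw [show 3 * (m + 1) = 3 * m + 1 + 1 + 1 by ring, Finset.sum_range_succ,
          Finset.sum_range_succ,
        Finset.sum_range_succ, ih]
      simp only [Finset.sum_range_succ, Finset.sum_range_zero]
      ring_nf
  simp only [h1]
  rw [← h2]
  exact Finset.sum_le_sum_of_subset_of_nonneg (Finset.range_mono (by omega)) fun _ _ _ => hg _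

lemma exists_bound_sum_arcDefect {f : ℝ → H} (hf : LipschitzWith 1 f) {L : ℝ} (hL : 0 ≤ L)
    {h₀ κ : ℝ}
    (hh₀ : 0 < h₀) (hκ : 2 ≤ κ) (C₀ : ℕ) :
    ∃ C : ℝ, 0 ≤ C ∧ ∀ F : ℕ → Finset H, (∀ j, ∀ x ∈ F j, x ∈ f '' Icc 0 L ∧
        2 * (κ * h₀) ≤ dist (f 0) x ∧ 2 * (κ * h₀) ≤ dist (f L) x ∧
        ((F j).filter fun y => dist y x ≤ 8 * (κ * (h₀ / 2 ^ j))).card ≤ C₀) →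
      ∀ K, ∑ j ∈ Finset.range K, ∑ x ∈ F j,
        arcDefect (f '' Icc 0 L) x (κ * (h₀ / 2 ^ j)) (h₀ / 2 ^ j) ^ 2 / (h₀ / 2 ^ j) ≤ C := by
  refine ⟨3 * (4 * C₀ * κ * (48 * (L + 1))), by positivity, fun F hF K => ?_⟩
  set g : ℕ → ℝ := fun j => ∑ x ∈ F j,
    arcDefect (f '' Icc 0 L) x (κ * (h₀ / 2 ^ j)) (h₀ / 2 ^ j) ^ 2 / (h₀ / 2 ^ j) with hg
  have hg0 : ∀ j, 0 ≤ g j := fun j => Finset.sum_nonneg fun x _ => by positivity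
  refine (sum_range_three_mul_le hg0 K).trans ?_
  have key : ∀ i ∈ Finset.range 3, ∑ k ∈ Finset.range (K + 1), g (3 * (K - k) + i) ≤
      4 * C₀ * κ * (48 * (L + 1)) := by
    intro i _
    set δ := κ * (h₀ / 2 ^ (3 * K + i)) with hδ
    obtain ⟨P, hP, hW⟩ := exists_mesh_chain hf hL (show 0 < δ by positivity)
    have hscale : ∀ k ≤ K, 8 ^ k * δ = κ * (h₀ / 2 ^ (3 * (K - k) + i)) := by
      intro k hk
      have : (2 : ℝ) ^ (3 * K + i) = 8 ^ k * 2 ^ (3 * (K - k) + i) := by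
        rw [show (8 : ℝ) = 2 ^ 3 by norm_num, ← pow_mul, ← pow_add]
        congr 1; omega
      rw [hδ, this]; field_simp
    have hex : ∀ k : ℕ, ∃ W, IsWindowFamily (P k : Set ℝ) W ∧
        (∀ w ∈ W, ∀ t ∈ Icc w.1 w.2, dist (f t) (f w.1) ≤ 8 * (8 ^ k * δ)) ∧
        (k ≤ K → g (3 * (K - k) + i) ≤
          4 * C₀ * κ * ((∑ w ∈ W, arcDev f w.1 w.2 ^ 2) / (8 ^ k * δ))) := by
      intro k
      rcases le_or_gt k K with hk | hk
      · obtain ⟨a1, a2, a3, a4⟩ := hP k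
        set j := 3 * (K - k) + i with hj
        rw [hscale k hk, ← hj] at a4 ⊢
        have hle : h₀ / 2 ^ j ≤ h₀ := div_le_self hh₀.le (one_le_pow₀ (by norm_num))
        have hle' : 2 * (κ * (h₀ / 2 ^ j)) ≤ 2 * (κ * h₀) := by gcongr
        have hpos : 0 < h₀ / 2 ^ j := by positivity
        obtain ⟨W, b1, b2, b3⟩ := exists_windowFamily hf a1 a2 a3 (h := h₀ / 2 ^ j) hpos
          (by gcongr) a4 (fun x hx => (hF j x hx).1)
          (fun x hx => hle'.trans (hF j x hx).2.1) (fun x hx => hle'.trans (hF j x hx).2.2.1)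
          (fun x hx => (hF j x hx).2.2.2)
        refine ⟨W, b1, b2, fun _ => ?_⟩
        rw [hg]
        simp only
        rw [← Finset.sum_div, div_le_iff₀ hpos]
        refine b3.trans_eq ?_
        clear_value j
        have : κ ≠ 0 := by positivity
        field_simp
      · exact ⟨∅, ⟨by simp, by simp, by simp, by simp⟩, by simp, fun h => absurd h (by omega)⟩
    choose W hW1 hW2 hW3 using hex
    calc ∑ k ∈ Finset.range (K + 1), g (3 * (K - k) + i)
        ≤ ∑ k ∈ Finset.range (K + 1), 4 * C₀ * κ * ((∑ w ∈ W k, arcDev f w.1 w.2 ^ 2) /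
            (8 ^ k * δ)) :=
          Finset.sum_le_sum fun k hk => hW3 k (Nat.lt_succ_iff.1 (Finset.mem_range.1 hk))
      _ ≤ _ := by
          rw [← Finset.mul_sum]
          exact mul_le_mul_of_nonneg_left (hW W hW1 hW2 (K + 1)) (by positivity)
  refine (Finset.sum_le_sum key).trans_eq ?_
  rw [Finset.sum_const, Finset.card_range, nsmul_eq_mul]; norm_num

end Axis

section Flatness

variable {H : Type u} [NormedAddCommGroup H] [InnerProductSpace ℝ H]

/-- The part of `Γ` within distance `M` of `x` is within `M / 64` of a line. -/
def IsFlat (Γ : Set H) (x : H) (M : ℝ) : Prop :=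
  ∃ a v : H, v ≠ 0 ∧ ∀ y ∈ Γ, dist y x ≤ M → infDist y (lineThrough a v) ≤ M / 64

lemma dist_le_add_of_norm_sub_le {x e p : H} (he : ‖e‖ = 1) {ρ D : ℝ} (h1 : |inner ℝ (p - x) e| ≤ ρ)
    (h2 : ‖p - x - (inner ℝ (p - x) e : ℝ) • e‖ ≤ D) : dist p x ≤ ρ + D := by
  rw [dist_eq_norm]
  have := norm_add_le ((inner ℝ (p - x) e : ℝ) • e) (p - x - (inner ℝ (p - x) e : ℝ) • e)
  rw [norm_smul, he, mul_one, Real.norm_eq_abs, add_sub_cancel] at this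
  linarith

lemma exists_far_of_not_isFlat {Γ : Set H} {x e : H} {M : ℝ} (he : ‖e‖ = 1) (h : ¬ IsFlat Γ x M) :
    ∃ y ∈ Γ, dist y x ≤ M ∧ M / 64 < ‖y - x - (inner ℝ (y - x) e : ℝ) • e‖ := by
  by_contra! hcon
  refine h ⟨x, e, fun h0 => by rw [h0, norm_zero] at he; exact zero_ne_one he, fun y hy hyx => ?_⟩
  refine (infDist_le_dist_of_mem (show x + (inner ℝ (y - x) e : ℝ) • e ∈ lineThrough x e from
      ⟨_, rfl⟩)).trans (le_trans (le_of_eq ?_) (hcon y hy hyx))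
  rw [dist_eq_norm, sub_add_eq_sub_sub]

lemma card_not_isFlat_mul_le {Γ : Set H} (hΓ : IsPreconnected Γ) {F : Finset H} {M D : ℝ}
    (hM : 0 < M)
    (hD : D ≤ M / 3840) (hF : ∀ x ∈ F, ¬ IsFlat Γ x M ∧ (∃ p ∈ Γ, 2 * M ≤ dist p x) ∧
      ∃ e, IsAxis Γ x e (2 * M) D)
    {C₀ : ℕ} (hC : ∀ x ∈ F, (F.filter fun y => dist y x ≤ 5 * M).card ≤ C₀)
    (hne : ∃ 𝒰, IsFineCover Γ (M / 5000) 𝒰) :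
    C₀ * coverLength Γ (5 * M) + F.card * (M / 1000) ≤ C₀ * coverLength Γ (M / 5000) := by
  obtain ⟨Y, hYF, hsep, hY⟩ := exists_separated_sum_le F (by linarith : 0 ≤ 5 * M) hC
    (val := fun _ => 1) (fun _ => zero_le_one)
  simp only [Finset.sum_const, nsmul_eq_mul, mul_one] at hY
  choose! hbad hbig e he using hF
  have hfar : ∀ x ∈ F, ∃ y ∈ Γ, dist y x ≤ M ∧
      M / 64 < ‖y - x - (inner ℝ (y - x) (e x) : ℝ) • e x‖ :=
    fun x hx => exists_far_of_not_isFlat (he x hx).norm_eq (hbad x hx)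
  choose! y hyΓ hyx hye using hfar
  set π : H → H → H := fun x p => p - x - (inner ℝ (p - x) (e x) : ℝ) • e x with hπ
  have hπd : ∀ x ∈ F, ∀ p q, ‖π x p - π x q‖ ≤ dist p q := by
    intro x hx p q
    have : π x p - π x q = (p - q) - (inner ℝ (p - q) (e x) : ℝ) • e x := by
      have h : inner ℝ (p - q) (e x) = inner ℝ (p - x) (e x) - inner ℝ (q - x) (e x) := by
        rw [← inner_sub_left, sub_sub_sub_cancel_right]
      simp only [hπ]
      rw [h]; module
    rw [this, dist_eq_norm]
    exact norm_sub_inner_smul_le (he x hx).norm_eq _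
  let T : H × Bool → Set H := fun i => if i.2 then
    {p ∈ Γ | |inner ℝ (p - i.1) (e i.1)| ≤ 2 * M ∧ ‖π i.1 p‖ ≤ D} else Γ ∩ closedBall (y i.1)
        (M / 512)
  have hTx : ∀ x ∈ F, ∀ b, ∀ u ∈ T (x, b), dist u x ≤ 2 * M + M / 3840 := by
    intro x hx b u hu
    cases b
    · have h1 : dist u (y x) ≤ M / 512 := hu.2
      have := dist_triangle u (y x) x
      have := hyx x hx
      linarith
    · have h1 : |inner ℝ (u - x) (e x)| ≤ 2 * M ∧ ‖π x u‖ ≤ D := hu.2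
      have := dist_le_add_of_norm_sub_le (he x hx).norm_eq h1.1 h1.2
      linarith
  have hTT : ∀ x ∈ F, ∀ u ∈ T (x, true), ∀ v ∈ T (x, false), M / 5000 < dist u v := by
    intro x hx u hu v hv
    have h1 : |inner ℝ (u - x) (e x)| ≤ 2 * M ∧ ‖π x u‖ ≤ D := hu.2
    have h2 : dist v (y x) ≤ M / 512 := hv.2
    have h3 := hπd x hx (y x) u
    have h4 : M / 64 < ‖π x (y x)‖ := hye x hx
    have h5 : ‖π x (y x)‖ ≤ ‖π x (y x) - π x u‖ + ‖π x u‖ := by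
      simpa using norm_add_le (π x (y x) - π x u) (π x u)
    have h6 := dist_triangle_right (y x) u v
    rw [dist_comm (y x) v] at h6
    linarith
  have hmerge := coverLength_add_le (Γ := Γ) (δ := M / 5000) (δ' := 5 * M) (d := 4 * M + M / 1920)
    (by positivity) (by positivity) (by linarith) hne (Y ×ˢ (Finset.univ : Finset Bool)) Y Prod.fst
    (fun i hi => (Finset.mem_product.1 hi).1) T (fun i => if i.2 then 4 * M else M / 512) ?_ ?_ ?_
  · have hsum : ∑ i ∈ Y ×ˢ (Finset.univ : Finset Bool), (if i.2 then 4 * M else M / 512) =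
        Y.card * (4 * M + M / 512) := by
      rw [Finset.sum_product]
      simp [mul_add]
    rw [hsum] at hmerge
    have h1 : coverLength Γ (5 * M) + Y.card * (M / 1000) ≤ coverLength Γ (M / 5000) := by
      have : (0 : ℝ) ≤ Y.card * M := mul_nonneg (Nat.cast_nonneg _) hM.le
      linarith
    have h2 := mul_le_mul_of_nonneg_left h1 (Nat.cast_nonneg (α := ℝ) C₀)
    have h3 := mul_le_mul_of_nonneg_right hY (by positivity : 0 ≤ M / 1000)
    linarith
  · rintro ⟨x, b⟩ hx ⟨x', b'⟩ hx' hne' u hu v hv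
    rw [Finset.mem_product] at hx hx'
    by_cases hxx : x = x'
    · subst hxx
      have hbb : b ≠ b' := fun h => hne' (by rw [h])
      cases b <;> cases b'
      · exact absurd rfl hbb
      · rw [dist_comm]; exact hTT x (hYF hx.1) v hv u hu
      · exact hTT x (hYF hx.1) u hu v hv
      · exact absurd rfl hbb
    · have h1 := hTx x (hYF hx.1) b u hu
      have h2 := hTx x' (hYF hx'.1) b' v hv
      have h3 := hsep x hx.1 x' hx'.1 hxx
      have := dist_triangle4 x u v x'
      rw [dist_comm x u] at this
      linarith
  · rintro 𝒰 h𝒰 ⟨x, b⟩ hx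
    rw [Finset.mem_product] at hx
    have hxF := hYF hx.1
    cases b
    · obtain ⟨p, hp, hpx⟩ := hbig x hxF
      have h1 := hyx x hxF
      have h2 := dist_triangle p (y x) x
      exact le_sum_diam_meeting_closedBall hΓ (hyΓ x hxF) hp
        (show M / 512 ≤ dist p (y x) by linarith) h𝒰
    · have h1 := le_sum_diam_meeting h𝒰 (T := T (x, true)) (fun p hp => hp.1)
        (φ := fun p => inner ℝ (p - x) (e x)) ?_ (α := -(2 * M)) (β := 2 * M) ?_
      · simp only [if_true]
        linarith
      · intro p q
        rw [← inner_sub_left, sub_sub_sub_cancel_right, dist_eq_norm]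
        have := abs_real_inner_le_norm (p - q) (e x)
        rwa [(he x hxF).norm_eq, mul_one] at this
      · intro τ hτ
        obtain ⟨p, hp, h2, h3⟩ := (he x hxF).exists_mem τ (abs_le.2 hτ)
        refine ⟨p, ⟨hp, ?_, ?_⟩, h3⟩
        · simp only; rw [h3]; exact abs_le.2 hτ
        · simp only [hπ]; rwa [h3]
  · rintro ⟨x, b⟩ hx ⟨x', b'⟩ hx' hxx u hu v hv
    rw [Finset.mem_product] at hx hx'
    simp only at hxx
    subst hxx
    have h1 := hTx x (hYF hx.1) b u hu
    have h2 := hTx x (hYF hx.1) b' v hv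
    have := dist_triangle_right u v x
    linarith

lemma exists_bound_sum_not_isFlat {f : ℝ → H} (hf : LipschitzWith 1 f) {L : ℝ} (hL : 0 ≤ L)
    {h₀ B : ℝ}
    (hh₀ : 0 < h₀) (hB : 3840 ≤ B) (C₀ : ℕ) :
    ∃ C : ℝ, 0 ≤ C ∧ ∀ F : ℕ → Finset H, (∀ j, ∀ x ∈ F j, x ∈ f '' Icc 0 L ∧
        2 * (4 * B * h₀) ≤ dist (f 0) x ∧ 2 * (4 * B * h₀) ≤ dist (f L) x ∧
        ((F j).filter fun y => dist y x ≤ 8 * (4 * B * (h₀ / 2 ^ j))).card ≤ C₀ ∧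
        ¬ IsFlat (f '' Icc 0 L) x (B * (h₀ / 2 ^ j))) →
      ∀ K, ∑ j ∈ Finset.range K, ((F j).card : ℝ) * (h₀ / 2 ^ j) ≤ C := by
  obtain ⟨C₁, hC₁, h1⟩ := exists_bound_sum_arcDefect hf hL hh₀ (by linarith : 2 ≤ 4 * B) C₀
  obtain ⟨C₂, hC₂, h2⟩ := sum_coverLength_sub_le hf hL hh₀ (κ := B / 5000) (κ' := 5 * B)
    (by positivity) (by positivity)
  refine ⟨C₁ + C₀ * C₂, by positivity, fun F hF K => ?_⟩
  set Γ := f '' Icc 0 L with hΓ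
  let G : ℕ → Finset H := fun j => (F j).filter fun x =>
    arcDefect Γ x (4 * B * (h₀ / 2 ^ j)) (h₀ / 2 ^ j) < h₀ / 2 ^ j
  have hterm : ∀ j, ((F j).card : ℝ) * (h₀ / 2 ^ j) ≤
      ∑ x ∈ F j, arcDefect Γ x (4 * B * (h₀ / 2 ^ j)) (h₀ / 2 ^ j) ^ 2 / (h₀ / 2 ^ j) +
      C₀ * (coverLength Γ (B / 5000 * (h₀ / 2 ^ j)) - coverLength Γ (5 * B * (h₀ / 2 ^ j))) := by
    intro j
    set h := h₀ / 2 ^ j with hh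
    have hp : 0 < h := by positivity
    have hle : h ≤ h₀ := div_le_self hh₀.le (one_le_pow₀ one_le_two)
    have hcard : ((F j).card : ℝ) = (G j).card +
        ((F j).filter fun x => ¬ arcDefect Γ x (4 * B * h) h < h).card := by
      exact_mod_cast (Finset.card_filter_add_card_filter_not _).symm
    have ha : (((F j).filter fun x => ¬ arcDefect Γ x (4 * B * h) h < h).card : ℝ) * h ≤
        ∑ x ∈ F j, arcDefect Γ x (4 * B * h) h ^ 2 / h := by
      rw [← nsmul_eq_mul, ← Finset.sum_const]
      refine (Finset.sum_le_sum fun x hx => ?_).trans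
        (Finset.sum_le_sum_of_subset_of_nonneg (Finset.filter_subset _ _) fun x _ _ =>
            by positivity)
      have := not_lt.1 (Finset.mem_filter.1 hx).2
      rw [le_div_iff₀ hp, sq]
      exact mul_le_mul this this hp.le (arcDefect_nonneg _ _ _ _)
    have hb : ((G j).card : ℝ) * h ≤
        C₀ * (coverLength Γ (B / 5000 * h) - coverLength Γ (5 * B * h)) := by
      obtain ⟨𝒰, h𝒰, -⟩ := exists_isFineCover hf hL (δ := B * h / 5000) (by positivity)
      have hBh : B * h ≤ B * h₀ := by gcongr
      have := card_not_isFlat_mul_le (Γ := Γ) (F := G j) (M := B * h) (D := h)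
        (isPreconnected_Icc.image _ hf.continuous.continuousOn) (by positivity)
        (by rw [le_div_iff₀ (by norm_num)]; nlinarith) ?_ (C₀ := C₀) ?_ ⟨𝒰, h𝒰⟩
      · rw [show B / 5000 * h = B * h / 5000 by ring, mul_assoc 5]
        have h3 : ((G j).card : ℝ) * h ≤ (G j).card * (B * h / 1000) := by
          gcongr
          rw [le_div_iff₀ (by norm_num)]; nlinarith
        linarith
      · intro x hx
        obtain ⟨hxF, hxd⟩ := Finset.mem_filter.1 hx
        obtain ⟨-, a2, -, -, a5⟩ := hF j x hxF
        refine ⟨a5, ⟨f 0, mem_image_of_mem f ⟨le_rfl, hL⟩, by nlinarith⟩, ?_⟩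
        obtain ⟨D, e, hD0, hDh, hax⟩ := exists_isAxis_of_arcDefect_lt hp.le hxd le_rfl
        exact ⟨e, hax.norm_eq, fun τ hτ => by
          obtain ⟨p, hp1, hp2, hp3⟩ := hax.exists_mem τ (hτ.trans (by nlinarith))
          exact ⟨p, hp1, hp2.trans hDh.le, hp3⟩⟩
      · intro x hx
        have hxF := (Finset.mem_filter.1 hx).1
        refine (Finset.card_le_card fun z hz => ?_).trans (hF j x hxF).2.2.2.1
        rw [Finset.mem_filter] at hz ⊢
        exact ⟨(Finset.mem_filter.1 hz.1).1, hz.2.trans (by nlinarith)⟩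
    rw [hcard, add_mul]
    linarith
  refine (Finset.sum_le_sum fun j _ => hterm j).trans ?_
  rw [Finset.sum_add_distrib, ← Finset.mul_sum]
  refine add_le_add (h1 F (fun j x hx => ?_) K) (mul_le_mul_of_nonneg_left (h2 K)
      (Nat.cast_nonneg _))
  obtain ⟨a1, a2, a3, a4, -⟩ := hF j x hx
  exact ⟨a1, a2, a3, a4⟩

end Flatness

section Escape

variable {H : Type u} [NormedAddCommGroup H] [InnerProductSpace ℝ H]

lemma not_isFlat_of_isAxis {Γ : Set H} {x e y z : H} {r D d M : ℝ} (hax : IsAxis Γ x e r D)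
    (hy : y ∈ Γ) (hd : ‖y - x - (inner ℝ (y - x) e : ℝ) • e‖ = d)
    (hr : |inner ℝ (y - x) e| + 2 * d ≤ r) (hD : 32 * D < d) (hM1 : 4 * d ≤ M) (hM2 : M < 8 * d)
    (hz : ‖z - x - (inner ℝ (y - x) e : ℝ) • e‖ ≤ D + M / 3840) : ¬ IsFlat Γ z M := by
  rintro ⟨a, v, hv, hflat⟩
  have hd0 : 0 ≤ d := hd ▸ norm_nonneg _
  set φ : ℝ := inner ℝ (y - x) e with hφ
  have hee : inner ℝ e e = 1 := by rw [real_inner_self_eq_norm_sq, hax.norm_eq, one_pow]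
  have h2d : |2 * d| = 2 * d := abs_of_nonneg (by linarith)
  obtain ⟨p, hp, hpD, hpe⟩ := hax.exists_mem (φ + 2 * d)
      ((abs_add_le _ _).trans (by rw [h2d]; exact hr))
  obtain ⟨q, hq, hqD, hqe⟩ := hax.exists_mem (φ - 2 * d)
      ((abs_sub _ _).trans (by rw [h2d]; exact hr))
  have hnear : ∀ w : H, ∀ s : ℝ, |s| ≤ 2 * d → ‖w - x - (φ + s) • e‖ ≤ d → dist w z ≤ M := by
    intro w s hs hw
    rw [dist_eq_norm, show w - z = (w - x - (φ + s) • e) + s • e - (z - x - φ • e) by module]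
    refine (norm_sub_le _ _).trans ?_
    have h1 := norm_add_le (w - x - (φ + s) • e) (s • e)
    rw [norm_smul, hax.norm_eq, mul_one, Real.norm_eq_abs] at h1
    linarith
  have hy' := hflat y hy (hnear y 0 (by rw [abs_zero]; linarith) (by rw [add_zero]; exact hd.le))
  have hp' := hflat p hp (hnear p (2 * d) h2d.le (by linarith))
  have hq' := hflat q hq (hnear q (-(2 * d)) (by rw [abs_neg]; exact h2d.le)
    (by rw [← sub_eq_add_neg]; linarith))
  replace hy' := (norm_sub_inner_smul_le_infDist hv).trans hy'
  replace hp' := (norm_sub_inner_smul_le_infDist hv).trans hp'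
  replace hq' := (norm_sub_inner_smul_le_infDist hv).trans hq'
  set u := ‖v‖⁻¹ • v with hu
  have huu : ‖u‖ = 1 := by
    rw [hu, norm_smul, norm_inv, norm_norm, inv_mul_cancel₀ (norm_ne_zero_iff.2 hv)]
  set sy : ℝ := inner ℝ (y - a) u
  set sp : ℝ := inner ℝ (p - a) u
  set sq : ℝ := inner ℝ (q - a) u
  set oy := y - a - sy • u with hoy
  set op := p - a - sp • u with hop
  set oq := q - a - sq • u with hoq
  set wp := p - x - (φ + 2 * d) • e with hwp
  set wq := q - x - (φ - 2 * d) • e with hwq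
  set wy := y - x - φ • e with hwy
  have hwye : inner ℝ wy e = 0 := by rw [hwy, inner_sub_left, inner_smul_left, hee, ← hφ]; simp
  have hwpe : inner ℝ wp e = 0 := by rw [hwp, inner_sub_left, inner_smul_left, hee, hpe]; simp
  have hwqe : inner ℝ wq e = 0 := by rw [hwq, inner_sub_left, inner_smul_left, hee, hqe]; simp
  set s : ℝ := sy - (sp + sq) / 2 with hs
  set t : ℝ := sp - sq with ht
  set o₁ := oy - (1 / 2 : ℝ) • (op + oq) with ho₁
  set o₂ := op - oq with ho₂
  have e1 : wy - (1 / 2 : ℝ) • (wp + wq) = s • u + o₁ := by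
    rw [hwy, hwp, hwq, ho₁, hoy, hop, hoq, hs]; module
  have e2 : wp - wq + (4 * d) • e = t • u + o₂ := by
    rw [hwp, hwq, ho₂, hop, hoq, ht]; module
  have hhalf : ∀ b c : H, ‖(1 / 2 : ℝ) • (b + c)‖ ≤ (‖b‖ + ‖c‖) / 2 := by
    intro b c
    rw [norm_smul, Real.norm_eq_abs, abs_of_pos (by norm_num : (0 : ℝ) < 1 / 2)]
    linarith [norm_add_le b c]
  have no1 : ‖o₁‖ ≤ d / 4 := (norm_sub_le _ _).trans (by linarith [hhalf op oq])
  have no2 : ‖o₂‖ ≤ d / 4 := (norm_sub_le _ _).trans (by linarith)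
  have ie : ∀ w : H, |inner ℝ w e| ≤ ‖w‖ := fun w => by
    have := abs_real_inner_le_norm w e
    rwa [hax.norm_eq, mul_one] at this
  have hs1 : d / 2 ≤ |s| := by
    have h1 : ‖wy‖ ≤ ‖wy - (1 / 2 : ℝ) • (wp + wq)‖ + ‖(1 / 2 : ℝ) • (wp + wq)‖ := by
      simpa using norm_add_le (wy - (1 / 2 : ℝ) • (wp + wq)) ((1 / 2 : ℝ) • (wp + wq))
    have h2 := norm_add_le (s • u) o₁
    rw [norm_smul, huu, mul_one, Real.norm_eq_abs, ← e1] at h2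
    linarith [hhalf wp wq]
  have ht1 : |t| ≤ 5 * d := by
    have h1 : ‖t • u‖ ≤ ‖t • u + o₂‖ + ‖o₂‖ := by
      simpa using norm_sub_le (t • u + o₂) o₂
    rw [norm_smul, huu, mul_one, Real.norm_eq_abs, ← e2] at h1
    have h2 := norm_add_le (wp - wq) ((4 * d) • e)
    rw [norm_smul, hax.norm_eq, mul_one, Real.norm_eq_abs, abs_of_nonneg (by linarith)] at h2
    linarith [norm_sub_le wp wq]
  set c : ℝ := inner ℝ u e with hc
  have hsc : |s| * |c| ≤ d / 4 := by
    have h1 : s * c + inner ℝ o₁ e = 0 := by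
      have := congrArg (fun w => inner ℝ w e) e1
      simp only [inner_add_left, inner_sub_left, real_inner_smul_left, hwye, hwpe, hwqe] at this
      linarith
    rw [← abs_mul, show s * c = -inner ℝ o₁ e by linarith, abs_neg]
    exact (ie _).trans no1
  have htc : 15 / 4 * d ≤ |t| * |c| := by
    have h1 : t * c + inner ℝ o₂ e = 4 * d := by
      have := congrArg (fun w => inner ℝ w e) e2
      simp only [inner_add_left, inner_sub_left, real_inner_smul_left, hwpe, hwqe, hee] at this
      linarith
    rw [← abs_mul]
    have h2 := le_abs_self (t * c)
    have h3 := (le_abs_self _).trans ((ie o₂).trans no2)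
    linarith
  have hdp : 0 < d := by
    have : 0 ≤ D := (norm_nonneg _).trans hpD
    linarith
  have h1 : d / 2 * |c| ≤ d / 4 := (mul_le_mul_of_nonneg_right hs1 (abs_nonneg c)).trans hsc
  have h2 : 15 / 4 * d ≤ 5 * d * |c| := htc.trans (mul_le_mul_of_nonneg_right ht1 (abs_nonneg c))
  linarith

/-- The points of a net around which `Γ` is not flat at scale `M`, away from the end points `a`,
`b`. -/
def notFlat (Γ : Set H) (a b : H) (m M : ℝ) (N : Finset H) : Finset H :=
  N.filter fun z => m ≤ dist a z ∧ m ≤ dist b z ∧ ¬ IsFlat Γ z M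

lemma norm_sub_axis_le {Γ : Set H} {h₀ : ℝ} (hh₀ : 0 < h₀) {N : ℕ → Finset H}
    (hN : IsNetFamily Γ h₀ N)
    {A : ℝ} (hA : 240 ≤ A) {a b x e : H} {j : ℕ} {D : ℝ} (hD0 : 0 ≤ D) (hDh : D ≤ h₀ / 2 ^ j)
    (hax : IsAxis Γ x e (64 * A * (h₀ / 2 ^ j)) D)
    (ha : 3 * (64 * A * h₀) ≤ dist a x) (hb : 3 * (64 * A * h₀) ≤ dist b x) {y : H} (hy : y ∈ Γ)
    (hyx : dist y x ≤ A * (h₀ / 2 ^ j)) (K : ℕ) :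
    ‖y - x - (inner ℝ (y - x) e : ℝ) • e‖ ≤ 32 * D ∨
    ‖y - x - (inner ℝ (y - x) e : ℝ) • e‖ ≤ 16 * A * (h₀ / 2 ^ K) ∨
    ∃ i < K, j ≤ i ∧ ∃ z ∈ notFlat Γ a b (2 * (64 * A * h₀)) (16 * A * (h₀ / 2 ^ i)) (N i),
      dist z x ≤ 3 * A * (h₀ / 2 ^ j) ∧
      ‖y - x - (inner ℝ (y - x) e : ℝ) • e‖ ≤ 16 * A * (h₀ / 2 ^ i) := by
  set h := h₀ / 2 ^ j with hh
  have hp : 0 < h := by positivity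
  have hle : h ≤ h₀ := div_le_self hh₀.le (one_le_pow₀ one_le_two)
  set d := ‖y - x - (inner ℝ (y - x) e : ℝ) • e‖ with hd
  by_cases hdD : d ≤ 32 * D
  · exact .inl hdD
  push Not at hdD
  right
  have hd0 : 0 < d := by linarith
  have hdA : d ≤ A * h := (norm_sub_inner_smul_le hax.norm_eq _).trans (by rwa [← dist_eq_norm])
  have hφA : |inner ℝ (y - x) e| ≤ A * h := by
    have := abs_real_inner_le_norm (y - x) e
    rw [hax.norm_eq, mul_one, ← dist_eq_norm] at this
    exact this.trans hyx
  have hAh : A * h ≤ A * h₀ := by gcongr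
  have hhA : 240 * h ≤ A * h := by gcongr
  obtain ⟨i, hi1, hi2⟩ := exists_nat_pow_near (x := 16 * A * h₀ / (4 * d)) (y := 2)
    (by rw [le_div_iff₀ (by positivity)]; linarith) one_lt_two
  rw [le_div_iff₀ (by positivity)] at hi1
  rw [div_lt_iff₀ (by positivity), pow_succ] at hi2
  set g := h₀ / 2 ^ i with hg
  have hgp : 0 < g := by positivity
  have hg2 : g * 2 ^ i = h₀ := by rw [hg]; field_simp
  have hM1 : 4 * d ≤ 16 * A * g := by
    rw [hg, ← mul_div_assoc, le_div_iff₀ (by positivity)]; linarith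
  have hM2 : 16 * A * g < 8 * d := by
    rw [hg, ← mul_div_assoc, div_lt_iff₀ (by positivity)]; linarith
  have hji : j ≤ i := by
    by_contra! hcon
    have : h ≤ g := div_le_div_of_nonneg_left hh₀.le (by positivity)
      (pow_le_pow_right₀ one_le_two hcon.le)
    have : A * h ≤ A * g := by gcongr
    have : 0 < A * h := by positivity
    linarith
  have hgh : g ≤ h := div_le_div_of_nonneg_left hh₀.le (by positivity)
    (pow_le_pow_right₀ one_le_two hji)
  by_cases hiK : i < K
  · right
    refine ⟨i, hiK, hji, ?_⟩
    obtain ⟨q, hq, hqD, -⟩ := hax.exists_mem (inner ℝ (y - x) e) (by linarith)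
    obtain ⟨z, hz, hqz⟩ := hN.exists_near i q hq
    have hzx : ‖z - x - (inner ℝ (y - x) e : ℝ) • e‖ ≤ D + g := by
      rw [show z - x - (inner ℝ (y - x) e : ℝ) • e =
        (q - x - (inner ℝ (y - x) e : ℝ) • e) - (q - z) by abel]
      exact (norm_sub_le _ _).trans (add_le_add hqD (by rwa [← dist_eq_norm]))
    have hzd : dist z x ≤ 3 * A * h := by
      have := norm_add_le ((inner ℝ (y - x) e : ℝ) • e) (z - x - (inner ℝ (y - x) e : ℝ) • e)
      rw [norm_smul, hax.norm_eq, mul_one, Real.norm_eq_abs, add_sub_cancel, ← dist_eq_norm] at this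
      linarith
    refine ⟨z, Finset.mem_filter.2 ⟨hz, ?_, ?_, ?_⟩, hzd, by linarith⟩
    · have := dist_triangle_right a x z
      rw [dist_comm x z] at this
      linarith
    · have := dist_triangle_right b x z
      rw [dist_comm x z] at this
      linarith
    · refine not_isFlat_of_isAxis hax hy rfl (by linarith) hdD hM1 hM2 (hzx.trans ?_)
      have : 240 * g ≤ A * g := by gcongr
      linarith
  · left
    have : g ≤ h₀ / 2 ^ K := div_le_div_of_nonneg_left hh₀.le (by positivity)
      (pow_le_pow_right₀ one_le_two (not_lt.1 hiK))
    have : A * g ≤ A * (h₀ / 2 ^ K) := by gcongr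
    linarith

end Escape

section EscapeSum

variable {X : Type*} [MetricSpace X]

lemma sum_two_pow_le (K : ℕ) : ∑ j ∈ Finset.range K, (2 : ℝ) ^ j ≤ 2 ^ K := by
  rw [geom_sum_eq (by norm_num)]
  norm_num

/-- The total weight of the points near `x` around which `Γ` is not flat, at scales finer
than that of index `j`. -/
def escapeSum (h₀ A : ℝ) (bad : ℕ → Finset X) (K j : ℕ) (x : X) : ℝ :=
  ∑ i ∈ Finset.range K, ∑ z ∈ bad i,
    if j ≤ i ∧ dist z x ≤ 3 * A * (h₀ / 2 ^ j) then (h₀ / 2 ^ i) ^ 2 else 0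

lemma escapeSum_nonneg (h₀ A : ℝ) (bad : ℕ → Finset X) (K j : ℕ) (x : X) :
    0 ≤ escapeSum h₀ A bad K j x :=
  Finset.sum_nonneg fun _ _ => Finset.sum_nonneg fun _ _ => by split_ifs <;> positivity

lemma sq_le_escapeSum {h₀ A : ℝ} {bad : ℕ → Finset X} {K j i : ℕ} {x z : X} (hi : i < K)
    (hji : j ≤ i)
    (hz : z ∈ bad i) (hzx : dist z x ≤ 3 * A * (h₀ / 2 ^ j)) :
    (h₀ / 2 ^ i) ^ 2 ≤ escapeSum h₀ A bad K j x := by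
  have hn : ∀ i : ℕ, ∀ z : X,
      0 ≤ if j ≤ i ∧ dist z x ≤ 3 * A * (h₀ / 2 ^ j) then (h₀ / 2 ^ i) ^ 2 else 0 := fun i z => by
    split_ifs <;> positivity
  refine le_trans ?_ (Finset.single_le_sum (fun i _ => Finset.sum_nonneg fun z _ => hn i z)
    (Finset.mem_range.2 hi))
  refine le_trans (le_of_eq ?_) (Finset.single_le_sum (fun z _ => hn i z) hz)
  rw [if_pos ⟨hji, hzx⟩]

lemma sum_escapeSum_div_le {h₀ A : ℝ} (hh₀ : 0 < h₀) (bad G : ℕ → Finset X) {C₀ : ℕ}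
    (hG : ∀ j, ∀ x ∈ G j, ((G j).filter fun y => dist y x ≤ 6 * A * (h₀ / 2 ^ j)).card ≤ C₀)
        (K : ℕ) :
    ∑ j ∈ Finset.range K, ∑ x ∈ G j, escapeSum h₀ A bad K j x / (h₀ / 2 ^ j) ≤
      2 * C₀ * ∑ i ∈ Finset.range K, ((bad i).card : ℝ) * (h₀ / 2 ^ i) := by
  have hcount : ∀ j, ∀ z : X,
      (((G j).filter fun x => dist z x ≤ 3 * A * (h₀ / 2 ^ j)).card : ℝ) ≤ C₀ := by
    intro j z
    rcases ((G j).filter fun x => dist z x ≤ 3 * A * (h₀ / 2 ^ j)).eq_empty_or_nonempty with h |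
        ⟨x, hx⟩
    · rw [h]; simp
    · obtain ⟨hxG, hx⟩ := Finset.mem_filter.1 hx
      refine Nat.cast_le.2 ((Finset.card_le_card fun y hy => ?_).trans (hG j x hxG))
      obtain ⟨hyG, hy⟩ := Finset.mem_filter.1 hy
      exact Finset.mem_filter.2 ⟨hyG, by linarith [dist_triangle_left y x z]⟩
  have hz : ∀ i, ∀ z : X, ∑ j ∈ Finset.range K, ∑ x ∈ G j,
      (if j ≤ i ∧ dist z x ≤ 3 * A * (h₀ / 2 ^ j) then (h₀ / 2 ^ i) ^ 2 else 0) / (h₀ / 2 ^ j) ≤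
      2 * C₀ * (h₀ / 2 ^ i) := by
    intro i z
    have h1 : ∀ j, ∑ x ∈ G j,
        (if j ≤ i ∧ dist z x ≤ 3 * A * (h₀ / 2 ^ j) then (h₀ / 2 ^ i) ^ 2 else 0) / (h₀ / 2 ^ j) ≤
        if j ≤ i then C₀ * (h₀ / 2 ^ i) ^ 2 / h₀ * 2 ^ j else 0 := by
      intro j
      by_cases hji : j ≤ i
      · simp only [hji, true_and, if_true]
        rw [← Finset.sum_div, ← Finset.sum_filter, Finset.sum_const, nsmul_eq_mul]
        rw [div_div_eq_mul_div, mul_div_right_comm]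
        gcongr
        exact Nat.cast_le.1 (hcount j z)
      · simp [hji]
    refine (Finset.sum_le_sum fun j _ => h1 j).trans ?_
    rw [← Finset.sum_filter, ← Finset.mul_sum]
    have h2 : ∑ j ∈ (Finset.range K).filter (· ≤ i), (2 : ℝ) ^ j ≤ 2 ^ (i + 1) := by
      refine le_trans (Finset.sum_le_sum_of_subset_of_nonneg (fun j hj => ?_) fun _ _ _ =>
          by positivity)
        (sum_two_pow_le (i + 1))
      exact Finset.mem_range.2 (Nat.lt_succ_of_le (Finset.mem_filter.1 hj).2)
    refine (mul_le_mul_of_nonneg_left h2 (by positivity)).trans (le_of_eq ?_)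
    field_simp
    ring
  have hswap : ∑ j ∈ Finset.range K, ∑ x ∈ G j, escapeSum h₀ A bad K j x / (h₀ / 2 ^ j) =
      ∑ i ∈ Finset.range K, ∑ z ∈ bad i, ∑ j ∈ Finset.range K, ∑ x ∈ G j,
        (if j ≤ i ∧ dist z x ≤ 3 * A * (h₀ / 2 ^ j) then (h₀ / 2 ^ i) ^ 2 else 0) / (h₀ / 2 ^ j) := by
    simp only [escapeSum, Finset.sum_div]
    rw [Finset.sum_congr rfl fun j _ => Finset.sum_comm, Finset.sum_comm]
    refine Finset.sum_congr rfl fun i _ => ?_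
    rw [Finset.sum_congr rfl fun j _ => Finset.sum_comm, Finset.sum_comm]
  rw [hswap, Finset.mul_sum]
  refine Finset.sum_le_sum fun i _ => (Finset.sum_le_sum fun z _ => hz i z).trans (le_of_eq ?_)
  rw [Finset.sum_const, nsmul_eq_mul]
  ring

end EscapeSum

section Tail

variable {H : Type u} [NormedAddCommGroup H] [InnerProductSpace ℝ H]

lemma jonesBeta_closedBall_le_one [Nontrivial H] (Γ : Set H) (x : H) {r : ℝ} (hr : 0 ≤ r) :
    jonesBeta Γ (closedBall x r) ≤ 1 := by
  obtain ⟨v, hv⟩ := exists_ne (0 : H)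
  refine jonesBeta_le x v hv zero_le_one fun z hz => ?_
  rw [Metric.diam_closedBall_eq x hr]
  have h1 : dist z x ≤ r := hz.2
  have h2 := infDist_le_dist_of_mem (x := z) (show x ∈ lineThrough x v from ⟨0, by simp⟩)
  linarith

lemma jonesBeta_sq_mul_le [Nontrivial H] {Γ : Set H} {h₀ : ℝ} (hh₀ : 0 < h₀) {N : ℕ → Finset H}
    (hN : IsNetFamily Γ h₀ N) {A : ℝ} (hA : 240 ≤ A) {a b x : H} {j : ℕ}
    (ha : 3 * (64 * A * h₀) ≤ dist a x) (hb : 3 * (64 * A * h₀) ≤ dist b x) (K : ℕ) :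
    jonesBeta Γ (closedBall x (A * (h₀ / 2 ^ j))) ^ 2 * (h₀ / 2 ^ j) ≤
      64 * (arcDefect Γ x (64 * A * (h₀ / 2 ^ j)) (h₀ / 2 ^ j) ^ 2 / (h₀ / 2 ^ j) +
        escapeSum h₀ A (fun i => notFlat Γ a b (2 * (64 * A * h₀)) (16 * A * (h₀ / 2 ^ i)) (N i)) K
            j x /
          (h₀ / 2 ^ j) + (h₀ / 2 ^ K) ^ 2 / (h₀ / 2 ^ j)) := by
  set bad := fun i => notFlat Γ a b (2 * (64 * A * h₀)) (16 * A * (h₀ / 2 ^ i)) (N i) with hbad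
  set h := h₀ / 2 ^ j with hh
  have hp : 0 < h := by positivity
  set η := h₀ / 2 ^ K
  have hη : 0 < η := by positivity
  set δ := arcDefect Γ x (64 * A * h) h with hδ
  have hδ0 : 0 ≤ δ := arcDefect_nonneg _ _ _ _
  set S := escapeSum h₀ A bad K j x
  have hS : 0 ≤ S := escapeSum_nonneg _ _ _ _ _ _
  have hAh : 0 < A * h := by positivity
  have hβ0 : 0 ≤ jonesBeta Γ (closedBall x (A * h)) := jonesBeta_nonneg _ _
  rw [← add_div, ← add_div, ← mul_div_assoc 64, le_div_iff₀ hp, mul_assoc, ← sq, ← mul_pow]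
  by_cases hδh : h ≤ δ
  · have h1 : jonesBeta Γ (closedBall x (A * h)) * h ≤ δ := by
      have := mul_le_mul_of_nonneg_right (jonesBeta_closedBall_le_one Γ x hAh.le) hp.le
      linarith
    have h2 := pow_le_pow_left₀ (by positivity) h1 2
    nlinarith
  push Not at hδh
  obtain ⟨D, e, hD0, hD, hax⟩ := exists_isAxis_of_arcDefect_lt hp.le
    (lt_min (by linarith : δ < δ + η) hδh) (min_le_right _ _)
  have hD1 := hD.le.trans (min_le_left _ _)
  have hD2 := hD.le.trans (min_le_right _ _)
  set W := δ ^ 2 + S + η ^ 2 with hW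
  have hW0 : 0 ≤ W := by positivity
  have hd : ∀ y ∈ Γ, dist y x ≤ A * h →
      ‖y - x - (inner ℝ (y - x) e : ℝ) • e‖ ≤ 16 * A * Real.sqrt W := by
    intro y hy hyx
    have hkey : ∀ w, 0 ≤ w → w ^ 2 ≤ W →
        ‖y - x - (inner ℝ (y - x) e : ℝ) • e‖ ≤ 16 * A * w →
        ‖y - x - (inner ℝ (y - x) e : ℝ) • e‖ ≤ 16 * A * Real.sqrt W := fun w hw hwW h1 =>
      h1.trans (mul_le_mul_of_nonneg_left (Real.le_sqrt_of_sq_le hwW) (by positivity))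
    rcases norm_sub_axis_le hh₀ hN hA hD0 hD2 hax ha hb hy hyx K with h1 | h1 | ⟨i, hiK, hji, z, hz,
        hzx, h1⟩
    · refine hkey ((δ + η) / 2) (by positivity) (by nlinarith [sq_nonneg (δ - η)]) (h1.trans ?_)
      nlinarith
    · exact hkey η hη.le (by nlinarith) h1
    · refine hkey (h₀ / 2 ^ i) (by positivity) ?_ h1
      have : (h₀ / 2 ^ i) ^ 2 ≤ S := sq_le_escapeSum (bad := bad) hiK hji hz hzx
      nlinarith
  have hβ : jonesBeta Γ (closedBall x (A * h)) ≤ 8 * Real.sqrt W / h := by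
    refine jonesBeta_le x e (fun h0 => ?_) (by positivity) fun y hy => ?_
    · have := hax.norm_eq
      rw [h0, norm_zero] at this
      exact zero_ne_one this
    · rw [Metric.diam_closedBall_eq x hAh.le]
      have h1 := infDist_le_dist_of_mem (x := y)
        (show x + (inner ℝ (y - x) e : ℝ) • e ∈ lineThrough x e from ⟨_, rfl⟩)
      rw [dist_eq_norm, sub_add_eq_sub_sub] at h1
      refine (h1.trans (hd y hy.1 hy.2)).trans (le_of_eq ?_)
      field_simp
      ring
  rw [le_div_iff₀ hp] at hβ
  have h2 := pow_le_pow_left₀ (by positivity) hβ 2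
  rw [mul_pow 8, Real.sq_sqrt hW0] at h2
  linarith

lemma exists_bound_sum_jonesBeta [Nontrivial H] {f : ℝ → H} (hf : LipschitzWith 1 f) {L : ℝ}
    (hL : 0 ≤ L) {h₀ : ℝ} (hh₀ : 0 < h₀) {N : ℕ → Finset H} (hN : IsNetFamily (f '' Icc 0 L) h₀ N)
    (hbig : ∀ x ∈ f '' Icc 0 L, ∃ p ∈ f '' Icc 0 L, h₀ ≤ dist p x) {A : ℝ} (hA : 240 ≤ A) :
    ∃ C : ℝ, ∀ K, ∑ j ∈ Finset.range K,
      ∑ x ∈ (N j).filter fun x => 3 * (64 * A * h₀) ≤ dist (f 0) x ∧ 3 * (64 * A * h₀) ≤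
          dist (f L) x,
        jonesBeta (f '' Icc 0 L) (closedBall x (A * (h₀ / 2 ^ j))) ^ 2 * (h₀ / 2 ^ j) ≤ C := by
  have hA0 : 0 < A := by linarith
  obtain ⟨C₀, hC₀⟩ := exists_nat_ge (48 * (512 * A) + 6)
  obtain ⟨C₁, hC₁, h1⟩ := exists_bound_sum_crowded hf hL hh₀ hN hbig (by linarith : 1 ≤ 512 * A) hC₀
  obtain ⟨C₂, hC₂, h2⟩ := exists_bound_sum_arcDefect hf hL hh₀ (by linarith : 2 ≤ 64 * A) C₀
  obtain ⟨C₃, hC₃, h3⟩ := exists_bound_sum_not_isFlat hf hL hh₀ (by linarith : 3840 ≤ 16 * A) C₀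
  set Γ := f '' Icc 0 L with hΓ
  refine ⟨C₁ + 64 * (C₂ + 2 * C₀ * (C₁ + C₃) + 4 * L), fun K => ?_⟩
  let Cr : ℕ → Finset H := fun j => crowded (N j) (512 * A * (h₀ / 2 ^ j)) C₀
  let G : ℕ → Finset H := fun j => ((N j).filter fun x => 3 * (64 * A * h₀) ≤ dist (f 0) x ∧
    3 * (64 * A * h₀) ≤ dist (f L) x).filter fun x => x ∉ Cr j
  let bad : ℕ → Finset H := fun i =>
    notFlat Γ (f 0) (f L) (2 * (64 * A * h₀)) (16 * A * (h₀ / 2 ^ i)) (N i)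
  have hncr : ∀ j, ∀ x ∈ N j, x ∉ Cr j →
      ((N j).filter fun y => dist y x ≤ 512 * A * (h₀ / 2 ^ j)).card ≤ C₀ := by
    intro j x hx hxC
    by_contra! hcon
    exact hxC (Finset.mem_filter.2 ⟨hx, hcon⟩)
  have hGm : ∀ j, ∀ x ∈ G j, x ∈ N j ∧ 3 * (64 * A * h₀) ≤ dist (f 0) x ∧
      3 * (64 * A * h₀) ≤ dist (f L) x ∧ x ∉ Cr j := by
    intro j x hx
    obtain ⟨hx, hx'⟩ := Finset.mem_filter.1 hx
    obtain ⟨hx, hx1, hx2⟩ := Finset.mem_filter.1 hx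
    exact ⟨hx, hx1, hx2, hx'⟩
  have hAh : 0 < 64 * A * h₀ := by positivity
  have hbadsum : ∑ i ∈ Finset.range K, ((bad i).card : ℝ) * (h₀ / 2 ^ i) ≤ C₁ + C₃ := by
    have h3' := h3 (fun i => (bad i).filter fun x => x ∉ Cr i) (fun j x hx => ?_) K
    · refine le_trans (Finset.sum_le_sum fun i _ => ?_) ((Finset.sum_add_distrib (f := fun i =>
        ((Cr i).card : ℝ) * (h₀ / 2 ^ i))).le.trans (add_le_add (h1 K) h3'))
      rw [← add_mul]
      have : (bad i).card ≤ (Cr i).card + ((bad i).filter fun x => x ∉ Cr i).card := by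
        rw [← Finset.card_filter_add_card_filter_not (s := bad i) fun x => x ∈ Cr i]
        gcongr
        exact fun x hx => (Finset.mem_filter.1 hx).2
      have : ((bad i).card : ℝ) ≤ (Cr i).card + ((bad i).filter fun x => x ∉ Cr i).card := by
        exact_mod_cast this
      gcongr
    · obtain ⟨hx, hxC⟩ := Finset.mem_filter.1 hx
      obtain ⟨hxN, hx1, hx2, hx3⟩ := Finset.mem_filter.1 hx
      refine ⟨hN.mem j x hxN, by linarith, by linarith, ?_, hx3⟩
      refine (Finset.card_le_card fun y hy => ?_).trans (hncr j x hxN hxC)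
      obtain ⟨hy, hy'⟩ := Finset.mem_filter.1 hy
      exact Finset.mem_filter.2 ⟨(Finset.mem_filter.1 (Finset.mem_filter.1 hy).1).1, by linarith⟩
  have harc := h2 G (fun j x hx => by
    obtain ⟨hxN, hx1, hx2, hxC⟩ := hGm j x hx
    refine ⟨hN.mem j x hxN, by linarith, by linarith, ?_⟩
    refine (Finset.card_le_card fun y hy => ?_).trans (hncr j x hxN hxC)
    obtain ⟨hy, hy'⟩ := Finset.mem_filter.1 hy
    exact Finset.mem_filter.2 ⟨(hGm j y hy).1, by linarith⟩) K
  have hesc := (sum_escapeSum_div_le (A := A) hh₀ bad G (C₀ := C₀) (fun j x hx => by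
    obtain ⟨hxN, hx1, hx2, hxC⟩ := hGm j x hx
    have hAj : 0 < A * (h₀ / 2 ^ j) := by positivity
    refine (Finset.card_le_card fun y hy => ?_).trans (hncr j x hxN hxC)
    obtain ⟨hy, hy'⟩ := Finset.mem_filter.1 hy
    exact Finset.mem_filter.2 ⟨(hGm j y hy).1, by linarith⟩) K).trans
    (mul_le_mul_of_nonneg_left hbadsum (by positivity))
  have hlast : ∑ j ∈ Finset.range K, ∑ x ∈ G j, (h₀ / 2 ^ K) ^ 2 / (h₀ / 2 ^ j) ≤ 4 * L := by
    have hj : ∀ j ∈ Finset.range K, ∑ x ∈ G j, (h₀ / 2 ^ K) ^ 2 / (h₀ / 2 ^ j) ≤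
        4 * L / 2 ^ K * 2 ^ j := by
      intro j hj
      rw [Finset.sum_const, nsmul_eq_mul]
      have hc : ((G j).card : ℝ) * (h₀ / 2 ^ j) ≤ 4 * L :=
        (mul_le_mul_of_nonneg_right (Nat.cast_le.2 (Finset.card_le_card fun x hx => (hGm j x hx).1))
          (by positivity)).trans (card_mul_le_of_isNetFamily hf hL hh₀ hN hbig j)
      have hpow : (2 : ℝ) ^ j ≤ 2 ^ K := pow_le_pow_right₀ one_le_two (Finset.mem_range.1 hj).le
      calc ((G j).card : ℝ) * ((h₀ / 2 ^ K) ^ 2 / (h₀ / 2 ^ j))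
          = ((G j).card : ℝ) * (h₀ / 2 ^ j) * ((2 ^ j / 2 ^ K) * (2 ^ j / 2 ^ K)) := by
            field_simp
        _ ≤ 4 * L * ((2 ^ j / 2 ^ K) * 1) := by
            gcongr
            exact div_le_one_of_le₀ hpow (by positivity)
        _ = 4 * L / 2 ^ K * 2 ^ j := by ring
    refine (Finset.sum_le_sum hj).trans ?_
    rw [← Finset.mul_sum]
    refine (mul_le_mul_of_nonneg_left (sum_two_pow_le K) (by positivity)).trans (le_of_eq ?_)
    field_simp
  have hmain : ∀ j ∈ Finset.range K,
      ∑ x ∈ (N j).filter fun x => 3 * (64 * A * h₀) ≤ dist (f 0) x ∧ 3 * (64 * A * h₀) ≤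
          dist (f L) x,
        jonesBeta Γ (closedBall x (A * (h₀ / 2 ^ j))) ^ 2 * (h₀ / 2 ^ j) ≤
      ((Cr j).card : ℝ) * (h₀ / 2 ^ j) +
        64 * (∑ x ∈ G j, arcDefect Γ x (64 * A * (h₀ / 2 ^ j)) (h₀ / 2 ^ j) ^ 2 / (h₀ / 2 ^ j) +
          ∑ x ∈ G j, escapeSum h₀ A bad K j x / (h₀ / 2 ^ j) +
          ∑ x ∈ G j, (h₀ / 2 ^ K) ^ 2 / (h₀ / 2 ^ j)) := by
    intro j _
    rw [← Finset.sum_filter_add_sum_filter_not _ fun x => x ∈ Cr j]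
    refine add_le_add ?_ ?_
    · rw [← nsmul_eq_mul, ← Finset.sum_const]
      refine (Finset.sum_le_sum fun x _ => ?_).trans (Finset.sum_le_sum_of_subset_of_nonneg
        (fun x hx => (Finset.mem_filter.1 hx).2) fun _ _ _ => by positivity)
      have := pow_le_one₀ (n := 2) (jonesBeta_nonneg _ _)
        (jonesBeta_closedBall_le_one Γ x (by positivity : 0 ≤ A * (h₀ / 2 ^ j)))
      exact mul_le_of_le_one_left (by positivity) this
    · rw [← Finset.sum_add_distrib, ← Finset.sum_add_distrib, Finset.mul_sum]
      refine Finset.sum_le_sum fun x hx => ?_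
      obtain ⟨-, hx1, hx2, -⟩ := hGm j x hx
      exact jonesBeta_sq_mul_le hh₀ hN hA hx1 hx2 K
  refine (Finset.sum_le_sum hmain).trans ?_
  rw [Finset.sum_add_distrib, ← Finset.mul_sum, Finset.sum_add_distrib, Finset.sum_add_distrib]
  have := h1 K
  have : ∑ j ∈ Finset.range K, ((Cr j).card : ℝ) * (h₀ / 2 ^ j) ≤ C₁ := this
  linarith

end Tail

section Separated

variable {X : Type*} [MetricSpace X]

lemma exists_hop {Γ : Set X} (hΓ : IsPreconnected Γ) {ε : ℝ} {V W : Finset X}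
    (hVΓ : (V : Set X) ⊆ Γ)
    (hnet : ∀ p ∈ Γ, ∃ x ∈ V, dist p x ≤ ε) (hWV : W ⊆ V) (hW : W.Nonempty) (hW' : W ≠ V)
    (hε : 0 ≤ ε) : ∃ a ∈ W, ∃ b ∈ V, b ∉ W ∧ dist a b ≤ 2 * ε := by
  obtain ⟨w, hw⟩ := hW
  obtain ⟨z, hzV, hzW⟩ : ∃ z ∈ V, z ∉ W := by
    by_contra! hcon
    exact hW' (hWV.antisymm hcon)
  have hcl : ∀ S : Finset X, IsClosed (⋃ a ∈ S, closedBall a ε) := fun S =>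
    S.finite_toSet.isClosed_biUnion fun _ _ => isClosed_closedBall
  obtain ⟨p, hpΓ, hp1, hp2⟩ := isPreconnected_closed_iff.1 hΓ _ _ (hcl W) (hcl (V \ W))
    (fun p hp => by
      obtain ⟨x, hx, hpx⟩ := hnet p hp
      by_cases hxW : x ∈ W
      · exact .inl (Set.mem_biUnion hxW hpx)
      · exact .inr (Set.mem_biUnion (Finset.mem_coe.2 (Finset.mem_sdiff.2 ⟨hx, hxW⟩)) hpx))
    ⟨w, hVΓ (hWV hw), Set.mem_biUnion hw (mem_closedBall_self hε)⟩
    ⟨z, hVΓ hzV, Set.mem_biUnion (Finset.mem_coe.2 (Finset.mem_sdiff.2 ⟨hzV, hzW⟩))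
      (mem_closedBall_self hε)⟩
  obtain ⟨a, ha, hpa⟩ := Set.mem_iUnion₂.1 hp1
  obtain ⟨b, hb, hpb⟩ := Set.mem_iUnion₂.1 hp2
  obtain ⟨hbV, hbW⟩ := Finset.mem_sdiff.1 hb
  have h1 : dist p a ≤ ε := hpa
  have h2 : dist p b ≤ ε := hpb
  exact ⟨a, ha, b, hbV, hbW, by linarith [dist_triangle_left a b p]⟩

lemma exists_forall_le_dist (F : Finset X) {d : ℝ} (hd : 0 < d) :
    ∃ ε, 0 < ε ∧ ε ≤ d ∧ ∀ x ∈ F, ∀ y ∈ F, x ≠ y → ε ≤ dist x y := by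
  obtain ⟨e, he, hmin⟩ := (insert d (F.offDiag.image fun e => dist e.1 e.2)).exists_min_image id
    ⟨d, Finset.mem_insert_self _ _⟩
  refine ⟨e, ?_, hmin d (Finset.mem_insert_self _ _), fun x hx y hy hxy => hmin _
    (Finset.mem_insert_of_mem (Finset.mem_image.2 ⟨(x, y), Finset.mem_offDiag.2 ⟨hx, hy, hxy⟩,
        rfl⟩))⟩
  rcases Finset.mem_insert.1 he with rfl | he
  · exact hd
  · obtain ⟨e', he', rfl⟩ := Finset.mem_image.1 he
    exact dist_pos.2 (Finset.mem_offDiag.1 he').2.2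

lemma exists_far_of_dist {Γ : Set X} {p q : X} (hp : p ∈ Γ) (hq : q ∈ Γ) {r : ℝ}
    (hr : 2 * r ≤ dist p q) (x : X) : ∃ y ∈ Γ, r ≤ dist y x := by
  by_contra! hcon
  linarith [hcon p hp, hcon q hq, dist_triangle_right p q x]

variable [MeasurableSpace X] [BorelSpace X]

lemma le_hausdorffMeasure_inter_closedBall {Γ : Set X} (hΓ : IsPreconnected Γ) {x p : X}
    (hx : x ∈ Γ)
    (hp : p ∈ Γ) {r : ℝ} (hr : r ≤ dist p x) : ENNReal.ofReal r ≤ μH[1] (Γ ∩ closedBall x r) := by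
  have h1 := measure_mono (μ := (μH[1] : Measure ℝ)) (Icc_subset_dist_image hΓ hx hp hr)
  rw [hausdorffMeasure_real, Real.volume_Icc, sub_zero, ← hausdorffMeasure_real] at h1
  have h2 := (LipschitzWith.dist_left x).hausdorffMeasure_image_le (d := 1) zero_le_one
    (Γ ∩ closedBall x r)
  rw [ENNReal.coe_one, ENNReal.one_rpow, one_mul] at h2
  exact h1.trans h2

lemma card_mul_le_hausdorffMeasure {Γ : Set X} (hc : IsCompact Γ) (hΓ : IsPreconnected Γ)
    (hfin : μH[1] Γ < ⊤) {ε : ℝ} (hε : 0 < ε) (hbig : ∀ x ∈ Γ, ∃ p ∈ Γ, ε ≤ dist p x) {V : Finset X}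
    (hV : (V : Set X) ⊆ Γ) (hsep : ∀ x ∈ V, ∀ y ∈ V, x ≠ y → ε ≤ dist x y) :
    (V.card : ℝ) * (ε / 4) ≤ (μH[1] Γ).toReal := by
  have h1 : ENNReal.ofReal (V.card * (ε / 4)) ≤ μH[1] Γ := by
    calc ENNReal.ofReal (V.card * (ε / 4)) = ∑ x ∈ V, ENNReal.ofReal (ε / 4) := by
          rw [Finset.sum_const, nsmul_eq_mul, ENNReal.ofReal_mul (Nat.cast_nonneg _),
            ENNReal.ofReal_natCast]
      _ ≤ ∑ x ∈ V, μH[1] (Γ ∩ closedBall x (ε / 4)) := by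
          refine Finset.sum_le_sum fun x hx => ?_
          obtain ⟨p, hp, hpx⟩ := hbig x (hV hx)
          exact le_hausdorffMeasure_inter_closedBall hΓ (hV hx) hp (by linarith)
      _ = μH[1] (⋃ x ∈ V, Γ ∩ closedBall x (ε / 4)) := by
          refine (measure_biUnion_finset (fun x hx y hy hxy => ?_) fun x _ =>
            (hc.isClosed.inter isClosed_closedBall).measurableSet).symm
          refine Set.disjoint_left.2 fun z hz hz' => ?_
          have h2 : dist z x ≤ ε / 4 := hz.2
          have h3 : dist z y ≤ ε / 4 := hz'.2
          have := dist_triangle_left x y z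
          have := hsep x hx y hy hxy
          linarith
      _ ≤ μH[1] Γ := measure_mono (Set.iUnion₂_subset fun _ _ => inter_subset_left)
  exact (ENNReal.ofReal_le_iff_le_toReal hfin.ne).1 h1

lemma exists_maximal_net {Γ : Set X} (hc : IsCompact Γ) (hΓ : IsPreconnected Γ)
    (hfin : μH[1] Γ < ⊤) {ε : ℝ} (hε : 0 < ε) (hbig : ∀ x ∈ Γ, ∃ p ∈ Γ, ε ≤ dist p x) {Y : Set X}
    (hY : Y ⊆ Γ) (hsep : ∀ x ∈ Y, ∀ y ∈ Y, x ≠ y → ε ≤ dist x y) :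
    ∃ V : Finset X, Y ⊆ V ∧ (V : Set X) ⊆ Γ ∧ (∀ x ∈ V, ∀ y ∈ V, x ≠ y → ε ≤ dist x y) ∧
      ∀ p ∈ Γ, ∃ x ∈ V, dist p x ≤ ε := by
  obtain ⟨M, hM⟩ := exists_nat_ge ((μH[1] Γ).toReal / (ε / 4))
  have hcard : ∀ V : Finset X, (V : Set X) ⊆ Γ → (∀ x ∈ V, ∀ y ∈ V, x ≠ y → ε ≤ dist x y) →
      V.card ≤ M := fun V h1 h2 => by
    have h3 := card_mul_le_hausdorffMeasure hc hΓ hfin hε hbig h1 h2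
    rw [← le_div_iff₀ (by positivity)] at h3
    exact_mod_cast h3.trans hM
  have hYfin : Y.Finite := by
    by_contra hinf
    obtain ⟨T, hT, hTc⟩ := Set.Infinite.exists_subset_card_eq hinf (M + 1)
    have := hcard T (hT.trans hY) fun x hx y hy => hsep x (hT hx) y (hT hy)
    omega
  let S : Set ℕ := {n | ∃ V : Finset X, V.card = n ∧ Y ⊆ V ∧ (V : Set X) ⊆ Γ ∧
    ∀ x ∈ V, ∀ y ∈ V, x ≠ y → ε ≤ dist x y}
  have hS : S.Nonempty := ⟨_, hYfin.toFinset, rfl, by simp, by simpa using hY, by simpa using hsep⟩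
  have hSb : BddAbove S := ⟨M, by rintro n ⟨V, rfl, -, h1, h2⟩; exact hcard V h1 h2⟩
  obtain ⟨V, hVc, hYV, hVΓ, hVs⟩ := Nat.sSup_mem hS hSb
  refine ⟨V, hYV, hVΓ, hVs, fun p hp => ?_⟩
  by_contra! hcon
  have hpV : p ∉ V := fun h => by
    have := hcon p h
    rw [dist_self] at this
    linarith
  have : (insert p V).card ≤ sSup S := by
    refine le_csSup hSb ⟨insert p V, rfl, hYV.trans (by simp), ?_, ?_⟩
    · rw [Finset.coe_insert]
      exact Set.insert_subset hp hVΓ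
    · intro x hx y hy hxy
      rcases Finset.mem_insert.1 hx with rfl | hx' <;> rcases Finset.mem_insert.1 hy with rfl | hy'
      · exact absurd rfl hxy
      · exact (hcon y hy').le
      · rw [dist_comm]
        exact (hcon x hx').le
      · exact hVs x hx' y hy' hxy
  rw [Finset.card_insert_of_notMem hpV, ← hVc] at this
  omega

lemma exists_pathLen_le_hausdorffMeasure {Γ : Set X} (hc : IsCompact Γ) (hΓ : IsPreconnected Γ)
    (hfin : μH[1] Γ < ⊤) {ε : ℝ} (hε : 0 < ε) (hbig : ∀ x ∈ Γ, ∃ p ∈ Γ, ε ≤ dist p x) {F : Finset X}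
    (hF : (F : Set X) ⊆ Γ) (hsep : ∀ x ∈ F, ∀ y ∈ F, x ≠ y → ε ≤ dist x y) (hne : Γ.Nonempty) :
    ∃ l : List X, (∀ x ∈ F, x ∈ l) ∧ pathLen l ≤ 16 * (μH[1] Γ).toReal := by
  obtain ⟨V, hFV, hVΓ, hVs, hnet⟩ := exists_maximal_net hc hΓ hfin hε hbig hF hsep
  obtain ⟨p, hp⟩ := hne
  obtain ⟨x₀, hx₀, -⟩ := hnet p hp
  let G := (V ×ˢ V).filter fun e => dist e.1 e.2 ≤ 2 * ε
  let R : X → X → Prop := fun a b => (a, b) ∈ G ∨ (b, a) ∈ G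
  let W := V.filter fun z => Relation.ReflTransGen R x₀ z
  have hWV : W = V := by
    by_contra hW
    obtain ⟨a, ha, b, hb, hbW, hab⟩ := exists_hop hΓ hVΓ hnet (Finset.filter_subset _ _)
      ⟨x₀, Finset.mem_filter.2 ⟨hx₀, .refl⟩⟩ hW hε.le
    obtain ⟨haV, har⟩ := Finset.mem_filter.1 ha
    exact hbW (Finset.mem_filter.2 ⟨hb, har.tail
      (.inl (Finset.mem_filter.2 ⟨Finset.mem_product.2 ⟨haV, hb⟩, hab⟩))⟩)
  obtain ⟨l, T, hT, hl⟩ := exists_tour G x₀ V fun z hz =>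
    (Finset.mem_filter.1 (hWV.symm ▸ hz : z ∈ W)).2
  refine ⟨l, fun x hx => hl x (hFV hx), hT.len.trans ?_⟩
  have hlV : l.toFinset ⊆ V := by
    intro x hx
    have hr := hT.reach x (List.mem_toFinset.1 hx)
    induction hr with
    | refl => exact hx₀
    | tail _ h _ =>
      rcases h with h | h
      · exact (Finset.mem_product.1 (Finset.mem_filter.1 h).1).2
      · exact (Finset.mem_product.1 (Finset.mem_filter.1 h).1).1
  have h1 : (T.card : ℝ) ≤ V.card := by
    have := hT.card.trans (Finset.card_le_card hlV)
    exact_mod_cast (Nat.le_succ _).trans this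
  have h2 : ∑ e ∈ T, dist e.1 e.2 ≤ T.card * (2 * ε) := by
    rw [← nsmul_eq_mul]
    exact Finset.sum_le_card_nsmul _ _ _ fun e he => (Finset.mem_filter.1 (hT.subset he)).2
  have h3 := card_mul_le_hausdorffMeasure hc hΓ hfin hε hbig hVΓ hVs
  have h4 := mul_le_mul_of_nonneg_right h1 hε.le
  linarith

end Separated

section Curve

variable {H : Type u} [NormedAddCommGroup H] [InnerProductSpace ℝ H] [MeasurableSpace H]
    [BorelSpace H]

lemma IsRectifiableCurve.exists_lipschitz [CompleteSpace H] {Γ : Set H} (h : IsRectifiableCurve Γ)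
    (hnt : Γ.Nontrivial) : ∃ L, 0 ≤ L ∧ ∃ f : ℝ → H, LipschitzWith 1 f ∧ Γ ⊆ f '' Icc 0 L := by
  obtain ⟨⟨g, hg, hgΓ⟩, hfin⟩ := h
  obtain ⟨p, hp, q, hq, hpq⟩ := hnt
  have hc : IsCompact Γ := hgΓ ▸ isCompact_Icc.image_of_continuousOn hg
  have hconn : IsPreconnected Γ := hgΓ ▸ isPreconnected_Icc.image _ hg
  refine ⟨_, exists_lipschitz_curve ⟨p, hp⟩ (L := 16 * (μH[1] Γ).toReal) fun F hF => ?_⟩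
  obtain ⟨ε, hε, hεd, hsep⟩ := exists_forall_le_dist F (half_pos (dist_pos.2 hpq))
  exact exists_pathLen_le_hausdorffMeasure hc hconn hfin hε
    (fun x _ => exists_far_of_dist hp hq (by linarith) x) hF hsep ⟨p, hp⟩

end Curve

section Necessity

variable {H : Type u} [NormedAddCommGroup H] [InnerProductSpace ℝ H]

lemma LipschitzWith.exists_extension_far [Nontrivial H] {g : ℝ → H} (hg : LipschitzWith 1 g) {L : ℝ}
    (hL : 0 ≤ L) : ∃ (L' : ℝ) (f : ℝ → H), 0 ≤ L' ∧ LipschitzWith 1 f ∧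
      g '' Icc 0 L ⊆ f '' Icc 0 L' ∧
      ∀ x ∈ g '' Icc 0 L, 1 ≤ dist (f 0) x ∧ 1 ≤ dist (f L') x := by
  obtain ⟨e, he⟩ := exists_norm_eq H (zero_le_one (α := ℝ))
  set S := L + 1 with hS
  let c : ℝ → ℝ := fun t => max 0 (min (t - S) L)
  let φ : ℝ → ℝ := fun t => |t - S - c t|
  let f : ℝ → H := fun t => g (c t) + φ t • e
  have hf0 : f 0 = g 0 + S • e := by
    have h1 : c 0 = 0 := max_eq_left ((min_le_left _ _).trans (by linarith))
    have h2 : φ 0 = S := by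
      simp only [φ, h1]
      rw [zero_sub, sub_zero, abs_neg, abs_of_pos (by linarith)]
    simp only [f, h1, h2]
  have hfL : f (L + 2 * S) = g L + S • e := by
    have h1 : c (L + 2 * S) = L := by
      simp only [c]
      rw [min_eq_right (by linarith), max_eq_right hL]
    have h2 : φ (L + 2 * S) = S := by
      simp only [φ, h1]
      rw [show L + 2 * S - S - L = S by ring, abs_of_pos (by linarith)]
    simp only [f, h1, h2]
  have hfar : ∀ s ∈ Icc (0 : ℝ) L, ∀ t ∈ Icc (0 : ℝ) L, 1 ≤ dist (g s + S • e) (g t) := by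
    intro s hs t ht
    have h1 := hg.dist_le_mul s t
    rw [NNReal.coe_one, one_mul, Real.dist_eq] at h1
    have h2 : |s - t| ≤ L := abs_le.2 ⟨by linarith [hs.1, ht.2], by linarith [hs.2, ht.1]⟩
    have h3 := dist_triangle_right (g s + S • e) (g s) (g t)
    have h4 := dist_triangle_left (g s + S • e) (g s) (g t)
    rw [dist_comm (g t)] at h4
    have h5 : dist (g s + S • e) (g s) = S := by
      rw [dist_eq_norm, add_sub_cancel_left, norm_smul, he, mul_one, Real.norm_eq_abs,
        abs_of_pos (by linarith)]
    rw [dist_comm (g t)] at h4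
    linarith
  refine ⟨L + 2 * S, f, by linarith, LipschitzWith.of_dist_le_mul fun s t => ?_, ?_, ?_⟩
  · rw [NNReal.coe_one, one_mul]
    have h1 := hg.dist_le_mul (c s) (c t)
    rw [NNReal.coe_one, one_mul] at h1
    have h2 : dist (f s) (f t) ≤ dist (c s) (c t) + |φ s - φ t| := by
      refine (dist_add_add_le _ _ _ _).trans (add_le_add h1 (le_of_eq ?_))
      rw [dist_eq_norm, ← sub_smul, norm_smul, he, mul_one, Real.norm_eq_abs]
    refine h2.trans ?_
    rw [Real.dist_eq, Real.dist_eq]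
    simp only [φ, c]
    grind
  · rintro _ ⟨t, ht, rfl⟩
    refine ⟨t + S, ⟨by linarith [ht.1], by linarith [ht.2]⟩, ?_⟩
    have h1 : c (t + S) = t := by
      simp only [c]
      rw [add_sub_cancel_right, min_eq_left ht.2, max_eq_right ht.1]
    simp only [f, φ, h1, add_sub_cancel_right, sub_self, abs_zero, zero_smul, add_zero]
  · rintro _ ⟨t, ht, rfl⟩
    rw [hf0, hfL]
    exact ⟨hfar 0 ⟨le_rfl, hL⟩ t ht, hfar L ⟨hL, le_rfl⟩ t ht⟩

lemma jonesBeta_mono {E Γ Q : Set H} (hE : E ⊆ Γ) (hQ : IsBounded Q) (hd : 0 < Metric.diam Q) :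
    jonesBeta E Q ≤ jonesBeta Γ Q := by
  by_cases hE0 : E ∩ Q = ∅
  · rw [jonesBeta, if_pos hE0]
    exact jonesBeta_nonneg _ _
  have hΓ0 : (Γ ∩ Q).Nonempty :=
    (Set.nonempty_iff_ne_empty.2 hE0).mono (Set.inter_subset_inter_left _ hE)
  conv_rhs => rw [jonesBeta, if_neg hΓ0.ne_empty]
  obtain ⟨x, hx⟩ := hΓ0
  by_cases hH : ∃ v : H, v ≠ 0
  · obtain ⟨v, hv⟩ := hH
    refine le_csInf ⟨_, x, v, hv, rfl⟩ ?_
    rintro r ⟨a, w, hw, rfl⟩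
    have hbdd : BddAbove ((fun x => infDist x (lineThrough a w) / Metric.diam Q) '' (Γ ∩ Q)) := by
      obtain ⟨R, hR⟩ := hQ.subset_closedBall a
      refine ⟨R / Metric.diam Q, ?_⟩
      rintro _ ⟨y, hy, rfl⟩
      simp only
      gcongr
      exact (infDist_le_dist_of_mem (show a ∈ lineThrough a w from ⟨0, by simp⟩)).trans (hR hy.2)
    have hle : ∀ y ∈ Γ ∩ Q, infDist y (lineThrough a w) / Metric.diam Q ≤
        sSup ((fun x => infDist x (lineThrough a w) / Metric.diam Q) '' (Γ ∩ Q)) :=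
      fun y hy => le_csSup hbdd (Set.mem_image_of_mem _ hy)
    refine jonesBeta_le a w hw ((div_nonneg infDist_nonneg hd.le).trans (hle x hx)) fun z hz => ?_
    exact (div_le_iff₀ hd).1 (hle z ⟨hE hz.1, hz.2⟩)
  · push Not at hH
    rw [jonesBeta, if_neg hE0]
    refine le_of_eq ?_
    congr 1
    ext r
    constructor
    · rintro ⟨a, v, hv, -⟩
      exact absurd (hH v) hv
    · rintro ⟨a, v, hv, -⟩
      exact absurd (hH v) hv

lemma tsum_int_eq_add (l : ℤ) (g : ℤ → ℝ≥0∞) :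
    ∑' k, g k = ∑' n : ℕ, g (l + n) + ∑' n : ℕ, g (l - (n + 1)) := by
  rw [← (Equiv.addLeft l).tsum_eq, tsum_of_nat_of_neg_add_one ENNReal.summable ENNReal.summable]
  rfl

lemma tsum_tsum_finite_le {N : ℤ → Set H} (E : Set H) {A : ℝ} {k : ℤ} {F : Finset H} (hF : N k ⊆ F)
    {c : ℝ}
    (hc : ∑ x ∈ F.filter fun x => x ∈ N k, jonesBeta E (closedBall x (A * (2 : ℝ) ^ (-k))) ^ 2 *
      Metric.diam (closedBall x (A * (2 : ℝ) ^ (-k))) ≤ c) :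
    ∑' x : N k, ENNReal.ofReal (jonesBeta E (closedBall (x : H) (A * (2 : ℝ) ^ (-k))) ^ (2 : ℝ) *
      Metric.diam (closedBall (x : H) (A * (2 : ℝ) ^ (-k)))) ≤ ENNReal.ofReal c := by
  have hset : N k = ((F.filter fun x => x ∈ N k : Finset H) : Set H) := by
    ext x
    simp only [Finset.coe_filter, Set.mem_ofPred_eq]
    exact ⟨fun h => ⟨hF h, h⟩, fun h => h.2⟩
  refine le_trans (le_of_eq ?_) (ENNReal.ofReal_le_ofReal hc)
  rw [ENNReal.ofReal_sum_of_nonneg fun _ _ => by positivity, sum_eq_tsum_indicator, ← hset,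
    tsum_subtype (N k) fun x => ENNReal.ofReal (jonesBeta E (closedBall x (A * (2 : ℝ) ^ (-k))) ^
      (2 : ℝ) * Metric.diam (closedBall x (A * (2 : ℝ) ^ (-k))))]
  simp only [Real.rpow_two]

lemma jonesBeta_mul_diam_le [Nontrivial H] {E : Set H} (hE : IsBounded E) (Q : Set H) :
    jonesBeta E Q * Metric.diam Q ≤ Metric.diam E := by
  by_cases hE0 : E ∩ Q = ∅
  · rw [jonesBeta, if_pos hE0, zero_mul]
    exact diam_nonneg
  obtain ⟨y, hy⟩ := Set.nonempty_iff_ne_empty.2 hE0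
  rcases diam_nonneg.eq_or_lt' (a := Metric.diam Q) with h0 | h0
  · rw [h0, mul_zero]
    exact diam_nonneg
  obtain ⟨v, hv⟩ := exists_ne (0 : H)
  rw [← le_div_iff₀ h0]
  refine jonesBeta_le y v hv (by positivity) fun z hz => ?_
  rw [div_mul_cancel₀ _ h0.ne']
  exact (infDist_le_dist_of_mem (show y ∈ lineThrough y v from ⟨0, by simp⟩)).trans
    (dist_le_diam_of_mem hE hz.1 hy.1)

lemma betaSum_eq_zero_of_subsingleton {E : Set H} (hE : E.Subsingleton) (net : ℤ → Set H) (A : ℝ) :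
    betaSum E net A 2 = 0 := by
  have h : ∀ Q : Set H, jonesBeta E Q ^ (2 : ℝ) * Metric.diam Q = 0 := by
    intro Q
    rcases subsingleton_or_nontrivial H with hH | hH
    · rw [diam_subsingleton Q.subsingleton_of_subsingleton, mul_zero]
    · rcases diam_nonneg.eq_or_lt' (a := Metric.diam Q) with h0 | h0
      · rw [h0, mul_zero]
      · have h1 := jonesBeta_mul_diam_le hE.finite.isBounded Q
        rw [diam_subsingleton hE] at h1
        have h2 : jonesBeta E Q = 0 := le_antisymm (by nlinarith) (jonesBeta_nonneg _ _)
        rw [h2, Real.zero_rpow two_ne_zero, zero_mul]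
  simp only [betaSum, h, ENNReal.ofReal_zero, tsum_zero]

lemma betaSum_lt_top_of_subset [CompleteSpace H] [MeasurableSpace H] [BorelSpace H] {A : ℝ}
    (hA : 240 ≤ A) {E Γ₀ : Set H} {net : ℤ → Set H} (hE : IsBounded E)
    (hnet : IsMultiresolution E net) (hEΓ : E ⊆ Γ₀) (hΓ₀ : IsRectifiableCurve Γ₀) :
    betaSum E net A 2 < ⊤ := by
  rcases Set.subsingleton_or_nontrivial E with hs | hnt
  · rw [betaSum_eq_zero_of_subsingleton hs]
    exact ENNReal.zero_lt_top
  have : Nontrivial H := by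
    obtain ⟨x, -, y, -, hxy⟩ := hnt
    exact ⟨x, y, hxy⟩
  obtain ⟨L₀, hL₀, g, hg, hΓg⟩ := hΓ₀.exists_lipschitz (hnt.mono hEΓ)
  obtain ⟨L, f, hL, hf, hgf, hfar⟩ := hg.exists_extension_far hL₀
  set Γ := f '' Icc 0 L with hΓ
  have hEΓ' : E ⊆ Γ := (hEΓ.trans hΓg).trans hgf
  have hfar' : ∀ x ∈ E, 1 ≤ dist (f 0) x ∧ 1 ≤ dist (f L) x := fun x hx =>
    hfar x (hΓg (hEΓ hx))
  have hc : IsCompact Γ := isCompact_Icc.image hf.continuous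
  have hpre : IsPreconnected Γ := isPreconnected_Icc.image f hf.continuous.continuousOn
  have hfin : μH[1] Γ < ⊤ := (hausdorffMeasure_image_Icc_le hf hL).1.2
  obtain ⟨l, hl⟩ := pow_unbounded_of_one_lt (3 * (64 * A)) (one_lt_two (α := ℝ))
  set h₀ : ℝ := (2 : ℝ) ^ (-(l : ℤ)) with hh₀
  have hpos : 0 < h₀ := by positivity
  have hh₀l : 3 * (64 * A * h₀) ≤ 1 := by
    rw [hh₀, zpow_neg, zpow_natCast, ← mul_assoc, ← div_eq_mul_inv, div_le_one (by positivity)]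
    exact hl.le
  have hh₀1 : 2 * h₀ ≤ 1 := by nlinarith
  have hscale : ∀ j : ℕ, (2 : ℝ) ^ (-((l : ℤ) + j)) = h₀ / 2 ^ j := by
    intro j
    rw [hh₀, neg_add, zpow_add₀ two_ne_zero, zpow_neg _ (j : ℤ), zpow_natCast, div_eq_mul_inv]
  obtain ⟨e₀, he₀⟩ := hnt.nonempty
  have hbig : ∀ x ∈ Γ, ∃ p ∈ Γ, h₀ ≤ dist p x := fun x _ =>
    exists_far_of_dist (Set.mem_image_of_mem f (Set.left_mem_Icc.2 hL)) (hEΓ' he₀)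
      (hh₀1.trans (hfar' e₀ he₀).1) x
  have hnets : ∀ j : ℕ, ∃ V : Finset H, net (l + j) ⊆ V ∧ (V : Set H) ⊆ Γ ∧
      (∀ x ∈ V, ∀ y ∈ V, x ≠ y → h₀ / 2 ^ j ≤ dist x y) ∧ ∀ p ∈ Γ, ∃ x ∈ V, dist p x ≤ h₀ / 2 ^ j := by
    intro j
    refine exists_maximal_net hc hpre hfin (by positivity) (fun x hx => ?_)
      ((hnet.1.1 _).trans hEΓ') fun x hx y hy hxy => ?_
    · obtain ⟨p, hp, hxp⟩ := hbig x hx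
      exact ⟨p, hp, (div_le_self hpos.le (one_le_pow₀ one_le_two)).trans hxp⟩
    · rw [← hscale]
      exact hnet.1.2.2 _ x hx y hy hxy
  choose N hNnet hNΓ hNsep hNnear using hnets
  have hN : IsNetFamily Γ h₀ N := ⟨fun j x hx => hNΓ j hx, hNsep, hNnear⟩
  obtain ⟨C, hC⟩ := exists_bound_sum_jonesBeta hf hL hpos hN hbig hA
  have hdiam : ∀ (x : H) {r : ℝ}, 0 ≤ r → Metric.diam (closedBall x r) = 2 * r := fun x r hr =>
    Metric.diam_closedBall_eq x hr
  rw [betaSum, tsum_int_eq_add (l : ℤ)]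
  refine ENNReal.add_lt_top.2 ⟨?_, ?_⟩
  · set c : ℕ → ℝ := fun j => ∑ x ∈ (N j).filter fun x =>
      3 * (64 * A * h₀) ≤ dist (f 0) x ∧ 3 * (64 * A * h₀) ≤ dist (f L) x,
        jonesBeta Γ (closedBall x (A * (h₀ / 2 ^ j))) ^ 2 * (h₀ / 2 ^ j) with hcdef
    have hc0 : ∀ j, 0 ≤ c j := fun j => Finset.sum_nonneg fun x _ => by positivity
    refine lt_of_le_of_lt (ENNReal.tsum_le_tsum fun j =>
      tsum_tsum_finite_le E (hNnet j) (c := 2 * A * c j) ?_) ?_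
    · rw [hcdef, Finset.mul_sum]
      refine (Finset.sum_le_sum (g := fun x => 2 * A *
        (jonesBeta Γ (closedBall x (A * (h₀ / 2 ^ j))) ^ 2 * (h₀ / 2 ^ j))) fun x _ => ?_).trans
        (Finset.sum_le_sum_of_subset_of_nonneg (fun x hx => ?_) fun x _ _ => by positivity)
      · rw [hscale, hdiam x (by positivity)]
        have h1 := jonesBeta_mono hEΓ' (Q := closedBall x (A * (h₀ / 2 ^ j))) isBounded_closedBall
          (by rw [hdiam x (by positivity)]; positivity)
        have h2 := jonesBeta_nonneg E (closedBall x (A * (h₀ / 2 ^ j)))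
        calc _ = 2 * A * (jonesBeta E (closedBall x (A * (h₀ / 2 ^ j))) ^ 2 * (h₀ / 2 ^ j)) := by
              ring
          _ ≤ _ := by gcongr
      · rw [Finset.mem_filter] at hx ⊢
        have hxE := hfar' x (hnet.1.1 _ hx.2)
        exact ⟨hx.1, hh₀l.trans hxE.1, hh₀l.trans hxE.2⟩
    · refine lt_of_le_of_lt (b := ENNReal.ofReal (2 * A * C)) ?_ ENNReal.ofReal_lt_top
      rw [ENNReal.tsum_eq_iSup_nat]
      refine iSup_le fun K => ?_
      rw [← ENNReal.ofReal_sum_of_nonneg fun j _ => mul_nonneg (by positivity) (hc0 j),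
        ← Finset.mul_sum]
      exact ENNReal.ofReal_le_ofReal (mul_le_mul_of_nonneg_left (hC K) (by positivity))
  · set D := Metric.diam E with hD
    set M : ℝ := (N 0).card * (D ^ 2 / (2 * A * h₀)) with hM
    refine lt_of_le_of_lt (ENNReal.tsum_le_tsum fun n => tsum_tsum_finite_le E (F := N 0)
      (c := M * (1 / 2) ^ n) ?_ ?_) ?_
    · refine (monotone_int_of_le_succ hnet.1.2.1 ?_).trans (hNnet 0)
      simp only [Nat.cast_zero]
      linarith
    · set r : ℝ := A * (2 : ℝ) ^ (-((l : ℤ) - (n + 1))) with hr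
      have hr0 : 0 < r := by positivity
      have hrh : A * h₀ * 2 ^ n ≤ r := by
        have : (2 : ℝ) ^ (-((l : ℤ) - (n + 1))) = h₀ * 2 ^ n * 2 := by
          rw [hh₀, show -((l : ℤ) - (n + 1)) = -l + n + 1 by ring, zpow_add₀ two_ne_zero,
            zpow_add₀ two_ne_zero, zpow_natCast, zpow_one]
        rw [hr, this]
        have : 0 ≤ A * h₀ * 2 ^ n := by positivity
        linarith
      have hterm : ∀ x : H, jonesBeta E (closedBall x r) ^ 2 * Metric.diam (closedBall x r) ≤
          D ^ 2 / (2 * A * h₀) * (1 / 2) ^ n := by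
        intro x
        have h1 := jonesBeta_mul_diam_le hE (closedBall x r)
        rw [hdiam x hr0.le] at h1 ⊢
        have h2 := jonesBeta_nonneg E (closedBall x r)
        calc jonesBeta E (closedBall x r) ^ 2 * (2 * r)
            = (jonesBeta E (closedBall x r) * (2 * r)) ^ 2 / (2 * r) := by field_simp
          _ ≤ D ^ 2 / (2 * (A * h₀ * 2 ^ n)) := by gcongr
          _ = _ := by rw [one_div, inv_pow]; field_simp
      refine (Finset.sum_le_card_nsmul _ _ _ fun x _ => hterm x).trans ?_
      rw [nsmul_eq_mul, hM, mul_assoc (_ : ℝ) _ ((1 / 2 : ℝ) ^ n)]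
      refine mul_le_mul_of_nonneg_right ?_ (by positivity)
      exact_mod_cast Finset.card_le_card (Finset.filter_subset _ _)
    · have hM0 : 0 ≤ M := by positivity
      have hsum : Summable fun n : ℕ => M * (1 / 2 : ℝ) ^ n := summable_geometric_two.mul_left M
      rw [← ENNReal.ofReal_tsum_of_nonneg (fun n => by positivity) hsum]
      exact ENNReal.ofReal_lt_top

end Necessity

/-- Corollary 1.4: Schul's Analyst's Traveling Salesman theorem in Hilbert space. -/
theorem statement7 (A : ℝ) (hA : 240 ≤ A) :
    (∀ (H : Type u) [NormedAddCommGroup H] [InnerProductSpace ℝ H] [CompleteSpace H]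
        [MeasurableSpace H] [BorelSpace H] (E : Set H) (net : ℤ → Set H),
        E.Nonempty → IsBounded E → IsMultiresolution E net →
        ((∃ Γ : Set H, E ⊆ Γ ∧ IsRectifiableCurve Γ) ↔ betaSum E net A 2 < ⊤)) ∧
    ∃ C : ℝ, 0 < C ∧
      ∀ (H : Type u) [NormedAddCommGroup H] [InnerProductSpace ℝ H] [CompleteSpace H]
        [MeasurableSpace H] [BorelSpace H] (E : Set H) (net : ℤ → Set H),
        E.Nonempty → IsBounded E → IsMultiresolution E net → betaSum E net A 2 < ⊤ →
        ∃ Γ : Set H, E ⊆ Γ ∧ IsRectifiableCurve Γ ∧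
          μH[1] Γ ≤ ENNReal.ofReal C * SEp E net A 2 := by
  refine ⟨fun H _ _ _ _ _ E net hne hE hnet => ⟨?_, fun hsum => ?_⟩, 80000000 * A, by linarith,
    fun H _ _ _ _ _ E net hne hE hnet hsum => exists_curve_of_betaSum hA hne hE hnet hsum⟩
  · rintro ⟨Γ, hEΓ, hΓ⟩
    exact betaSum_lt_top_of_subset hA hE hnet hEΓ hΓ
  · obtain ⟨Γ, hEΓ, hΓ, -⟩ := exists_curve_of_betaSum hA hne hE hnet hsum
    exact ⟨Γ, hEΓ, hΓ⟩

end
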